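/- Interior-to-axis Hölder regularity for the weighted degenerate equation (Hölder part of Lemma 4.2): let I ⊂ ℝ be an open interval, r0 > 0, N > 2, and constants 0 < c_W ≤ C_W, 0 < κ ≤ K, L ≥ 0. Let W : (0,r0) → ℝ be measurable with c_W·r^{N−1} ≤ W(r) ≤ C_W·r^{N−1} for all r ∈ (0,r0); let A : (0,r0) → ℝ and B : (0,r0) × I → ℝ be measurable with κ ≤ A ≤ K and κ ≤ B ≤ K, and D : (0,r0) → ℝ measurable with |D| ≤ L. Let Z̃ : (0,r0) × I → ℝ be measurable and bounded, and let g_r, g_t : (0,r0) × I → ℝ be measurable, square-integrable on every compact subset of (0,r0) × I, such that for every infinitely differentiable Φ : ℝ² → ℝ with compact support contained in (0,r0) × I: (a) ∬ Z̃·∂_rΦ dr dt = −∬ g_r·Φ dr dt and ∬ Z̃·∂_tΦ dr dt = −∬ g_t·Φ dr dt (g_r, g_t are the weak partial derivatives of Z̃), and (b) ∬ W(r)·[ B(r,t)·g_t(r,t)·∂_tΦ(r,t) + A(r)·g_r(r,t)·∂_rΦ(r,t) − D(r)·Z̃(r,t)·Φ(r,t) ] dr dt = 0. Then there exist α ∈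 (0,1) and a function Z* : [0,r0) × I → ℝ such that Z* = Z̃ almost everywhere on (0,r0) × I and Z* is α-Hölder continuous on every compact subset of [0,r0) × I. -/

import Mathlib

open Set MeasureTheory
open Filter Topology

theorem sq_integral_le_measure_mul {α : Type*} [MeasurableSpace α] {ν : Measure α}
    [IsFiniteMeasure ν] {f : α → ℝ} (hf : Integrable f ν) (hf2 : Integrable (fun x => f x ^ 2) ν) :
    (∫ x, f x ∂ν) ^ 2 ≤ ν.real univ * ∫ x, f x ^ 2 ∂ν := by
  set V := ν.real univ with hV
  have key : ∀ c : ℝ, 0 ≤ (∫ x, f x ^ 2 ∂ν) - 2 * c * (∫ x, f x ∂ν) + c ^ 2 * V := by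
    intro c
    have h0 : 0 ≤ ∫ x, (f x - c) ^ 2 ∂ν := integral_nonneg fun x => sq_nonneg _
    have h1 : ∫ x, (f x - c) ^ 2 ∂ν
        = (∫ x, f x ^ 2 ∂ν) - 2 * c * (∫ x, f x ∂ν) + c ^ 2 * V := by
      have : (fun x => (f x - c) ^ 2) = fun x => (f x ^ 2 - (2 * c) * f x) + c ^ 2 := by
        ext x; ring
      have hi : Integrable (fun x => f x ^ 2 - (2 * c) * f x) ν := hf2.sub (hf.const_mul _)
      rw [this, integral_add hi (integrable_const _),
        integral_sub hf2 (hf.const_mul _), integral_const_mul, integral_const]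
      simp [hV, mul_comm]
    linarith
  by_cases h : V = 0
  · have hz : ν = 0 := by
      rw [hV] at h
      have := (measureReal_eq_zero_iff (measure_ne_top ν univ)).1 h
      exact Measure.measure_univ_eq_zero.1 this
    simp [hz]
  · have hVpos : 0 < V := lt_of_le_of_ne measureReal_nonneg (Ne.symm h)
    have := key ((∫ x, f x ∂ν) / V)
    have h2 : (∫ x, f x ^ 2 ∂ν) - 2 * ((∫ x, f x ∂ν) / V) * (∫ x, f x ∂ν)
        + ((∫ x, f x ∂ν) / V) ^ 2 * V = (∫ x, f x ^ 2 ∂ν) - (∫ x, f x ∂ν) ^ 2 / V := by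
      field_simp; ring
    rw [h2] at this
    have h3 : (∫ x, f x ∂ν) ^ 2 / V ≤ ∫ x, f x ^ 2 ∂ν := by linarith
    rwa [div_le_iff₀ hVpos, mul_comm] at h3

theorem sq_intervalIntegral_le {f : ℝ → ℝ} (hf : Continuous f) {x y : ℝ} (hxy : x ≤ y) :
    (∫ s in x..y, f s) ^ 2 ≤ (y - x) * ∫ s in x..y, f s ^ 2 := by
  have hi : ∀ g : ℝ → ℝ, Continuous g → Integrable g (volume.restrict (Ioc x y)) := fun g hg =>
    (hg.integrableOn_Icc (a := x) (b := y)).mono_set Ioc_subset_Icc_self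
  have := sq_integral_le_measure_mul (hi f hf) (hi _ (hf.pow 2))
  rw [intervalIntegral.integral_of_le hxy, intervalIntegral.integral_of_le hxy]
  simpa [measureReal_def, hxy] using this

theorem weighted_increment_le {ρ f f' : ℝ → ℝ} {a b x y : ℝ} (hρ : Continuous ρ)
    (hmono : MonotoneOn ρ (Icc a b)) (hnn : ∀ s ∈ Icc a b, 0 ≤ ρ s)
    (hf : ∀ s, HasDerivAt f (f' s) s) (hf' : Continuous f')
    (hax : a ≤ x) (hxy : x ≤ y) (hyb : y ≤ b) :
    ρ x * (f y - f x) ^ 2 ≤ (b - a) * ∫ s in a..b, ρ s * f' s ^ 2 := by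
  have h1 : f y - f x = ∫ s in x..y, f' s :=
    (intervalIntegral.integral_eq_sub_of_hasDerivAt (fun s _ => hf s)
      (hf'.intervalIntegrable _ _)).symm
  have hx0 : 0 ≤ ρ x := hnn x ⟨hax, hxy.trans hyb⟩
  have hnonneg : ∀ s ∈ Icc a b, 0 ≤ ρ s * f' s ^ 2 := fun s hs =>
    mul_nonneg (hnn s hs) (sq_nonneg _)
  have hc : Continuous fun s => ρ s * f' s ^ 2 := hρ.mul (hf'.pow 2)
  have h2 : ∫ s in x..y, ρ x * f' s ^ 2 ≤ ∫ s in x..y, ρ s * f' s ^ 2 := by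
    apply intervalIntegral.integral_mono_on hxy
      ((continuous_const.mul (hf'.pow 2)).intervalIntegrable _ _) (hc.intervalIntegrable _ _)
    intro s hs
    exact mul_le_mul_of_nonneg_right
      (hmono ⟨hax, hxy.trans hyb⟩ ⟨hax.trans hs.1, hs.2.trans hyb⟩ hs.1) (sq_nonneg _)
  have h3 : ∫ s in x..y, ρ s * f' s ^ 2 ≤ ∫ s in a..b, ρ s * f' s ^ 2 := by
    rw [intervalIntegral.integral_of_le hxy,
      intervalIntegral.integral_of_le (hax.trans (hxy.trans hyb))]
    apply setIntegral_mono_set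
    · exact (hc.integrableOn_Icc (a := a) (b := b)).mono_set Ioc_subset_Icc_self
    · exact (ae_restrict_iff' measurableSet_Ioc).2
        (Eventually.of_forall fun s hs => hnonneg s (Ioc_subset_Icc_self hs))
    · exact (Ioc_subset_Ioc hax hyb).eventuallyLE
  have h4 : 0 ≤ ∫ s in a..b, ρ s * f' s ^ 2 :=
    intervalIntegral.integral_nonneg (hax.trans (hxy.trans hyb)) hnonneg
  calc ρ x * (f y - f x) ^ 2 ≤ ρ x * ((y - x) * ∫ s in x..y, f' s ^ 2) := by
        rw [h1]; exact mul_le_mul_of_nonneg_left (sq_intervalIntegral_le hf' hxy) hx0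
    _ = (y - x) * ∫ s in x..y, ρ x * f' s ^ 2 := by
        rw [intervalIntegral.integral_const_mul]; ring
    _ ≤ (y - x) * ∫ s in a..b, ρ s * f' s ^ 2 :=
        mul_le_mul_of_nonneg_left (h2.trans h3) (by linarith)
    _ ≤ _ := mul_le_mul_of_nonneg_right (by linarith) h4

theorem setIntegral_Icc_prod_Icc {f : ℝ × ℝ → ℝ} (hf : Continuous f) {a b c d : ℝ}
    (hab : a ≤ b) (hcd : c ≤ d) :
    ∫ p in Icc a b ×ˢ Icc c d, f p = ∫ t in c..d, ∫ s in a..b, f (s, t) := by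
  have hint : IntegrableOn f (Icc a b ×ˢ Icc c d) :=
    hf.continuousOn.integrableOn_compact (isCompact_Icc.prod isCompact_Icc)
  rw [Measure.volume_eq_prod, ← setIntegral_prod_swap, setIntegral_prod]
  · simp only [Prod.swap_prod_mk]
    rw [integral_Icc_eq_integral_Ioc, intervalIntegral.integral_of_le hcd]
    congr 1
    ext t
    rw [integral_Icc_eq_integral_Ioc, intervalIntegral.integral_of_le hab]
  · exact (hf.comp continuous_swap).continuousOn.integrableOn_compact
      (isCompact_Icc.prod isCompact_Icc)

theorem setIntegral_Icc_prod_Icc' {f : ℝ × ℝ → ℝ} (hf : Continuous f) {a b c d : ℝ}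
    (hab : a ≤ b) (hcd : c ≤ d) :
    ∫ p in Icc a b ×ˢ Icc c d, f p = ∫ s in a..b, ∫ t in c..d, f (s, t) := by
  have hint : IntegrableOn f (Icc a b ×ˢ Icc c d) :=
    hf.continuousOn.integrableOn_compact (isCompact_Icc.prod isCompact_Icc)
  rw [Measure.volume_eq_prod, setIntegral_prod _ (by rwa [← Measure.volume_eq_prod])]
  rw [integral_Icc_eq_integral_Ioc, intervalIntegral.integral_of_le hab]
  congr 1
  ext t
  rw [integral_Icc_eq_integral_Ioc, intervalIntegral.integral_of_le hcd]

theorem hasDerivAt_fst_slice {v : ℝ × ℝ → ℝ} (hv : ContDiff ℝ 1 v) (r t : ℝ) :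
    HasDerivAt (fun s => v (s, t)) (fderiv ℝ v (r, t) (1, 0)) r := by
  have h := (hv.differentiable one_ne_zero (r, t)).hasFDerivAt
  exact h.comp_hasDerivAt r ((hasDerivAt_id r).prodMk (hasDerivAt_const r t))

theorem hasDerivAt_snd_slice {v : ℝ × ℝ → ℝ} (hv : ContDiff ℝ 1 v) (r t : ℝ) :
    HasDerivAt (fun s => v (r, s)) (fderiv ℝ v (r, t) (0, 1)) t := by
  have h := (hv.differentiable one_ne_zero (r, t)).hasFDerivAt
  exact h.comp_hasDerivAt t ((hasDerivAt_const t r).prodMk (hasDerivAt_id t))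

theorem continuous_fderiv_apply_const {v : ℝ × ℝ → ℝ} (hv : ContDiff ℝ 1 v) (e : ℝ × ℝ) :
    Continuous fun p => fderiv ℝ v p e :=
  (hv.continuous_fderiv one_ne_zero).clm_apply continuous_const

/-- A weighted Ladyzhenskaya inequality for functions vanishing on the sides `r = b`, `t = c`. -/
theorem weighted_ladyzhenskaya {ρ : ℝ → ℝ} {v : ℝ × ℝ → ℝ} {a b c d l : ℝ} (hρ : Continuous ρ)
    (hmono : MonotoneOn ρ (Icc a b)) (hnn : ∀ s ∈ Icc a b, 0 ≤ ρ s)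
    (hv : ContDiff ℝ 1 v) (hab : a ≤ b) (hcd : c ≤ d) (hl : 0 < l) (hbl : b - a ≤ l)
    (hvb : ∀ t, v (b, t) = 0) (hvc : ∀ r, v (r, c) = 0) :
    ∫ p in Icc a b ×ˢ Icc c d, (ρ p.1 * v p ^ 2) ^ 2 ≤
      (l⁻¹ * (∫ p in Icc a b ×ˢ Icc c d, ρ p.1 * v p ^ 2)
        + l * ∫ p in Icc a b ×ˢ Icc c d,
          ρ p.1 * (fderiv ℝ v p (1, 0) ^ 2 + fderiv ℝ v p (0, 1) ^ 2)) ^ 2 := by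
  have hvc' := hv.continuous
  have hr := continuous_fderiv_apply_const hv (1, 0)
  have ht := continuous_fderiv_apply_const hv (0, 1)
  have hρ1 : Continuous fun p : ℝ × ℝ => ρ p.1 := hρ.comp continuous_fst
  set Vr : ℝ × ℝ → ℝ := fun p => fderiv ℝ v p (1, 0) with hVr
  set Vt : ℝ × ℝ → ℝ := fun p => fderiv ℝ v p (0, 1) with hVt
  have cont1 : Continuous fun p : ℝ × ℝ => ρ p.1 * v p ^ 2 := hρ1.mul (hvc'.pow 2)
  have contr : Continuous fun p : ℝ × ℝ => ρ p.1 * Vr p ^ 2 := hρ1.mul (hr.pow 2)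
  have contt : Continuous fun p : ℝ × ℝ => ρ p.1 * Vt p ^ 2 := hρ1.mul (ht.pow 2)
  have ion : ∀ f : ℝ × ℝ → ℝ, Continuous f → IntegrableOn f (Icc a b ×ˢ Icc c d) := fun f hf =>
    hf.continuousOn.integrableOn_compact (isCompact_Icc.prod isCompact_Icc)
  have ms : MeasurableSet (Icc a b ×ˢ Icc c d) := measurableSet_Icc.prod measurableSet_Icc
  have nn1 : 0 ≤ ∫ p in Icc a b ×ˢ Icc c d, ρ p.1 * v p ^ 2 :=
    setIntegral_nonneg ms fun p hp => mul_nonneg (hnn _ hp.1) (sq_nonneg _)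
  have nnr : 0 ≤ ∫ p in Icc a b ×ˢ Icc c d, ρ p.1 * Vr p ^ 2 :=
    setIntegral_nonneg ms fun p hp => mul_nonneg (hnn _ hp.1) (sq_nonneg _)
  have nnt : 0 ≤ ∫ p in Icc a b ×ˢ Icc c d, ρ p.1 * Vt p ^ 2 :=
    setIntegral_nonneg ms fun p hp => mul_nonneg (hnn _ hp.1) (sq_nonneg _)
  have hsplit : ∫ p in Icc a b ×ˢ Icc c d, ρ p.1 * (Vr p ^ 2 + Vt p ^ 2)
      = (∫ p in Icc a b ×ˢ Icc c d, ρ p.1 * Vr p ^ 2)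
        + ∫ p in Icc a b ×ˢ Icc c d, ρ p.1 * Vt p ^ 2 := by
    rw [← integral_add (ion _ contr) (ion _ contt)]
    simp only [mul_add]
  rw [hsplit]
  set X := ∫ p in Icc a b ×ˢ Icc c d, ρ p.1 * v p ^ 2 with hX
  set Er := ∫ p in Icc a b ×ˢ Icc c d, ρ p.1 * Vr p ^ 2 with hEr
  set Et := ∫ p in Icc a b ×ˢ Icc c d, ρ p.1 * Vt p ^ 2 with hEt
  set E := l⁻¹ * X + l * (Er + Et) with hE
  have li : 0 < l⁻¹ := inv_pos.2 hl
  have hEnn : 0 ≤ E := by positivity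
  set G : ℝ → ℝ := fun t => ∫ s in a..b, ρ s * Vr (s, t) ^ 2 with hG
  set h : ℝ → ℝ := fun t => ∫ s in a..b, ρ s * v (s, t) ^ 2 with hh
  have pc : ∀ f : ℝ × ℝ → ℝ, Continuous f → Continuous fun t => ∫ s in a..b, f (s, t) := by
    intro f hf
    exact intervalIntegral.continuous_parametric_intervalIntegral_of_continuous'
      (f := fun t s => f (s, t)) (hf.comp continuous_swap) a b
  have hGc : Continuous G := pc _ contr
  have hhc : Continuous h := pc _ cont1
  have hGnn : ∀ t, 0 ≤ G t := fun t => intervalIntegral.integral_nonneg hab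
    fun s hs => mul_nonneg (hnn _ hs) (sq_nonneg _)
  have point : ∀ s ∈ Icc a b, ∀ t, ρ s * v (s, t) ^ 2 ≤ l * G t := by
    intro s hs t
    have := weighted_increment_le hρ hmono hnn (fun r => hasDerivAt_fst_slice hv r t)
      (hr.comp (continuous_id.prodMk continuous_const)) hs.1 hs.2 le_rfl
    simp only [hvb, zero_sub, neg_sq] at this
    exact this.trans (mul_le_mul_of_nonneg_right hbl (hGnn t))
  have hbound : ∀ t ∈ Icc c d, h t ≤ E := by
    intro t htm
    have hslice : ∀ s, v (s, t) ^ 2 ≤ ∫ τ in c..d, (l⁻¹ * v (s, τ) ^ 2 + l * Vt (s, τ) ^ 2) := by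
      intro s
      have hd : ∀ τ, HasDerivAt (fun τ => v (s, τ) ^ 2) (2 * v (s, τ) * Vt (s, τ)) τ := by
        intro τ
        have := (hasDerivAt_snd_slice hv s τ).pow 2
        simp only [Nat.cast_ofNat, Nat.add_one_sub_one, pow_one] at this
        exact this
      have hcs : Continuous fun τ : ℝ => ((s, τ) : ℝ × ℝ) := continuous_const.prodMk continuous_id
      have c1 : Continuous fun τ => 2 * v (s, τ) * Vt (s, τ) :=
        (continuous_const.mul (hvc'.comp hcs)).mul (ht.comp hcs)
      have c2 : Continuous fun τ => (l⁻¹ * v (s, τ) ^ 2 + l * Vt (s, τ) ^ 2) :=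
        (continuous_const.mul ((hvc'.comp hcs).pow 2)).add
          (continuous_const.mul ((ht.comp hcs).pow 2))
      have e1 : ∫ τ in c..t, 2 * v (s, τ) * Vt (s, τ) = v (s, t) ^ 2 := by
        rw [intervalIntegral.integral_eq_sub_of_hasDerivAt (fun τ _ => hd τ)
          (c1.intervalIntegrable _ _), hvc]; ring
      rw [← e1]
      have e2 : ∫ τ in c..t, 2 * v (s, τ) * Vt (s, τ) ≤
          ∫ τ in c..t, (l⁻¹ * v (s, τ) ^ 2 + l * Vt (s, τ) ^ 2) := by
        apply intervalIntegral.integral_mono_on htm.1 (c1.intervalIntegrable _ _)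
          (c2.intervalIntegrable _ _)
        intro τ _
        have hsq := mul_nonneg li.le (sq_nonneg (v (s, τ) - l * Vt (s, τ)))
        have : l⁻¹ * (v (s, τ) - l * Vt (s, τ)) ^ 2
          = l⁻¹ * v (s, τ) ^ 2 - 2 * v (s, τ) * Vt (s, τ) + l * Vt (s, τ) ^ 2 := by
          field_simp
          ring
        linarith
      refine e2.trans ?_
      rw [intervalIntegral.integral_of_le htm.1, intervalIntegral.integral_of_le hcd]
      apply setIntegral_mono_set
      · exact (c2.integrableOn_Icc (a := c) (b := d)).mono_set Ioc_subset_Icc_self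
      · exact Eventually.of_forall fun τ => by simp only [Pi.zero_apply]; positivity
      · exact (Ioc_subset_Ioc le_rfl htm.2).eventuallyLE
    have cc : Continuous fun p : ℝ × ℝ => ρ p.1 * (l⁻¹ * v p ^ 2 + l * Vt p ^ 2) :=
      hρ1.mul ((continuous_const.mul (hvc'.pow 2)).add (continuous_const.mul (ht.pow 2)))
    have e3 : h t ≤ ∫ s in a..b, ∫ τ in c..d, ρ s * (l⁻¹ * v (s, τ) ^ 2 + l * Vt (s, τ) ^ 2) := by
      apply intervalIntegral.integral_mono_on hab
      · exact (cont1.comp (continuous_id.prodMk continuous_const)).intervalIntegrable _ _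
      · exact (intervalIntegral.continuous_parametric_intervalIntegral_of_continuous'
          (f := fun s τ => ρ s * (l⁻¹ * v (s, τ) ^ 2 + l * Vt (s, τ) ^ 2)) cc c d).intervalIntegrable
            _ _
      · intro s hs
        rw [intervalIntegral.integral_const_mul]
        exact mul_le_mul_of_nonneg_left (hslice s) (hnn s hs)
    rw [← setIntegral_Icc_prod_Icc' cc hab hcd] at e3
    have e4 : ∫ p in Icc a b ×ˢ Icc c d, ρ p.1 * (l⁻¹ * v p ^ 2 + l * Vt p ^ 2)
        = l⁻¹ * X + l * Et := by
      rw [hX, hEt, ← integral_const_mul, ← integral_const_mul, ← integral_add]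
      · congr 1; ext p; ring
      · exact (ion _ cont1).const_mul _
      · exact (ion _ contt).const_mul _
    rw [e4] at e3
    have : 0 ≤ l * Er := by positivity
    linarith
  have hhnn : ∀ t, 0 ≤ h t := fun t => intervalIntegral.integral_nonneg hab
    fun s hs => mul_nonneg (hnn _ hs) (sq_nonneg _)
  have cont2 : Continuous fun p : ℝ × ℝ => (ρ p.1 * v p ^ 2) ^ 2 := cont1.pow 2
  rw [setIntegral_Icc_prod_Icc cont2 hab hcd]
  have f1 : ∫ t in c..d, ∫ s in a..b, (ρ s * v (s, t) ^ 2) ^ 2 ≤ ∫ t in c..d, E * (l * G t) := by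
    apply intervalIntegral.integral_mono_on hcd ((pc _ cont2).intervalIntegrable _ _)
      ((continuous_const.mul (continuous_const.mul hGc)).intervalIntegrable _ _)
    intro t htm
    calc ∫ s in a..b, (ρ s * v (s, t) ^ 2) ^ 2 ≤ ∫ s in a..b, (l * G t) * (ρ s * v (s, t) ^ 2) := by
          apply intervalIntegral.integral_mono_on hab
          · exact (cont2.comp (continuous_id.prodMk continuous_const)).intervalIntegrable
              _ _
          · exact ((continuous_const.mul cont1).comp
              (continuous_id.prodMk continuous_const)).intervalIntegrable _ _
          · intro s hs
            rw [sq]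
            exact mul_le_mul_of_nonneg_right (point s hs t)
              (mul_nonneg (hnn _ hs) (sq_nonneg _))
      _ = (l * G t) * h t := by rw [intervalIntegral.integral_const_mul]
      _ ≤ (l * G t) * E := mul_le_mul_of_nonneg_left (hbound t htm) (mul_nonneg hl.le (hGnn t))
      _ = E * (l * G t) := mul_comm _ _
  have f2 : ∫ t in c..d, E * (l * G t) = E * (l * Er) := by
    rw [intervalIntegral.integral_const_mul, intervalIntegral.integral_const_mul, hEr,
      setIntegral_Icc_prod_Icc contr hab hcd]
  rw [f2] at f1
  refine f1.trans ?_
  rw [sq]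
  apply mul_le_mul_of_nonneg_left _ hEnn
  have : 0 ≤ l⁻¹ * X + l * Et := by positivity
  linarith [mul_add l Er Et]

theorem weighted_double_increment_le {ρ : ℝ → ℝ} {v : ℝ × ℝ → ℝ} {a b c d l : ℝ}
    (hρ : Continuous ρ) (hmono : MonotoneOn ρ (Icc a b)) (hnn : ∀ s ∈ Icc a b, 0 ≤ ρ s)
    (hv : ContDiff ℝ 1 v) (hab : a ≤ b) (hcd : c ≤ d) (hbl : b - a ≤ l) (hdl : d - c ≤ l) :
    ∫ z in (Icc a b ×ˢ Icc c d) ×ˢ (Icc a b ×ˢ Icc c d),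
        ρ z.1.1 * ρ z.2.1 * (v z.1 - v z.2) ^ 2 ≤
      2 * ρ b * l ^ 2 * ((b - a) * (d - c)) * ∫ p in Icc a b ×ˢ Icc c d,
          ρ p.1 * (fderiv ℝ v p (1, 0) ^ 2 + fderiv ℝ v p (0, 1) ^ 2) := by
  have hl : 0 ≤ l := by linarith
  have hvc' := hv.continuous
  have hr := continuous_fderiv_apply_const hv (1, 0)
  have ht := continuous_fderiv_apply_const hv (0, 1)
  have hρ1 : Continuous fun p : ℝ × ℝ => ρ p.1 := hρ.comp continuous_fst
  set Vr : ℝ × ℝ → ℝ := fun p => fderiv ℝ v p (1, 0) with hVr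
  set Vt : ℝ × ℝ → ℝ := fun p => fderiv ℝ v p (0, 1) with hVt
  have contr : Continuous fun p : ℝ × ℝ => ρ p.1 * Vr p ^ 2 := hρ1.mul (hr.pow 2)
  have contt : Continuous fun p : ℝ × ℝ => ρ p.1 * Vt p ^ 2 := hρ1.mul (ht.pow 2)
  have hQc : IsCompact (Icc a b ×ˢ Icc c d) := isCompact_Icc.prod isCompact_Icc
  have ion : ∀ f : ℝ × ℝ → ℝ, Continuous f → IntegrableOn f (Icc a b ×ˢ Icc c d) := fun f hf =>
    hf.continuousOn.integrableOn_compact hQc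
  have ion2 : ∀ f : (ℝ × ℝ) × (ℝ × ℝ) → ℝ, Continuous f →
      IntegrableOn f ((Icc a b ×ˢ Icc c d) ×ˢ (Icc a b ×ˢ Icc c d)) := fun f hf =>
    hf.continuousOn.integrableOn_compact (hQc.prod hQc)
  have ms : MeasurableSet (Icc a b ×ˢ Icc c d) := measurableSet_Icc.prod measurableSet_Icc
  have hb0 : 0 ≤ ρ b := hnn b ⟨hab, le_rfl⟩
  set G : ℝ → ℝ := fun t => ∫ s in a..b, ρ s * Vr (s, t) ^ 2 with hG
  set H : ℝ → ℝ := fun s => ∫ t in c..d, ρ s * Vt (s, t) ^ 2 with hH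
  have hGc : Continuous G :=
    intervalIntegral.continuous_parametric_intervalIntegral_of_continuous'
      (f := fun t s => ρ s * Vr (s, t) ^ 2) (contr.comp continuous_swap) a b
  have hHc : Continuous H :=
    intervalIntegral.continuous_parametric_intervalIntegral_of_continuous'
      (f := fun s t => ρ s * Vt (s, t) ^ 2) contt c d
  have horiz : ∀ t, ∀ x ∈ Icc a b, ∀ y ∈ Icc a b,
      ρ x * ρ y * (v (x, t) - v (y, t)) ^ 2 ≤ ρ b * (l * G t) := by
    have base : ∀ t, ∀ x ∈ Icc a b, ∀ y ∈ Icc a b, x ≤ y →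
        ρ x * ρ y * (v (x, t) - v (y, t)) ^ 2 ≤ ρ b * (l * G t) := by
      intro t x hx y hy hxy
      have h1 := weighted_increment_le hρ hmono hnn (fun r => hasDerivAt_fst_slice hv r t)
        (hr.comp (continuous_id.prodMk continuous_const)) hx.1 hxy hy.2
      have h2 : 0 ≤ ρ x * (v (y, t) - v (x, t)) ^ 2 := mul_nonneg (hnn x hx) (sq_nonneg _)
      have hGt : 0 ≤ G t := intervalIntegral.integral_nonneg hab
        fun s hs => mul_nonneg (hnn _ hs) (sq_nonneg _)
      calc ρ x * ρ y * (v (x, t) - v (y, t)) ^ 2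
          = ρ y * (ρ x * (v (y, t) - v (x, t)) ^ 2) := by ring
        _ ≤ ρ b * (ρ x * (v (y, t) - v (x, t)) ^ 2) :=
          mul_le_mul_of_nonneg_right (hmono hy ⟨hab, le_rfl⟩ hy.2) h2
        _ ≤ ρ b * (l * G t) := mul_le_mul_of_nonneg_left
          (h1.trans (mul_le_mul_of_nonneg_right hbl hGt)) hb0
    intro t x hx y hy
    rcases le_total x y with h | h
    · exact base t x hx y hy h
    · have := base t y hy x hx h
      calc _ = ρ y * ρ x * (v (y, t) - v (x, t)) ^ 2 := by ring
        _ ≤ _ := this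
  have vert : ∀ s ∈ Icc a b, ∀ x ∈ Icc c d, ∀ y ∈ Icc c d,
      ρ s * (v (s, x) - v (s, y)) ^ 2 ≤ l * H s := by
    have base : ∀ s ∈ Icc a b, ∀ x ∈ Icc c d, ∀ y ∈ Icc c d, x ≤ y →
        ρ s * (v (s, x) - v (s, y)) ^ 2 ≤ l * H s := by
      intro s hs x hx y hy hxy
      have h1 := weighted_increment_le (ρ := fun _ => ρ s) continuous_const
        (fun _ _ _ _ _ => le_rfl) (fun _ _ => hnn s hs) (fun t => hasDerivAt_snd_slice hv s t)
        (ht.comp (continuous_const.prodMk continuous_id)) hx.1 hxy hy.2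
      have hHs : 0 ≤ H s := intervalIntegral.integral_nonneg hcd
        fun t _ => mul_nonneg (hnn _ hs) (sq_nonneg _)
      calc ρ s * (v (s, x) - v (s, y)) ^ 2 = ρ s * (v (s, y) - v (s, x)) ^ 2 := by ring
        _ ≤ (d - c) * H s := h1
        _ ≤ l * H s := mul_le_mul_of_nonneg_right hdl hHs
    intro s hs x hx y hy
    rcases le_total x y with h | h
    · exact base s hs x hx y hy h
    · have := base s hs y hy x hx h
      calc _ = ρ s * (v (s, y) - v (s, x)) ^ 2 := by ring
        _ ≤ _ := this
  have hpt : ∀ z ∈ (Icc a b ×ˢ Icc c d) ×ˢ (Icc a b ×ˢ Icc c d),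
      ρ z.1.1 * ρ z.2.1 * (v z.1 - v z.2) ^ 2 ≤ 2 * ρ b * l * (G z.1.2 + H z.2.1) := by
    rintro ⟨⟨x, t⟩, ⟨y, τ⟩⟩ ⟨⟨hx, htt⟩, ⟨hy, hτ⟩⟩
    have h1 := horiz t x hx y hy
    have h2 := vert y hy t htt τ hτ
    have h3 : ρ x * (ρ y * (v (y, t) - v (y, τ)) ^ 2) ≤ ρ b * (l * H y) :=
      mul_le_mul (hmono hx ⟨hab, le_rfl⟩ hx.2) h2 (mul_nonneg (hnn y hy) (sq_nonneg _)) hb0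
    have h4 : 0 ≤ ρ x * ρ y * (v (x, t) - v (y, t) - (v (y, t) - v (y, τ))) ^ 2 :=
      mul_nonneg (mul_nonneg (hnn x hx) (hnn y hy)) (sq_nonneg _)
    simp only
    nlinarith
  have cG : Continuous fun p : ℝ × ℝ => G p.2 := hGc.comp continuous_snd
  have cH : Continuous fun p : ℝ × ℝ => H p.1 := hHc.comp continuous_fst
  have cL : Continuous fun z : (ℝ × ℝ) × (ℝ × ℝ) => ρ z.1.1 * ρ z.2.1 * (v z.1 - v z.2) ^ 2 :=
    ((hρ1.comp continuous_fst).mul (hρ1.comp continuous_snd)).mul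
      (((hvc'.comp continuous_fst).sub (hvc'.comp continuous_snd)).pow 2)
  have c1 : Continuous fun z : (ℝ × ℝ) × (ℝ × ℝ) => G z.1.2 := cG.comp continuous_fst
  have c2 : Continuous fun z : (ℝ × ℝ) × (ℝ × ℝ) => H z.2.1 := cH.comp continuous_snd
  have hvol : volume.real (Icc a b ×ˢ Icc c d) = (b - a) * (d - c) := by
    rw [Measure.volume_eq_prod, measureReal_prod_prod]
    simp [measureReal_def, hab, hcd]
  have hI1 : ∫ z in (Icc a b ×ˢ Icc c d) ×ˢ (Icc a b ×ˢ Icc c d), G z.1.2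
      = ((b - a) * (d - c)) * ((b - a) * ∫ p in Icc a b ×ˢ Icc c d, ρ p.1 * Vr p ^ 2) := by
    have hi := ion2 _ c1
    rw [Measure.volume_eq_prod] at hi ⊢
    rw [setIntegral_prod _ hi]
    simp only [setIntegral_const, smul_eq_mul]
    rw [integral_const_mul, hvol, setIntegral_Icc_prod_Icc cG hab hcd,
      setIntegral_Icc_prod_Icc contr hab hcd]
    simp only [intervalIntegral.integral_const, smul_eq_mul, intervalIntegral.integral_const_mul]
    rfl
  have hI2 : ∫ z in (Icc a b ×ˢ Icc c d) ×ˢ (Icc a b ×ˢ Icc c d), H z.2.1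
      = ((b - a) * (d - c)) * ((d - c) * ∫ p in Icc a b ×ˢ Icc c d, ρ p.1 * Vt p ^ 2) := by
    have hi := ion2 _ c2
    rw [Measure.volume_eq_prod] at hi ⊢
    rw [setIntegral_prod _ hi]
    simp only [setIntegral_const, smul_eq_mul]
    rw [hvol, setIntegral_Icc_prod_Icc' cH hab hcd,
      setIntegral_Icc_prod_Icc' contt hab hcd]
    simp only [intervalIntegral.integral_const, smul_eq_mul, hH]
    simp only [intervalIntegral.integral_const_mul]
  have nnr : 0 ≤ ∫ p in Icc a b ×ˢ Icc c d, ρ p.1 * Vr p ^ 2 :=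
    setIntegral_nonneg ms fun p hp => mul_nonneg (hnn _ hp.1) (sq_nonneg _)
  have nnt : 0 ≤ ∫ p in Icc a b ×ˢ Icc c d, ρ p.1 * Vt p ^ 2 :=
    setIntegral_nonneg ms fun p hp => mul_nonneg (hnn _ hp.1) (sq_nonneg _)
  have hsplit : ∫ p in Icc a b ×ˢ Icc c d, ρ p.1 * (Vr p ^ 2 + Vt p ^ 2)
      = (∫ p in Icc a b ×ˢ Icc c d, ρ p.1 * Vr p ^ 2)
        + ∫ p in Icc a b ×ˢ Icc c d, ρ p.1 * Vt p ^ 2 := by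
    rw [← integral_add (ion _ contr) (ion _ contt)]
    simp only [mul_add]
  rw [hsplit]
  calc _ ≤ ∫ z in (Icc a b ×ˢ Icc c d) ×ˢ (Icc a b ×ˢ Icc c d),
        2 * ρ b * l * (G z.1.2 + H z.2.1) :=
        setIntegral_mono_on (ion2 _ cL) (ion2 _ (continuous_const.mul (c1.add c2)))
          (ms.prod ms) hpt
    _ = 2 * ρ b * l * ((b - a) * (d - c)) *
        ((b - a) * (∫ p in Icc a b ×ˢ Icc c d, ρ p.1 * Vr p ^ 2)
          + (d - c) * ∫ p in Icc a b ×ˢ Icc c d, ρ p.1 * Vt p ^ 2) := by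
        rw [integral_const_mul, integral_add (ion2 _ c1) (ion2 _ c2), hI1, hI2]; ring
    _ ≤ 2 * ρ b * l * ((b - a) * (d - c)) *
        (l * (∫ p in Icc a b ×ˢ Icc c d, ρ p.1 * Vr p ^ 2)
          + l * ∫ p in Icc a b ×ˢ Icc c d, ρ p.1 * Vt p ^ 2) := by
        have h1 : 0 ≤ b - a := by linarith
        have h2 : 0 ≤ d - c := by linarith
        gcongr
    _ = _ := by ring

theorem tendsto_integral_abs_sub_of_integral_eq {α : Type*} [MeasurableSpace α] {ν : Measure α}
    {F : ℕ → α → ℝ} {f : α → ℝ} (hF : ∀ n, Integrable (F n) ν) (hf : Integrable f ν)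
    (hFn : ∀ n, 0 ≤ᵐ[ν] F n) (hlim : ∀ᵐ x ∂ν, Tendsto (fun n => F n x) atTop (𝓝 (f x)))
    (hint : ∀ n, ∫ x, F n x ∂ν = ∫ x, f x ∂ν) :
    Tendsto (fun n => ∫ x, |F n x - f x| ∂ν) atTop (𝓝 0) := by
  have h1 : ∀ n, ∫ x, |F n x - f x| ∂ν = 2 * ∫ x, max (f x - F n x) 0 ∂ν := by
    intro n
    have hm : Integrable (fun x => max (f x - F n x) 0) ν := (hf.sub (hF n)).pos_part
    have e : (fun x => |F n x - f x|) = fun x => (F n x - f x) + 2 * max (f x - F n x) 0 := by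
      ext x
      rcases le_total (f x) (F n x) with h | h
      · rw [abs_of_nonneg (by linarith), max_eq_right (by linarith)]; ring
      · rw [abs_of_nonpos (by linarith), max_eq_left (by linarith)]; ring
    have hs : Integrable (fun x => F n x - f x) ν := (hF n).sub hf
    rw [e, integral_add hs (hm.const_mul 2), integral_sub (hF n) hf, hint n,
      integral_const_mul]
    ring
  simp only [h1]
  have h2 : Tendsto (fun n => ∫ x, max (f x - F n x) 0 ∂ν) atTop (𝓝 (∫ _x, (0:ℝ) ∂ν)) := by
    apply tendsto_integral_of_dominated_convergence (fun x => |f x|)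
    · exact fun n => ((hf.sub (hF n)).pos_part).aestronglyMeasurable
    · exact hf.abs
    · intro n
      filter_upwards [hFn n] with x hx
      have hx' : 0 ≤ F n x := hx
      rw [Real.norm_of_nonneg (le_max_right _ _)]
      exact max_le ((by linarith : f x - F n x ≤ f x).trans (le_abs_self _)) (abs_nonneg _)
    · filter_upwards [hlim] with x hx
      have : Tendsto (fun n => max (f x - F n x) 0) atTop (𝓝 (max (f x - f x) 0)) :=
        (tendsto_const_nhds.sub hx).max tendsto_const_nhds
      simpa using this
  simpa using h2.const_mul 2

theorem exists_dominated_subseq {α : Type*} [MeasurableSpace α] {ν : Measure α}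
    {F : ℕ → α → ℝ} {f : α → ℝ} (hF : ∀ n, Integrable (F n) ν) (hf : Integrable f ν)
    (hlim : Tendsto (fun n => ∫ x, |F n x - f x| ∂ν) atTop (𝓝 0)) :
    ∃ (φ : ℕ → ℕ) (S : α → ℝ), StrictMono φ ∧ Integrable S ν ∧
      ∀ᵐ x ∂ν, ∀ n, F (φ n) x ≤ S x := by
  have hev : ∀ n : ℕ, ∀ᶠ k in atTop, ∫ x, |F k x - f x| ∂ν < (1 / 2 : ℝ) ^ n := fun n =>
    hlim.eventually_lt_const (by positivity)
  obtain ⟨φ, hφ, hφ2⟩ := extraction_forall_of_eventually hev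
  set T : α → ENNReal := fun x => ∑' n, ENNReal.ofReal |F (φ n) x - f x| with hT
  have hmeas : ∀ n, AEMeasurable (fun x => ENNReal.ofReal |F (φ n) x - f x|) ν := fun n =>
    (((hF (φ n)).sub hf).abs.aestronglyMeasurable.aemeasurable).ennreal_ofReal
  have hTm : AEMeasurable T ν := AEMeasurable.tsum hmeas
  have hTint : ∫⁻ x, T x ∂ν ≠ ⊤ := by
    rw [hT, lintegral_tsum hmeas]
    have : ∀ n, ∫⁻ x, ENNReal.ofReal |F (φ n) x - f x| ∂ν ≤ ENNReal.ofReal ((1 / 2 : ℝ) ^ n) := by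
      intro n
      have hi : Integrable (fun x => |F (φ n) x - f x|) ν := ((hF (φ n)).sub hf).abs
      rw [← ofReal_integral_eq_lintegral_ofReal hi
        (Eventually.of_forall fun x => abs_nonneg _)]
      exact ENNReal.ofReal_le_ofReal (hφ2 n).le
    refine ne_top_of_le_ne_top ?_ (ENNReal.tsum_le_tsum this)
    rw [← ENNReal.ofReal_tsum_of_nonneg (fun n => by positivity) summable_geometric_two]
    exact ENNReal.ofReal_ne_top
  refine ⟨φ, fun x => f x + (T x).toReal, hφ, hf.add (integrable_toReal_of_lintegral_ne_top hTm
    hTint), ?_⟩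
  filter_upwards [ae_lt_top' hTm hTint] with x hx n
  have h1 : ENNReal.ofReal |F (φ n) x - f x| ≤ T x := ENNReal.le_tsum n
  have h2 : |F (φ n) x - f x| ≤ (T x).toReal := by
    rw [← ENNReal.toReal_ofReal (abs_nonneg (F (φ n) x - f x))]
    exact ENNReal.toReal_mono hx.ne h1
  linarith [le_abs_self (F (φ n) x - f x)]

section Mollifier
open ContinuousLinearMap
open scoped Convolution

/-- A sequence of bump functions shrinking to the origin. -/
noncomputable def shrinkingBump (n : ℕ) : ContDiffBump (0 : ℝ × ℝ) where
  rIn := 1 / (2 * (n + 1))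
  rOut := 1 / (n + 1)
  rIn_pos := by positivity
  rIn_lt_rOut := by
    apply one_div_lt_one_div_of_lt <;> [positivity; linarith [(Nat.cast_nonneg n : (0:ℝ) ≤ n)]]

/-- Mollification of a function on the plane. -/
noncomputable def mollify (n : ℕ) (f : ℝ × ℝ → ℝ) : ℝ × ℝ → ℝ :=
  (shrinkingBump n).normed volume ⋆[lsmul ℝ ℝ, volume] f

theorem tendsto_rOut_shrinkingBump : Tendsto (fun n => (shrinkingBump n).rOut) atTop (𝓝 0) :=
  tendsto_one_div_add_atTop_nhds_zero_nat

theorem mollify_apply (n : ℕ) (f : ℝ × ℝ → ℝ) (x : ℝ × ℝ) :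
    mollify n f x = ∫ y, (shrinkingBump n).normed volume (x - y) * f y := by
  rw [mollify, convolution_eq_swap]; rfl

theorem integrable_mollifier_mul {f : ℝ × ℝ → ℝ} (hf : LocallyIntegrable f) (n : ℕ) (x : ℝ × ℝ) :
    Integrable fun y => (shrinkingBump n).normed volume (x - y) * f y := by
  have h := ((shrinkingBump n).hasCompactSupport_normed (μ := volume)).convolutionExists_left
    (lsmul ℝ ℝ) (shrinkingBump n).continuous_normed hf x
  rw [← convolutionExistsAt_flip] at h
  simpa [ConvolutionExistsAt, mul_comm] using h

theorem integral_mollifier (n : ℕ) (x : ℝ × ℝ) :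
    ∫ y, (shrinkingBump n).normed volume (x - y) = 1 := by
  rw [integral_sub_left_eq_self (fun y => (shrinkingBump n).normed volume y) volume x]
  exact (shrinkingBump n).integral_normed

theorem abs_mollify_le {f : ℝ × ℝ → ℝ} {M : ℝ} (hf : LocallyIntegrable f) (hM : ∀ p, |f p| ≤ M)
    (n : ℕ) (x : ℝ × ℝ) : |mollify n f x| ≤ M := by
  rw [mollify_apply]
  have h1 := integrable_mollifier_mul (f := fun _ => (1:ℝ)) (locallyIntegrable_const 1) n x
  simp only [mul_one] at h1
  calc |∫ y, (shrinkingBump n).normed volume (x - y) * f y|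
      ≤ ∫ y, |(shrinkingBump n).normed volume (x - y) * f y| := abs_integral_le_integral_abs
    _ ≤ ∫ y, (shrinkingBump n).normed volume (x - y) * M := by
        apply integral_mono (integrable_mollifier_mul hf n x).abs (h1.mul_const M)
        intro y
        simp only [abs_mul, abs_of_nonneg ((shrinkingBump n).nonneg_normed (μ := volume) (x - y))]
        exact mul_le_mul_of_nonneg_left (hM y) ((shrinkingBump n).nonneg_normed _)
    _ = M := by rw [integral_mul_const, integral_mollifier, one_mul]

theorem sq_mollify_le {f : ℝ × ℝ → ℝ} (hf : LocallyIntegrable f)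
    (hf2 : LocallyIntegrable fun p => f p ^ 2) (n : ℕ) (x : ℝ × ℝ) :
    mollify n f x ^ 2 ≤ mollify n (fun p => f p ^ 2) x := by
  have i0 := integrable_mollifier_mul (f := fun _ => (1:ℝ)) (locallyIntegrable_const 1) n x
  simp only [mul_one] at i0
  have i1 := integrable_mollifier_mul hf n x
  have i2 := integrable_mollifier_mul hf2 n x
  set c := mollify n f x with hc
  have h0 : 0 ≤ ∫ y, (shrinkingBump n).normed volume (x - y) * (f y - c) ^ 2 :=
    integral_nonneg fun y => mul_nonneg ((shrinkingBump n).nonneg_normed _) (sq_nonneg _)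
  have e : (fun y => (shrinkingBump n).normed volume (x - y) * (f y - c) ^ 2) = fun y =>
      ((shrinkingBump n).normed volume (x - y) * f y ^ 2
        - 2 * c * ((shrinkingBump n).normed volume (x - y) * f y))
        + c ^ 2 * (shrinkingBump n).normed volume (x - y) := by
    ext y; ring
  have i3 : Integrable fun y => (shrinkingBump n).normed volume (x - y) * f y ^ 2
        - 2 * c * ((shrinkingBump n).normed volume (x - y) * f y) := i2.sub (i1.const_mul _)
  rw [e, integral_add i3 (i0.const_mul _), integral_sub i2 (i1.const_mul _), integral_const_mul,
    integral_const_mul, integral_mollifier, ← mollify_apply, ← mollify_apply, ← hc] at h0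
  linarith

theorem contDiff_mollify {f : ℝ × ℝ → ℝ} (hf : LocallyIntegrable f) (n : ℕ) :
    ContDiff ℝ (⊤ : ℕ∞) (mollify n f) :=
  ((shrinkingBump n).hasCompactSupport_normed (μ := volume)).contDiff_convolution_left _
    (shrinkingBump n).contDiff_normed hf

theorem fderiv_mollify {f : ℝ × ℝ → ℝ} (hf : LocallyIntegrable f) (n : ℕ) (x e : ℝ × ℝ) :
    fderiv ℝ (mollify n f) x e =
      ∫ y, fderiv ℝ ((shrinkingBump n).normed volume) (x - y) e * f y := by
  have hcs := (shrinkingBump n).hasCompactSupport_normed (μ := volume)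
  have hcd : ContDiff ℝ 1 ((shrinkingBump n).normed volume) := (shrinkingBump n).contDiff_normed
  have h := hcs.hasFDerivAt_convolution_left (lsmul ℝ ℝ) (μ := volume) hcd hf x
  have hE := (hcs.fderiv (𝕜 := ℝ)).convolutionExists_left ((lsmul ℝ ℝ).precompL (ℝ × ℝ))
    (hcd.continuous_fderiv one_ne_zero) hf x
  rw [mollify, h.fderiv, convolution_eq_swap]
  rw [← convolutionExistsAt_flip] at hE
  rw [ContinuousLinearMap.integral_apply]
  · rfl
  · exact hE

theorem ae_tendsto_mollify {f : ℝ × ℝ → ℝ} (hf : LocallyIntegrable f) :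
    ∀ᵐ x, Tendsto (fun n => mollify n f x) atTop (𝓝 (f x)) := by
  apply ContDiffBump.ae_convolution_tendsto_right_of_locallyIntegrable (K := 2)
    tendsto_rOut_shrinkingBump _ hf
  refine Eventually.of_forall fun n => ?_
  simp only [shrinkingBump]
  have : (0:ℝ) < n + 1 := by positivity
  apply le_of_eq
  field_simp

theorem integrable_mollify {f : ℝ × ℝ → ℝ} (hf : Integrable f) (n : ℕ) :
    Integrable (mollify n f) :=
  Integrable.integrable_convolution _ (shrinkingBump n).integrable_normed hf

theorem integral_mollify {f : ℝ × ℝ → ℝ} (hf : Integrable f) (n : ℕ) :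
    ∫ x, mollify n f x = ∫ x, f x := by
  rw [mollify, integral_convolution _ (shrinkingBump n).integrable_normed hf,
    ContDiffBump.integral_normed]
  simp

theorem mollify_nonneg {f : ℝ × ℝ → ℝ} (hf : ∀ p, 0 ≤ f p) (n : ℕ) (x : ℝ × ℝ) :
    0 ≤ mollify n f x := by
  rw [mollify_apply]
  exact integral_nonneg fun y => mul_nonneg ((shrinkingBump n).nonneg_normed _) (hf y)

theorem fderiv_mollify_indicator {Ω K : Set (ℝ × ℝ)} {Z g : ℝ × ℝ → ℝ} {e x : ℝ × ℝ} {δ : ℝ}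
    (hΩ : IsOpen Ω) (hZ : LocallyIntegrable (Ω.indicator Z))
    (hweak : ∀ Φ : ℝ × ℝ → ℝ, ContDiff ℝ (⊤ : ℕ∞) Φ → HasCompactSupport Φ → tsupport Φ ⊆ Ω →
      ∫ p in Ω, Z p * fderiv ℝ Φ p e = -∫ p in Ω, g p * Φ p)
    (hKΩ : K ⊆ Ω) (hx : Metric.closedBall x δ ⊆ K) {n : ℕ}
    (hn : (shrinkingBump n).rOut ≤ δ) :
    fderiv ℝ (mollify n (Ω.indicator Z)) x e = mollify n (K.indicator g) x := by
  set b := (shrinkingBump n).normed (volume : Measure (ℝ × ℝ)) with hb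
  have hcd : ContDiff ℝ (⊤ : ℕ∞) b := (shrinkingBump n).contDiff_normed
  set Φ : ℝ × ℝ → ℝ := fun y => b (x - y) with hΦ
  have hcdΦ : ContDiff ℝ (⊤ : ℕ∞) Φ := hcd.comp (contDiff_const.sub contDiff_id)
  have hsup : Function.support Φ ⊆ Metric.closedBall x δ := by
    intro y hy
    have : x - y ∈ Function.support b := hy
    rw [hb, ContDiffBump.support_normed_eq] at this
    have h2 : dist y x < (shrinkingBump n).rOut := by
      rw [dist_comm, dist_eq_norm]
      simpa using this
    exact (h2.le.trans hn)
  have hts : tsupport Φ ⊆ Metric.closedBall x δ :=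
    closure_minimal hsup Metric.isClosed_closedBall
  have hcs : HasCompactSupport Φ :=
    (isCompact_closedBall x δ).of_isClosed_subset (isClosed_tsupport _) hts
  have hw := hweak Φ hcdΦ hcs (hts.trans (hx.trans hKΩ))
  have hder : ∀ y, fderiv ℝ Φ y e = - fderiv ℝ b (x - y) e := by
    intro y
    have h1 : HasFDerivAt b (fderiv ℝ b (x - y)) (x - y) :=
      (hcd.differentiable (by simp) (x - y)).hasFDerivAt
    have h2 : HasFDerivAt (fun y : ℝ × ℝ => x - y) (-ContinuousLinearMap.id ℝ (ℝ × ℝ)) y :=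
      (hasFDerivAt_id y).const_sub x
    have h3 := h1.comp y h2
    have h4 : fderiv ℝ Φ y = (fderiv ℝ b (x - y)).comp (-ContinuousLinearMap.id ℝ (ℝ × ℝ)) :=
      h3.fderiv
    rw [h4]
    simp
  rw [fderiv_mollify hZ, mollify_apply, ← hb]
  have e1 : (fun y => fderiv ℝ b (x - y) e * Ω.indicator Z y) =
      Ω.indicator fun y => -(Z y * fderiv ℝ Φ y e) := by
    ext y
    by_cases hy : y ∈ Ω
    · simp only [indicator_of_mem hy, hder]; ring
    · simp [indicator_of_notMem hy]
  have e2 : (fun y => b (x - y) * K.indicator g y) = Ω.indicator fun y => g y * Φ y := by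
    ext y
    by_cases hy : y ∈ K
    · rw [indicator_of_mem hy, indicator_of_mem (hKΩ hy)]; ring
    · have h0 : Φ y = 0 := by
        by_contra h
        exact hy (hx (hsup h))
      rw [indicator_of_notMem hy, mul_zero]
      by_cases hy' : y ∈ Ω
      · rw [indicator_of_mem hy', h0, mul_zero]
      · rw [indicator_of_notMem hy']
  rw [e1, e2, integral_indicator hΩ.measurableSet, integral_indicator hΩ.measurableSet,
    integral_neg, hw, neg_neg]

end Mollifier

theorem exists_smooth_approx {Ω K : Set (ℝ × ℝ)} {Z gr gt : ℝ × ℝ → ℝ} {M : ℝ}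
    (hΩ : IsOpen Ω) (hZm : Measurable Z) (hM : 0 ≤ M) (hZ : ∀ p ∈ Ω, |Z p| ≤ M)
    (hgrm : Measurable gr) (hgtm : Measurable gt)
    (hgL2 : ∀ Kc : Set (ℝ × ℝ), IsCompact Kc → Kc ⊆ Ω →
      IntegrableOn (fun p => (gr p) ^ 2) Kc ∧ IntegrableOn (fun p => (gt p) ^ 2) Kc)
    (hweak_r : ∀ Φ : ℝ × ℝ → ℝ, ContDiff ℝ (⊤ : ℕ∞) Φ → HasCompactSupport Φ → tsupport Φ ⊆ Ω →
      ∫ p in Ω, Z p * fderiv ℝ Φ p (1, 0) = -∫ p in Ω, gr p * Φ p)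
    (hweak_t : ∀ Φ : ℝ × ℝ → ℝ, ContDiff ℝ (⊤ : ℕ∞) Φ → HasCompactSupport Φ → tsupport Φ ⊆ Ω →
      ∫ p in Ω, Z p * fderiv ℝ Φ p (0, 1) = -∫ p in Ω, gt p * Φ p)
    (hK : IsCompact K) (hKΩ : K ⊆ Ω) :
    ∃ (z : ℕ → ℝ × ℝ → ℝ) (S : ℝ × ℝ → ℝ), (∀ n, ContDiff ℝ (⊤ : ℕ∞) (z n)) ∧
      (∀ n p, |z n p| ≤ M) ∧ Integrable S ∧
      (∀ᵐ p, p ∈ Ω → Tendsto (fun n => z n p) atTop (𝓝 (Z p))) ∧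
      (∀ᵐ p, p ∈ K → Tendsto (fun n => fderiv ℝ (z n) p (1, 0)) atTop (𝓝 (gr p))) ∧
      (∀ᵐ p, p ∈ K → Tendsto (fun n => fderiv ℝ (z n) p (0, 1)) atTop (𝓝 (gt p))) ∧
      (∀ᵐ p, p ∈ K → ∀ n, fderiv ℝ (z n) p (1, 0) ^ 2 + fderiv ℝ (z n) p (0, 1) ^ 2 ≤ S p) := by
  obtain ⟨δ, hδ, hδΩ⟩ := hK.exists_cthickening_subset_open hΩ hKΩ
  set K' := Metric.cthickening δ K with hK'
  have hK'c : IsCompact K' := hK.cthickening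
  have hK'm : MeasurableSet K' := hK'c.measurableSet
  have hKK' : K ⊆ K' := Metric.self_subset_cthickening _
  have hball : ∀ x ∈ K, Metric.closedBall x δ ⊆ K' := fun x hx =>
    Metric.closedBall_subset_cthickening hx δ
  have hZb : ∀ p, |Ω.indicator Z p| ≤ M := by
    intro p
    by_cases hp : p ∈ Ω
    · rw [indicator_of_mem hp]; exact hZ p hp
    · rw [indicator_of_notMem hp]; simpa using hM
  have hZl : LocallyIntegrable (Ω.indicator Z) :=
    (locallyIntegrable_const M).mono (hZm.indicator hΩ.measurableSet).aestronglyMeasurable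
      (Eventually.of_forall fun p => by
        rw [Real.norm_eq_abs, Real.norm_eq_abs]; exact (hZb p).trans (le_abs_self _))
  have hfin : volume K' < ⊤ := hK'c.measure_lt_top
  have hi : ∀ g : ℝ × ℝ → ℝ, Measurable g → IntegrableOn (fun p => g p ^ 2) K' →
      Integrable (K'.indicator g) ∧ Integrable (fun p => K'.indicator g p ^ 2) := by
    intro g hg hg2
    constructor
    · rw [integrable_indicator_iff hK'm]
      have : IntegrableOn (fun p => g p ^ 2 + 1) K' :=
        hg2.add (integrableOn_const hfin.ne)
      refine Integrable.mono this hg.aestronglyMeasurable (Eventually.of_forall fun p => ?_)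
      rw [Real.norm_eq_abs, Real.norm_of_nonneg (by positivity)]
      nlinarith [sq_abs (g p), sq_nonneg (|g p| - 1)]
    · have e : (fun p => K'.indicator g p ^ 2) = K'.indicator fun p => g p ^ 2 := by
        ext p
        by_cases hp : p ∈ K'
        · simp [indicator_of_mem hp]
        · simp [indicator_of_notMem hp]
      rw [e, integrable_indicator_iff hK'm]
      exact hg2
  obtain ⟨ir, ir2⟩ := hi gr hgrm (hgL2 K' hK'c hδΩ).1
  obtain ⟨it, it2⟩ := hi gt hgtm (hgL2 K' hK'c hδΩ).2
  set fr : ℝ × ℝ → ℝ := fun p => K'.indicator gr p ^ 2 with hfr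
  set ft : ℝ × ℝ → ℝ := fun p => K'.indicator gt p ^ 2 with hft
  set f : ℝ × ℝ → ℝ := fun p => fr p + ft p with hf
  have hfi : Integrable f := ir2.add it2
  have hFi : ∀ n, Integrable (fun p => mollify n fr p + mollify n ft p) := fun n =>
    (integrable_mollify ir2 n).add (integrable_mollify it2 n)
  have hL1 := tendsto_integral_abs_sub_of_integral_eq hFi hfi
    (fun n => Eventually.of_forall fun p => add_nonneg
      (mollify_nonneg (fun p => sq_nonneg _) n p) (mollify_nonneg (fun p => sq_nonneg _) n p))
    (by
      filter_upwards [ae_tendsto_mollify ir2.locallyIntegrable,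
        ae_tendsto_mollify it2.locallyIntegrable] with p h1 h2
      exact h1.add h2)
    (fun n => by
      rw [integral_add (integrable_mollify ir2 n) (integrable_mollify it2 n),
        integral_mollify ir2, integral_mollify it2, ← integral_add ir2 it2])
  obtain ⟨n0, hn0⟩ : ∃ n0, ∀ n ≥ n0, (shrinkingBump n).rOut ≤ δ := by
    have := tendsto_rOut_shrinkingBump.eventually_le_const hδ
    exact eventually_atTop.1 this
  obtain ⟨φ, S, hφ, hS, hle⟩ := exists_dominated_subseq hFi hfi hL1
  have hφ' : StrictMono fun n => φ (n + n0) := fun a b h => hφ (by omega)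
  have hge : ∀ n, n0 ≤ φ (n + n0) := fun n => (by omega : n0 ≤ n + n0).trans (hφ.id_le _)
  have htop := hφ'.tendsto_atTop
  have hdr : ∀ n, ∀ x ∈ K, fderiv ℝ (mollify (φ (n + n0)) (Ω.indicator Z)) x (1, 0) =
      mollify (φ (n + n0)) (K'.indicator gr) x := fun n x hx =>
    fderiv_mollify_indicator hΩ hZl hweak_r hδΩ (hball x hx) (hn0 _ (hge n))
  have hdt : ∀ n, ∀ x ∈ K, fderiv ℝ (mollify (φ (n + n0)) (Ω.indicator Z)) x (0, 1) =
      mollify (φ (n + n0)) (K'.indicator gt) x := fun n x hx =>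
    fderiv_mollify_indicator hΩ hZl hweak_t hδΩ (hball x hx) (hn0 _ (hge n))
  refine ⟨fun n => mollify (φ (n + n0)) (Ω.indicator Z), S, fun n => contDiff_mollify hZl _,
    fun n p => abs_mollify_le hZl hZb _ p, hS, ?_, ?_, ?_, ?_⟩
  · filter_upwards [ae_tendsto_mollify hZl] with p hp hpΩ
    rw [indicator_of_mem hpΩ] at hp
    exact hp.comp htop
  · filter_upwards [ae_tendsto_mollify ir.locallyIntegrable] with p hp hpK
    rw [indicator_of_mem (hKK' hpK)] at hp
    simp only [hdr _ p hpK]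
    exact hp.comp htop
  · filter_upwards [ae_tendsto_mollify it.locallyIntegrable] with p hp hpK
    rw [indicator_of_mem (hKK' hpK)] at hp
    simp only [hdt _ p hpK]
    exact hp.comp htop
  · filter_upwards [hle] with p hp hpK n
    rw [hdr n p hpK, hdt n p hpK]
    exact (add_le_add (sq_mollify_le ir.locallyIntegrable ir2.locallyIntegrable _ p)
      (sq_mollify_le it.locallyIntegrable it2.locallyIntegrable _ p)).trans (hp _)

/-- The half-plane rectangle on which the degenerate equation is posed. -/
abbrev axisDomain (r0 t0 t1 : ℝ) : Set (ℝ × ℝ) := Ioo 0 r0 ×ˢ Ioo t0 t1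

/-- Bounded weak solutions of a divergence form equation whose coefficients are comparable to the
weight `r ^ q`. -/
structure IsWeightedWeakSolution (t0 t1 r0 q cW CW κ K L M : ℝ) (W A D : ℝ → ℝ)
    (B Z gr gt : ℝ × ℝ → ℝ) : Prop where
  one_lt_q : 1 < q
  r0_pos : 0 < r0
  cW_pos : 0 < cW
  cW_le : cW ≤ CW
  κ_pos : 0 < κ
  κ_le : κ ≤ K
  L_nonneg : 0 ≤ L
  M_nonneg : 0 ≤ M
  measurable_W : Measurable W
  measurable_A : Measurable A
  measurable_B : Measurable B
  measurable_D : Measurable D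
  measurable_Z : Measurable Z
  measurable_gr : Measurable gr
  measurable_gt : Measurable gt
  W_bounds : ∀ r ∈ Ioo 0 r0, cW * r ^ q ≤ W r ∧ W r ≤ CW * r ^ q
  A_bounds : ∀ r ∈ Ioo 0 r0, κ ≤ A r ∧ A r ≤ K
  B_bounds : ∀ p ∈ axisDomain r0 t0 t1, κ ≤ B p ∧ B p ≤ K
  D_bound : ∀ r ∈ Ioo 0 r0, |D r| ≤ L
  Z_bound : ∀ p ∈ axisDomain r0 t0 t1, |Z p| ≤ M
  sq_integrable : ∀ Kc : Set (ℝ × ℝ), IsCompact Kc → Kc ⊆ axisDomain r0 t0 t1 →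
    IntegrableOn (fun p => (gr p) ^ 2) Kc ∧ IntegrableOn (fun p => (gt p) ^ 2) Kc
  weak_r : ∀ Φ : ℝ × ℝ → ℝ, ContDiff ℝ (⊤ : ℕ∞) Φ → HasCompactSupport Φ →
    tsupport Φ ⊆ axisDomain r0 t0 t1 →
    ∫ p in axisDomain r0 t0 t1, Z p * fderiv ℝ Φ p (1, 0)
      = -∫ p in axisDomain r0 t0 t1, gr p * Φ p
  weak_t : ∀ Φ : ℝ × ℝ → ℝ, ContDiff ℝ (⊤ : ℕ∞) Φ → HasCompactSupport Φ →
    tsupport Φ ⊆ axisDomain r0 t0 t1 →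
    ∫ p in axisDomain r0 t0 t1, Z p * fderiv ℝ Φ p (0, 1)
      = -∫ p in axisDomain r0 t0 t1, gt p * Φ p
  weak_eq : ∀ Φ : ℝ × ℝ → ℝ, ContDiff ℝ (⊤ : ℕ∞) Φ → HasCompactSupport Φ →
    tsupport Φ ⊆ axisDomain r0 t0 t1 →
    ∫ p in axisDomain r0 t0 t1,
      W p.1 * (B p * gt p * fderiv ℝ Φ p (0, 1)
        + A p.1 * gr p * fderiv ℝ Φ p (1, 0)
        - D p.1 * Z p * Φ p) = 0

theorem isOpen_axisDomain (r0 t0 t1 : ℝ) : IsOpen (axisDomain r0 t0 t1) :=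
  isOpen_Ioo.prod isOpen_Ioo

theorem fderiv_mul_comp_apply {η z : ℝ × ℝ → ℝ} {F : ℝ → ℝ} (hη : ContDiff ℝ 1 η)
    (hz : ContDiff ℝ 1 z) (hF : ContDiff ℝ 1 F) (p e : ℝ × ℝ) :
    fderiv ℝ (fun p => η p * F (z p)) p e =
      fderiv ℝ η p e * F (z p) + η p * (deriv F (z p) * fderiv ℝ z p e) := by
  have h1 : HasFDerivAt η (fderiv ℝ η p) p := (hη.differentiable one_ne_zero p).hasFDerivAt
  have h2 : HasFDerivAt z (fderiv ℝ z p) p := (hz.differentiable one_ne_zero p).hasFDerivAt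
  have h3 : HasDerivAt F (deriv F (z p)) (z p) :=
    (hF.differentiable one_ne_zero (z p)).hasDerivAt
  have h4 := h1.mul (h3.comp_hasFDerivAt p h2)
  have h5 : fderiv ℝ (fun p => η p * F (z p)) p = _ := h4.fderiv
  rw [h5]
  simp
  ring

namespace IsWeightedWeakSolution

variable {t0 t1 r0 q cW CW κ K L M : ℝ} {W A D : ℝ → ℝ} {B Z gr gt : ℝ × ℝ → ℝ}

theorem neg (h : IsWeightedWeakSolution t0 t1 r0 q cW CW κ K L M W A D B Z gr gt) :
    IsWeightedWeakSolution t0 t1 r0 q cW CW κ K L M W A D B (fun p => -Z p) (fun p => -gr p)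
      (fun p => -gt p) where
  __ := h
  measurable_Z := h.measurable_Z.neg
  measurable_gr := h.measurable_gr.neg
  measurable_gt := h.measurable_gt.neg
  Z_bound p hp := by rw [abs_neg]; exact h.Z_bound p hp
  sq_integrable Kc h1 h2 := by simpa using h.sq_integrable Kc h1 h2
  weak_r Φ h1 h2 h3 := by
    simp only [neg_mul, integral_neg, h.weak_r Φ h1 h2 h3]
  weak_t Φ h1 h2 h3 := by
    simp only [neg_mul, integral_neg, h.weak_t Φ h1 h2 h3]
  weak_eq Φ h1 h2 h3 := by
    rw [← neg_eq_zero, ← integral_neg]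
    refine Eq.trans (integral_congr_ae (Eventually.of_forall fun p => ?_)) (h.weak_eq Φ h1 h2 h3)
    ring

theorem exists_smooth_approx_comp
    (h : IsWeightedWeakSolution t0 t1 r0 q cW CW κ K L M W A D B Z gr gt)
    {Kc : Set (ℝ × ℝ)} (hK : IsCompact Kc) (hKΩ : Kc ⊆ axisDomain r0 t0 t1)
    {η : ℝ × ℝ → ℝ} {F : ℝ → ℝ} (hη : ContDiff ℝ (⊤ : ℕ∞) η) (hF : ContDiff ℝ (⊤ : ℕ∞) F) :
    ∃ (z : ℕ → ℝ × ℝ → ℝ) (S : ℝ × ℝ → ℝ) (C : ℝ), (∀ n, ContDiff ℝ (⊤ : ℕ∞) (z n)) ∧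
      IntegrableOn S Kc ∧
      ∀ᵐ p, p ∈ Kc → Tendsto (fun n => η p * F (z n p)) atTop (𝓝 (η p * F (Z p))) ∧
        Tendsto (fun n => fderiv ℝ (fun p => η p * F (z n p)) p (1, 0)) atTop
          (𝓝 (fderiv ℝ η p (1, 0) * F (Z p) + η p * (deriv F (Z p) * gr p))) ∧
        Tendsto (fun n => fderiv ℝ (fun p => η p * F (z n p)) p (0, 1)) atTop
          (𝓝 (fderiv ℝ η p (0, 1) * F (Z p) + η p * (deriv F (Z p) * gt p))) ∧
        ∀ n, |η p * F (z n p)| ≤ C ∧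
          fderiv ℝ (fun p => η p * F (z n p)) p (1, 0) ^ 2 +
          fderiv ℝ (fun p => η p * F (z n p)) p (0, 1) ^ 2 ≤ S p := by
  obtain ⟨z, S, hz, hzM, hS, h1, h2, h3, h4⟩ := exists_smooth_approx (isOpen_axisDomain r0 t0 t1)
    h.measurable_Z h.M_nonneg h.Z_bound h.measurable_gr h.measurable_gt h.sq_integrable
    h.weak_r h.weak_t hK hKΩ
  have hη1 : ContDiff ℝ 1 η := hη.of_le (by exact_mod_cast le_top)
  have hF1 : ContDiff ℝ 1 F := hF.of_le (by exact_mod_cast le_top)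
  have hz1 : ∀ n, ContDiff ℝ 1 (z n) := fun n => (hz n).of_le (by exact_mod_cast le_top)
  have hF' : Continuous (deriv F) := hF1.continuous_deriv le_rfl
  obtain ⟨E, hE⟩ := hK.exists_bound_of_continuousOn hη1.continuous.continuousOn
  obtain ⟨Er, hEr⟩ := hK.exists_bound_of_continuousOn
    (continuous_fderiv_apply_const hη1 (1, 0)).continuousOn
  obtain ⟨Et, hEt⟩ := hK.exists_bound_of_continuousOn
    (continuous_fderiv_apply_const hη1 (0, 1)).continuousOn
  obtain ⟨CF, hCF⟩ := (isCompact_Icc (a := -M) (b := M)).exists_bound_of_continuousOn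
    hF1.continuous.continuousOn
  obtain ⟨CF', hCF'⟩ := (isCompact_Icc (a := -M) (b := M)).exists_bound_of_continuousOn
    hF'.continuousOn
  have hfin : volume Kc < ⊤ := hK.measure_lt_top
  refine ⟨z, fun p => 2 * (Er ^ 2 + Et ^ 2) * CF ^ 2 + 2 * E ^ 2 * CF' ^ 2 * S p, E * CF, hz, ?_, ?_⟩
  · have : IntegrableOn S Kc := hS.integrableOn
    exact (integrableOn_const hfin.ne).add (this.const_mul _)
  · filter_upwards [h1, h2, h3, h4] with p h1 h2 h3 h4 hp
    have l1 := h1 (hKΩ hp)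
    have l2 := h2 hp
    have l3 := h3 hp
    have c1 : Tendsto (fun n => F (z n p)) atTop (𝓝 (F (Z p))) :=
      (hF1.continuous.tendsto _).comp l1
    have c2 : Tendsto (fun n => deriv F (z n p)) atTop (𝓝 (deriv F (Z p))) :=
      (hF'.tendsto _).comp l1
    simp only [fun n => fderiv_mul_comp_apply hη1 (hz1 n) hF1 p]
    refine ⟨c1.const_mul _, (c1.const_mul _).add ((c2.mul l2).const_mul _),
      (c1.const_mul _).add ((c2.mul l3).const_mul _), fun n => ?_⟩
    have b0 : |η p| ≤ E := hE p hp
    have br : |fderiv ℝ η p (1, 0)| ≤ Er := hEr p hp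
    have bt : |fderiv ℝ η p (0, 1)| ≤ Et := hEt p hp
    have hzm := abs_le.1 (hzM n p)
    have bF : |F (z n p)| ≤ CF := hCF _ hzm
    have bF' : |deriv F (z n p)| ≤ CF' := hCF' _ hzm
    constructor
    · rw [abs_mul]
      exact mul_le_mul b0 bF (abs_nonneg _) ((abs_nonneg _).trans b0)
    · have hs := h4 hp n
      have key : ∀ x y : ℝ, (x + y) ^ 2 ≤ 2 * x ^ 2 + 2 * y ^ 2 := fun x y => by
        nlinarith [sq_nonneg (x - y)]
      have m1 : ∀ x y X Y : ℝ, |x| ≤ X → |y| ≤ Y → (x * y) ^ 2 ≤ X ^ 2 * Y ^ 2 := by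
        intro x y X Y hx hy
        rw [mul_pow]
        exact mul_le_mul (sq_le_sq' (abs_le.1 hx).1 (abs_le.1 hx).2)
          (sq_le_sq' (abs_le.1 hy).1 (abs_le.1 hy).2) (sq_nonneg _) (sq_nonneg _)
      have e1 := m1 _ _ _ _ br bF
      have e2 := m1 _ _ _ _ bt bF
      have e3 := m1 _ _ _ _ b0 bF'
      have e4 : (η p * deriv F (z n p)) ^ 2 *
          (fderiv ℝ (z n) p (1, 0) ^ 2 + fderiv ℝ (z n) p (0, 1) ^ 2) ≤ E ^ 2 * CF' ^ 2 * S p :=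
        mul_le_mul e3 hs (by positivity) (by positivity)
      calc _ ≤ _ := add_le_add (key _ _) (key _ _)
        _ ≤ _ := by nlinarith

theorem W_nonneg (h : IsWeightedWeakSolution t0 t1 r0 q cW CW κ K L M W A D B Z gr gt)
    {r : ℝ} (hr : r ∈ Ioo 0 r0) : 0 ≤ W r :=
  (mul_nonneg h.cW_pos.le (Real.rpow_nonneg hr.1.le _)).trans (h.W_bounds r hr).1

theorem K_nonneg (h : IsWeightedWeakSolution t0 t1 r0 q cW CW κ K L M W A D B Z gr gt) :
    0 ≤ K := h.κ_pos.le.trans h.κ_le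

theorem CW_nonneg (h : IsWeightedWeakSolution t0 t1 r0 q cW CW κ K L M W A D B Z gr gt) :
    0 ≤ CW := h.cW_pos.le.trans h.cW_le

theorem q_pos (h : IsWeightedWeakSolution t0 t1 r0 q cW CW κ K L M W A D B Z gr gt) :
    0 < q := one_pos.trans h.one_lt_q

theorem weak_identity (h : IsWeightedWeakSolution t0 t1 r0 q cW CW κ K L M W A D B Z gr gt)
    {η : ℝ × ℝ → ℝ} {F : ℝ → ℝ} (hη : ContDiff ℝ (⊤ : ℕ∞) η) (hF : ContDiff ℝ (⊤ : ℕ∞) F)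
    (hηc : HasCompactSupport η) (hηΩ : tsupport η ⊆ axisDomain r0 t0 t1) :
    IntegrableOn (fun p => W p.1 *
        (B p * gt p * (fderiv ℝ η p (0, 1) * F (Z p) + η p * (deriv F (Z p) * gt p)) +
         A p.1 * gr p * (fderiv ℝ η p (1, 0) * F (Z p) + η p * (deriv F (Z p) * gr p)) -
         D p.1 * Z p * (η p * F (Z p)))) (axisDomain r0 t0 t1) ∧
    ∫ p in axisDomain r0 t0 t1, W p.1 *
        (B p * gt p * (fderiv ℝ η p (0, 1) * F (Z p) + η p * (deriv F (Z p) * gt p)) +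
         A p.1 * gr p * (fderiv ℝ η p (1, 0) * F (Z p) + η p * (deriv F (Z p) * gr p)) -
         D p.1 * Z p * (η p * F (Z p))) = 0 := by
  set Ω := axisDomain r0 t0 t1 with hΩ
  set Kc := tsupport η with hKc
  have hKcc : IsCompact Kc := hηc
  have hηr : Measurable fun p => fderiv ℝ η p (1, 0) :=
    (continuous_fderiv_apply_const (hη.of_le (by exact_mod_cast le_top)) (1, 0)).measurable
  have hηt : Measurable fun p => fderiv ℝ η p (0, 1) :=
    (continuous_fderiv_apply_const (hη.of_le (by exact_mod_cast le_top)) (0, 1)).measurable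
  have hF' : Measurable (deriv F) := measurable_deriv F
  have hFm : Measurable F := hF.continuous.measurable
  have hηm : Measurable η := hη.continuous.measurable
  obtain ⟨mW, mA, mB, mD, mZ, mr, mt⟩ := And.intro h.measurable_W (And.intro h.measurable_A
    (And.intro h.measurable_B (And.intro h.measurable_D (And.intro h.measurable_Z
    (And.intro h.measurable_gr h.measurable_gt)))))
  obtain ⟨z, S, C, hz, hS, hlim⟩ := h.exists_smooth_approx_comp hKcc hηΩ hη hF
  set v : ℕ → ℝ × ℝ → ℝ := fun n p => η p * F (z n p) with hv
  have hvsm : ∀ n, ContDiff ℝ (⊤ : ℕ∞) (v n) := fun n => hη.mul (hF.comp (hz n))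
  have hvs : ∀ n, tsupport (v n) ⊆ Kc := fun n => tsupport_mul_subset_left
  have hvc : ∀ n, HasCompactSupport (v n) := fun n => hηc.mul_right
  have hd0 : ∀ n e, ∀ p ∉ Kc, fderiv ℝ (v n) p e = 0 := by
    intro n e p hp
    have : fderiv ℝ (v n) p = 0 := by
      by_contra hne
      exact hp (hvs n (support_fderiv_subset ℝ hne))
    rw [this]; rfl
  have hη0 : ∀ p ∉ Kc, η p = 0 := fun p hp => image_eq_zero_of_notMem_tsupport hp
  have hηd0 : ∀ e, ∀ p ∉ Kc, fderiv ℝ η p e = 0 := by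
    intro e p hp
    have : fderiv ℝ η p = 0 := by
      by_contra hne
      exact hp (support_fderiv_subset ℝ hne)
    rw [this]; rfl
  set I : ℝ × ℝ → ℝ := fun p => W p.1 *
        (B p * gt p * (fderiv ℝ η p (0, 1) * F (Z p) + η p * (deriv F (Z p) * gt p)) +
         A p.1 * gr p * (fderiv ℝ η p (1, 0) * F (Z p) + η p * (deriv F (Z p) * gr p)) -
         D p.1 * Z p * (η p * F (Z p))) with hI
  set In : ℕ → ℝ × ℝ → ℝ := fun n p => W p.1 * (B p * gt p * fderiv ℝ (v n) p (0, 1)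
        + A p.1 * gr p * fderiv ℝ (v n) p (1, 0) - D p.1 * Z p * v n p) with hIn
  have hIm : Measurable I := by
    rw [hI]; fun_prop
  have hInm : ∀ n, Measurable (In n) := by
    intro n
    have hvm : Measurable (v n) := (hvsm n).continuous.measurable
    have h1 : Measurable fun p => fderiv ℝ (v n) p (1, 0) := (continuous_fderiv_apply_const
      ((hvsm n).of_le (by exact_mod_cast le_top)) (1, 0)).measurable
    have h2 : Measurable fun p => fderiv ℝ (v n) p (0, 1) := (continuous_fderiv_apply_const
      ((hvsm n).of_le (by exact_mod_cast le_top)) (0, 1)).measurable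
    rw [hIn]; fun_prop
  set bound : ℝ × ℝ → ℝ := Kc.indicator fun p =>
    CW * r0 ^ q * (K * (gr p ^ 2 + gt p ^ 2 + S p) + L * M * C) with hb
  have hbi : IntegrableOn bound Ω := by
    have hsq := h.sq_integrable Kc hKcc hηΩ
    have : IntegrableOn (fun p => CW * r0 ^ q * (K * (gr p ^ 2 + gt p ^ 2 + S p) + L * M * C)) Kc :=
      (((hsq.1.add hsq.2).add hS).const_mul K).add (integrableOn_const hKcc.measure_lt_top.ne)
        |>.const_mul _
    exact ((integrable_indicator_iff hKcc.measurableSet).2 this).integrableOn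
  have hae : ∀ᵐ p ∂volume.restrict Ω, (∀ n, ‖In n p‖ ≤ bound p) ∧
      Tendsto (fun n => In n p) atTop (𝓝 (I p)) := by
    rw [ae_restrict_iff' (isOpen_axisDomain r0 t0 t1).measurableSet]
    filter_upwards [hlim] with p hp hpΩ
    by_cases hpK : p ∈ Kc
    · obtain ⟨l0, lr, lt, hbd⟩ := hp hpK
      constructor
      · intro n
        obtain ⟨b0, b1⟩ := hbd n
        rw [hb, indicator_of_mem hpK, Real.norm_eq_abs, hIn]
        simp only
        have hWn := h.W_nonneg hpΩ.1
        have hWle : W p.1 ≤ CW * r0 ^ q := (h.W_bounds _ hpΩ.1).2.trans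
          (mul_le_mul_of_nonneg_left (Real.rpow_le_rpow hpΩ.1.1.le hpΩ.1.2.le h.q_pos.le)
            h.CW_nonneg)
        have hK0 := h.K_nonneg
        have aux : ∀ x g d : ℝ, κ ≤ x → x ≤ K → |x * g * d| ≤ K * ((g ^ 2 + d ^ 2) / 2) := by
          intro x g d hx1 hx2
          have hx0 := h.κ_pos.le.trans hx1
          rw [mul_assoc, abs_mul, abs_of_nonneg hx0]
          apply mul_le_mul hx2 _ (abs_nonneg _) hK0
          rw [abs_mul]
          nlinarith [sq_nonneg (|g| - |d|), sq_abs g, sq_abs d]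
        have a1 := aux (B p) (gt p) (fderiv ℝ (v n) p (0, 1)) (h.B_bounds p hpΩ).1
          (h.B_bounds p hpΩ).2
        have a2 := aux (A p.1) (gr p) (fderiv ℝ (v n) p (1, 0)) (h.A_bounds _ hpΩ.1).1
          (h.A_bounds _ hpΩ.1).2
        have a3 : |D p.1 * Z p * v n p| ≤ L * M * C := by
          rw [abs_mul, abs_mul]
          exact mul_le_mul (mul_le_mul (h.D_bound _ hpΩ.1) (h.Z_bound p hpΩ) (abs_nonneg _)
            h.L_nonneg) b0 (abs_nonneg _) (mul_nonneg h.L_nonneg h.M_nonneg)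
        rw [abs_mul, abs_of_nonneg hWn]
        apply mul_le_mul hWle _ (abs_nonneg _) (mul_nonneg h.CW_nonneg (by
          exact Real.rpow_nonneg h.r0_pos.le _))
        have t1 := abs_sub (B p * gt p * fderiv ℝ (v n) p (0, 1)
          + A p.1 * gr p * fderiv ℝ (v n) p (1, 0)) (D p.1 * Z p * v n p)
        have t2 := abs_add_le (B p * gt p * fderiv ℝ (v n) p (0, 1))
          (A p.1 * gr p * fderiv ℝ (v n) p (1, 0))
        have b1' : K * (fderiv ℝ (v n) p (1, 0) ^ 2 + fderiv ℝ (v n) p (0, 1) ^ 2) ≤ K * S p :=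
          mul_le_mul_of_nonneg_left b1 hK0
        have : 0 ≤ K * (gr p ^ 2 + gt p ^ 2 + S p) := mul_nonneg hK0
          (by nlinarith [sq_nonneg (fderiv ℝ (v n) p (1, 0)), sq_nonneg (fderiv ℝ (v n) p (0, 1)),
            sq_nonneg (gr p), sq_nonneg (gt p)])
        nlinarith
      · exact (((lt.const_mul _).add (lr.const_mul _)).sub (l0.const_mul _)).const_mul _
    · have i0 : I p = 0 := by simp [hI, hη0 p hpK, hηd0 _ p hpK]
      have in0 : ∀ n, In n p = 0 := fun n => by
        simp only [hIn, hd0 n _ p hpK]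
        simp [hv, hη0 p hpK]
      rw [hb, indicator_of_notMem hpK, i0]
      simp [in0]
  have hIbd : ∀ᵐ p ∂volume.restrict Ω, ‖I p‖ ≤ bound p := by
    filter_upwards [hae] with p hp
    exact le_of_tendsto hp.2.norm (Eventually.of_forall hp.1)
  refine ⟨Integrable.mono' hbi hIm.aestronglyMeasurable hIbd, ?_⟩
  have hT := tendsto_integral_of_dominated_convergence (μ := volume.restrict Ω) bound
    (fun n => (hInm n).aestronglyMeasurable) hbi
    (fun n => by filter_upwards [hae] with p hp using hp.1 n)
    (by filter_upwards [hae] with p hp using hp.2)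
  have h0 : ∀ n, ∫ p in Ω, In n p = 0 := fun n =>
    h.weak_eq (v n) (hvsm n) (hvc n) ((hvs n).trans hηΩ)
  simp only [h0] at hT
  exact tendsto_nhds_unique hT tendsto_const_nhds |>.trans rfl

end IsWeightedWeakSolution

/-- A smooth positive function agreeing with the identity on `[R / 2, ∞)`. -/
noncomputable def smoothFloor (R s : ℝ) : ℝ :=
  R / 4 + (s - R / 4) * Real.smoothTransition ((s - R / 4) * (4 / R))

theorem contDiff_smoothFloor (R : ℝ) : ContDiff ℝ (⊤ : ℕ∞) (smoothFloor R) := by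
  unfold smoothFloor
  have : ContDiff ℝ (⊤ : ℕ∞) fun s : ℝ => Real.smoothTransition ((s - R / 4) * (4 / R)) :=
    Real.smoothTransition.contDiff.comp ((contDiff_id.sub contDiff_const).mul contDiff_const)
  exact contDiff_const.add ((contDiff_id.sub contDiff_const).mul this)

theorem smoothFloor_pos {R : ℝ} (hR : 0 < R) (s : ℝ) : 0 < smoothFloor R s := by
  unfold smoothFloor
  rcases le_total s (R / 4) with h | h
  · rw [Real.smoothTransition.zero_of_nonpos]
    · linarith
    · exact mul_nonpos_of_nonpos_of_nonneg (by linarith) (by positivity)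
  · have := mul_nonneg (sub_nonneg.2 h)
      (Real.smoothTransition.nonneg ((s - R / 4) * (4 / R)))
    linarith

theorem smoothFloor_of_le {R s : ℝ} (hR : 0 < R) (hs : R / 2 ≤ s) : smoothFloor R s = s := by
  unfold smoothFloor
  rw [Real.smoothTransition.one_of_one_le]
  · ring
  · rw [mul_div_assoc', le_div_iff₀ hR]; linarith

/-- The nonlinearity in the logarithmic test function. -/
noncomputable def logTest (G : ℝ → ℝ) (m R c s : ℝ) : ℝ :=
  G (c - Real.log (smoothFloor R (s - m + R))) / smoothFloor R (s - m + R)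

theorem contDiff_logTest {G : ℝ → ℝ} (hG : ContDiff ℝ (⊤ : ℕ∞) G) (m c : ℝ) {R : ℝ} (hR : 0 < R) :
    ContDiff ℝ (⊤ : ℕ∞) (logTest G m R c) := by
  unfold logTest
  have h1 : ContDiff ℝ (⊤ : ℕ∞) fun s : ℝ => smoothFloor R (s - m + R) :=
    (contDiff_smoothFloor R).comp ((contDiff_id.sub contDiff_const).add contDiff_const)
  exact (hG.comp (contDiff_const.sub (h1.log fun s => (smoothFloor_pos hR _).ne'))).div h1
    fun s => (smoothFloor_pos hR _).ne'

theorem logTest_of_le {G : ℝ → ℝ} {m R c s : ℝ} (hR : 0 < R) (hs : m ≤ s) :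
    logTest G m R c s = G (c - Real.log (s - m + R)) / (s - m + R) := by
  unfold logTest
  rw [smoothFloor_of_le hR (by linarith)]

theorem deriv_logTest_of_le {G : ℝ → ℝ} (hG : Differentiable ℝ G) {m R c s : ℝ} (hR : 0 < R)
    (hs : m ≤ s) : deriv (logTest G m R c) s =
      -(G (c - Real.log (s - m + R)) + deriv G (c - Real.log (s - m + R))) / (s - m + R) ^ 2 := by
  have hu : 0 < s - m + R := by linarith
  have hev : logTest G m R c =ᶠ[𝓝 s] fun s => G (c - Real.log (s - m + R)) / (s - m + R) := by
    filter_upwards [lt_mem_nhds (show m - R / 2 < s by linarith)] with x hx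
    unfold logTest
    rw [smoothFloor_of_le hR (by linarith)]
  rw [hev.deriv_eq]
  have h1 : HasDerivAt (fun s => s - m + R) 1 s := ((hasDerivAt_id s).sub_const m).add_const R
  have h2 : HasDerivAt (fun s => c - Real.log (s - m + R)) (-(1 / (s - m + R))) s :=
    (h1.log hu.ne').const_sub c
  have h3 : HasDerivAt (fun s => G (c - Real.log (s - m + R)))
      (deriv G (c - Real.log (s - m + R)) * (-(1 / (s - m + R)))) s :=
    (hG _).hasDerivAt.comp s h2
  have h4 := (h3.div h1 hu.ne').deriv
  refine h4.trans ?_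
  field_simp
  ring

/-- The constant in the logarithmic energy estimate. -/
noncomputable def energyConst (cW CW κ K L M : ℝ) : ℝ :=
  2 * CW / (κ * cW) * (2 * K ^ 2 / κ + L * M)

theorem young_coeff {κ K β x d : ℝ} (hκ : 0 < κ) (h1 : κ ≤ β) (h2 : β ≤ K) :
    κ / 2 * x ^ 2 ≤ β * x ^ 2 - 2 * β * x * d + 2 * K ^ 2 / κ * d ^ 2 := by
  have hβ : β ^ 2 ≤ K ^ 2 := pow_le_pow_left₀ (by linarith) h2 2
  have h3 : 0 ≤ (κ * x - 2 * β * d) ^ 2 / (2 * κ) := by positivity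
  have e : (κ * x - 2 * β * d) ^ 2 / (2 * κ) = κ / 2 * x ^ 2 - 2 * β * x * d + 2 * β ^ 2 / κ * d ^ 2 := by
    field_simp; ring
  have h4 : 2 * β ^ 2 / κ * d ^ 2 ≤ 2 * K ^ 2 / κ * d ^ 2 := by gcongr
  nlinarith [sq_nonneg x]

theorem energy_pointwise {κ K L M cW CW ρ w a b d y u R g g' gt gr z dt dr : ℝ}
    (hκ : 0 < κ) (hw : 0 ≤ w) (hw1 : cW * ρ ≤ w) (hw2 : w ≤ CW * ρ)
    (ha1 : κ ≤ a) (ha2 : a ≤ K) (hb1 : κ ≤ b) (hb2 : b ≤ K) (hdy : |d * y| ≤ L * M)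
    (hR : 0 < R) (hR1 : R ≤ 1) (hu : R ≤ u) (hg : 0 ≤ g) (hg' : 0 ≤ g') :
    κ * cW / 2 * (ρ * ((gr ^ 2 + gt ^ 2) / u ^ 2 * g * z ^ 2)) ≤
      CW * (2 * K ^ 2 / κ + L * M) * (ρ * (g * (dr ^ 2 + dt ^ 2 + z ^ 2 / R ^ 2))) -
      w * (b * gt * (2 * z * dt * (g / u) + z * z * (-(g + g') / u ^ 2 * gt)) +
         a * gr * (2 * z * dr * (g / u) + z * z * (-(g + g') / u ^ 2 * gr)) -
         d * y * (z * z * (g / u))) := by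
  have hu0 : 0 < u := hR.trans_le hu
  have hLM : 0 ≤ L * M := (abs_nonneg _).trans hdy
  have yX := young_coeff (x := gt / u * z) (d := dt) hκ hb1 hb2
  have yY := young_coeff (x := gr / u * z) (d := dr) hκ ha1 ha2
  have hDZ : -(d * y * z ^ 2 / u) ≤ L * M * (z ^ 2 / R ^ 2) := by
    have h2 : z ^ 2 / u ≤ z ^ 2 / R ^ 2 := by
      apply div_le_div_of_nonneg_left (sq_nonneg _) (by positivity)
      nlinarith
    calc -(d * y * z ^ 2 / u) = -(d * y) * (z ^ 2 / u) := by ring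
      _ ≤ (L * M) * (z ^ 2 / R ^ 2) :=
          mul_le_mul ((neg_le_abs _).trans hdy) h2 (by positivity) hLM
  have e1 : w * (b * gt * (2 * z * dt * (g / u) + z * z * (-(g + g') / u ^ 2 * gt)) +
      a * gr * (2 * z * dr * (g / u) + z * z * (-(g + g') / u ^ 2 * gr)) -
      d * y * (z * z * (g / u))) =
      -(w * (g * (b * (gt / u * z) ^ 2 - 2 * b * (gt / u * z) * dt +
        (a * (gr / u * z) ^ 2 - 2 * a * (gr / u * z) * dr) + d * y * z ^ 2 / u) +
        g' * (b * (gt / u * z) ^ 2 + a * (gr / u * z) ^ 2))) := by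
    field_simp
    ring
  have e2 : (gr ^ 2 + gt ^ 2) / u ^ 2 * g * z ^ 2 =
      g * ((gt / u * z) ^ 2 + (gr / u * z) ^ 2) := by
    field_simp
    ring
  rw [e1, e2]
  have hK2 : 0 ≤ 2 * K ^ 2 / κ := by positivity
  have hζR : 0 ≤ z ^ 2 / R ^ 2 := by positivity
  generalize gt / u * z = X at *
  generalize gr / u * z = Y at *
  generalize d * y * z ^ 2 / u = V at *
  generalize z ^ 2 / R ^ 2 = U at *
  generalize 2 * K ^ 2 / κ = k at *
  generalize L * M = l at *
  have f0 : k * (dr ^ 2 + dt ^ 2) + l * U ≤ (k + l) * (dr ^ 2 + dt ^ 2 + U) := by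
    have h1 := mul_nonneg hLM (add_nonneg (sq_nonneg dr) (sq_nonneg dt))
    have h2 := mul_nonneg hK2 hζR
    linarith
  have f1 : κ / 2 * (X ^ 2 + Y ^ 2) - (k + l) * (dr ^ 2 + dt ^ 2 + U) ≤
      b * X ^ 2 - 2 * b * X * dt + (a * Y ^ 2 - 2 * a * Y * dr) + V := by
    linarith
  have f2 : 0 ≤ g' * (b * X ^ 2 + a * Y ^ 2) := by
    have : 0 ≤ b := hκ.le.trans hb1
    have : 0 ≤ a := hκ.le.trans ha1
    positivity
  have hT0 : 0 ≤ (k + l) * (dr ^ 2 + dt ^ 2 + U) := by positivity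
  have hXY : 0 ≤ κ / 2 * (X ^ 2 + Y ^ 2) := by positivity
  generalize b * X ^ 2 - 2 * b * X * dt + (a * Y ^ 2 - 2 * a * Y * dr) + V = P at *
  generalize g' * (b * X ^ 2 + a * Y ^ 2) = P' at *
  have f3 : w * (g * (κ / 2 * (X ^ 2 + Y ^ 2) - (k + l) * (dr ^ 2 + dt ^ 2 + U))) ≤
      w * (g * P + P') := by
    apply mul_le_mul_of_nonneg_left _ hw
    have := mul_le_mul_of_nonneg_left f1 hg
    linarith
  have f4 : cW * ρ * (g * (κ / 2 * (X ^ 2 + Y ^ 2))) ≤ w * (g * (κ / 2 * (X ^ 2 + Y ^ 2))) :=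
    mul_le_mul_of_nonneg_right hw1 (by positivity)
  have f5 : w * (g * ((k + l) * (dr ^ 2 + dt ^ 2 + U))) ≤
      CW * ρ * (g * ((k + l) * (dr ^ 2 + dt ^ 2 + U))) :=
    mul_le_mul_of_nonneg_right hw2 (by positivity)
  linarith

namespace IsWeightedWeakSolution

variable {t0 t1 r0 q cW CW κ K L M : ℝ} {W A D : ℝ → ℝ} {B Z gr gt : ℝ × ℝ → ℝ}

theorem energyConst_nonneg (h : IsWeightedWeakSolution t0 t1 r0 q cW CW κ K L M W A D B Z gr gt) :
    0 ≤ energyConst cW CW κ K L M := by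
  unfold energyConst
  have := h.CW_nonneg
  have := h.κ_pos
  have := h.cW_pos
  have := h.L_nonneg
  have := h.M_nonneg
  positivity

theorem integrableOn_weight_mul
    (h : IsWeightedWeakSolution t0 t1 r0 q cW CW κ K L M W A D B Z gr gt)
    {f g : ℝ × ℝ → ℝ} (hf : Measurable f) (hf0 : ∀ p, 0 ≤ f p) (hf1 : ∀ p, f p ≤ 1)
    (hg : Continuous g) (hgc : HasCompactSupport g) :
    IntegrableOn (fun p => p.1 ^ q * (f p * g p)) (axisDomain r0 t0 t1) := by
  have hgi : IntegrableOn (fun p => r0 ^ q * |g p|) (axisDomain r0 t0 t1) :=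
    ((hg.integrable_of_hasCompactSupport hgc).abs.const_mul _).integrableOn
  refine Integrable.mono' hgi ?_ ?_
  · have := hg.measurable
    exact Measurable.aestronglyMeasurable (by fun_prop)
  · rw [ae_restrict_iff' (isOpen_axisDomain r0 t0 t1).measurableSet]
    refine Eventually.of_forall fun p hp => ?_
    have h1 : p.1 ^ q ≤ r0 ^ q := Real.rpow_le_rpow hp.1.1.le hp.1.2.le h.q_pos.le
    have h2 : 0 ≤ p.1 ^ q := Real.rpow_nonneg hp.1.1.le _
    rw [Real.norm_eq_abs, abs_mul, abs_mul, abs_of_nonneg h2, abs_of_nonneg (hf0 p)]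
    apply mul_le_mul h1 _ (mul_nonneg (hf0 p) (abs_nonneg _)) (h2.trans h1)
    exact mul_le_of_le_one_left (abs_nonneg _) (hf1 p)

theorem energy_interior (h : IsWeightedWeakSolution t0 t1 r0 q cW CW κ K L M W A D B Z gr gt)
    {ζ : ℝ × ℝ → ℝ} {G : ℝ → ℝ} {m R c : ℝ} (hζ : ContDiff ℝ (⊤ : ℕ∞) ζ)
    (hζc : HasCompactSupport ζ) (hζΩ : tsupport ζ ⊆ axisDomain r0 t0 t1)
    (hG : ContDiff ℝ (⊤ : ℕ∞) G) (hG0 : ∀ s, 0 ≤ G s) (hG1 : ∀ s, G s ≤ 1)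
    (hG' : ∀ s, 0 ≤ deriv G s) (hR : 0 < R) (hR1 : R ≤ 1)
    (hm : ∀ᵐ p, p ∈ axisDomain r0 t0 t1 → p ∈ tsupport ζ → m ≤ Z p) :
    IntegrableOn (fun p => p.1 ^ q * ((gr p ^ 2 + gt p ^ 2) / (Z p - m + R) ^ 2 *
      G (c - Real.log (Z p - m + R)) * ζ p ^ 2)) (axisDomain r0 t0 t1) ∧
    ∫ p in axisDomain r0 t0 t1, p.1 ^ q * ((gr p ^ 2 + gt p ^ 2) / (Z p - m + R) ^ 2 *
      G (c - Real.log (Z p - m + R)) * ζ p ^ 2) ≤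
    energyConst cW CW κ K L M * ∫ p in axisDomain r0 t0 t1, p.1 ^ q *
      (G (c - Real.log (Z p - m + R)) *
        (fderiv ℝ ζ p (1, 0) ^ 2 + fderiv ℝ ζ p (0, 1) ^ 2 + ζ p ^ 2 / R ^ 2)) := by
  set Ω := axisDomain r0 t0 t1 with hΩ
  have hΩm : MeasurableSet Ω := (isOpen_axisDomain r0 t0 t1).measurableSet
  obtain ⟨mZ, mr, mt⟩ := And.intro h.measurable_Z (And.intro h.measurable_gr h.measurable_gt)
  have mG : Measurable G := hG.continuous.measurable
  have mζ : Measurable ζ := hζ.continuous.measurable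
  have hζ1 : ContDiff ℝ 1 ζ := hζ.of_le (by exact_mod_cast le_top)
  have cr := continuous_fderiv_apply_const hζ1 (1, 0)
  have ct := continuous_fderiv_apply_const hζ1 (0, 1)
  set Kc := tsupport ζ with hKc
  have hKcc : IsCompact Kc := hζc
  have hζ0 : ∀ p ∉ Kc, ζ p = 0 := fun p hp => image_eq_zero_of_notMem_tsupport hp
  have hζd0 : ∀ e, ∀ p ∉ Kc, fderiv ℝ ζ p e = 0 := by
    intro e p hp
    have : fderiv ℝ ζ p = 0 := by
      by_contra hne
      exact hp (support_fderiv_subset ℝ hne)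
    rw [this]; rfl
  have hgc : HasCompactSupport fun p =>
      fderiv ℝ ζ p (1, 0) ^ 2 + fderiv ℝ ζ p (0, 1) ^ 2 + ζ p ^ 2 / R ^ 2 :=
    HasCompactSupport.intro hKcc fun p hp => by simp [hζ0 p hp, hζd0 _ p hp]
  have iR : IntegrableOn (fun p => p.1 ^ q * (G (c - Real.log (Z p - m + R)) *
      (fderiv ℝ ζ p (1, 0) ^ 2 + fderiv ℝ ζ p (0, 1) ^ 2 + ζ p ^ 2 / R ^ 2))) Ω :=
    h.integrableOn_weight_mul (f := fun p => G (c - Real.log (Z p - m + R))) (by fun_prop)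
      (fun p => hG0 _) (fun p => hG1 _)
      (((cr.pow 2).add (ct.pow 2)).add ((hζ.continuous.pow 2).div_const _)) hgc
  obtain ⟨E, hE⟩ := hKcc.exists_bound_of_continuousOn hζ.continuous.continuousOn
  have hsq := h.sq_integrable Kc hKcc hζΩ
  have iL : IntegrableOn (fun p => p.1 ^ q * ((gr p ^ 2 + gt p ^ 2) / (Z p - m + R) ^ 2 *
      G (c - Real.log (Z p - m + R)) * ζ p ^ 2)) Ω := by
    have ib : IntegrableOn (Kc.indicator fun p => r0 ^ q *
        ((gr p ^ 2 + gt p ^ 2) * (1 / R ^ 2 * 1 * E ^ 2))) Ω :=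
      ((integrable_indicator_iff hKcc.measurableSet).2
        (((hsq.1.add hsq.2).mul_const _).const_mul _)).integrableOn
    refine Integrable.mono' ib (Measurable.aestronglyMeasurable (by fun_prop)) ?_
    rw [ae_restrict_iff' hΩm]
    filter_upwards [hm] with p hp hpΩ
    by_cases hpK : p ∈ Kc
    · have hmp := hp hpΩ hpK
      have h1 : p.1 ^ q ≤ r0 ^ q := Real.rpow_le_rpow hpΩ.1.1.le hpΩ.1.2.le h.q_pos.le
      have h2 : 0 ≤ p.1 ^ q := Real.rpow_nonneg hpΩ.1.1.le _
      have hg0 := hG0 (c - Real.log (Z p - m + R))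
      have hg1 := hG1 (c - Real.log (Z p - m + R))
      have hz : ζ p ^ 2 ≤ E ^ 2 := by
        rw [← sq_abs]; exact pow_le_pow_left₀ (abs_nonneg _) (hE p hpK) 2
      rw [indicator_of_mem hpK, Real.norm_of_nonneg (by positivity)]
      have hu : R ^ 2 ≤ (Z p - m + R) ^ 2 := pow_le_pow_left₀ hR.le (by linarith) 2
      have e : (gr p ^ 2 + gt p ^ 2) / (Z p - m + R) ^ 2 *
          G (c - Real.log (Z p - m + R)) * ζ p ^ 2 = (gr p ^ 2 + gt p ^ 2) *
          (1 / (Z p - m + R) ^ 2 * G (c - Real.log (Z p - m + R)) * ζ p ^ 2) := by ring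
      rw [e]
      have := h2.trans h1
      gcongr
    · rw [indicator_of_notMem hpK, hζ0 p hpK]; simp
  have hη : ContDiff ℝ (⊤ : ℕ∞) fun p => ζ p * ζ p := hζ.mul hζ
  obtain ⟨iI, hI⟩ := h.weak_identity hη (contDiff_logTest hG m c hR) hζc.mul_right
    (tsupport_mul_subset_left.trans hζΩ)
  have hpt : ∀ᵐ p ∂volume.restrict Ω, κ * cW / 2 * (p.1 ^ q * ((gr p ^ 2 + gt p ^ 2) /
      (Z p - m + R) ^ 2 * G (c - Real.log (Z p - m + R)) * ζ p ^ 2)) ≤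
      CW * (2 * K ^ 2 / κ + L * M) * (p.1 ^ q * (G (c - Real.log (Z p - m + R)) *
      (fderiv ℝ ζ p (1, 0) ^ 2 + fderiv ℝ ζ p (0, 1) ^ 2 + ζ p ^ 2 / R ^ 2))) -
      W p.1 * (B p * gt p * (fderiv ℝ (fun p => ζ p * ζ p) p (0, 1) * logTest G m R c (Z p) +
          ζ p * ζ p * (deriv (logTest G m R c) (Z p) * gt p)) +
         A p.1 * gr p * (fderiv ℝ (fun p => ζ p * ζ p) p (1, 0) * logTest G m R c (Z p) +
          ζ p * ζ p * (deriv (logTest G m R c) (Z p) * gr p)) -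
         D p.1 * Z p * (ζ p * ζ p * logTest G m R c (Z p))) := by
    rw [ae_restrict_iff' hΩm]
    filter_upwards [hm] with p hp hpΩ
    have hd : ∀ e, fderiv ℝ (fun p => ζ p * ζ p) p e = 2 * ζ p * fderiv ℝ ζ p e := by
      intro e
      have h1 : HasFDerivAt ζ (fderiv ℝ ζ p) p := (hζ1.differentiable one_ne_zero p).hasFDerivAt
      have h2 : fderiv ℝ (fun p => ζ p * ζ p) p = _ := (h1.mul h1).fderiv
      rw [h2]
      simp
      ring
    by_cases hpK : p ∈ Kc
    · have hmp := hp hpΩ hpK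
      have hu : 0 < Z p - m + R := by linarith
      simp only [hd, logTest_of_le hR hmp,
        deriv_logTest_of_le (hG.differentiable (by simp)) hR hmp]
      set u := Z p - m + R with hu_def
      set g := G (c - Real.log u) with hg
      set g' := deriv G (c - Real.log u) with hg'
      have hg0 : 0 ≤ g := hG0 _
      have hg0' : 0 ≤ g' := hG' _
      obtain ⟨hW1, hW2⟩ := h.W_bounds _ hpΩ.1
      have hDZ : |D p.1 * Z p| ≤ L * M := by
        rw [abs_mul]
        exact mul_le_mul (h.D_bound _ hpΩ.1) (h.Z_bound p hpΩ) (abs_nonneg _) h.L_nonneg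
      exact energy_pointwise h.κ_pos (h.W_nonneg hpΩ.1) hW1 hW2 (h.A_bounds _ hpΩ.1).1
        (h.A_bounds _ hpΩ.1).2 (h.B_bounds _ hpΩ).1 (h.B_bounds _ hpΩ).2 hDZ hR hR1
        (by linarith) hg0 hg0'
    · simp [hd, hζ0 p hpK, hζd0 _ p hpK]
  refine ⟨iL, ?_⟩
  have hint := integral_mono_ae (iL.const_mul (κ * cW / 2))
    ((iR.const_mul (CW * (2 * K ^ 2 / κ + L * M))).sub iI) hpt
  have hsub := integral_sub (iR.const_mul (CW * (2 * K ^ 2 / κ + L * M))) iI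
  rw [hI, sub_zero, integral_const_mul] at hsub
  rw [integral_const_mul] at hint
  have hfin := hint.trans hsub.le
  have hκc : 0 < κ * cW := mul_pos h.κ_pos h.cW_pos
  unfold energyConst
  rw [← mul_le_mul_iff_right₀ (show 0 < κ * cW / 2 by positivity)]
  refine hfin.trans (le_of_eq ?_)
  have := h.κ_pos
  have := h.cW_pos
  field_simp

end IsWeightedWeakSolution

theorem integrable_and_integral_le_of_tendsto {α : Type*} [MeasurableSpace α] {ν : Measure α}
    {f : ℕ → α → ℝ} {g : α → ℝ} {c : ℕ → ℝ} {C : ℝ} (hf : ∀ n, Integrable (f n) ν)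
    (h0 : ∀ n, 0 ≤ᵐ[ν] f n) (hlim : ∀ᵐ x ∂ν, Tendsto (fun n => f n x) atTop (𝓝 (g x)))
    (hc : ∀ n, ∫ x, f n x ∂ν ≤ c n) (hC : Tendsto c atTop (𝓝 C)) :
    Integrable g ν ∧ ∫ x, g x ∂ν ≤ C := by
  have hgm : AEStronglyMeasurable g ν :=
    aestronglyMeasurable_of_tendsto_ae atTop (fun n => (hf n).aestronglyMeasurable) hlim
  have hg0 : 0 ≤ᵐ[ν] g := by
    filter_upwards [hlim, ae_all_iff.2 h0] with x hx h0x
    exact ge_of_tendsto' hx h0x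
  have hC0 : 0 ≤ C := ge_of_tendsto' hC fun n => (integral_nonneg_of_ae (h0 n)).trans (hc n)
  have hle : ∫⁻ x, ENNReal.ofReal (g x) ∂ν ≤ ENNReal.ofReal C := by
    calc ∫⁻ x, ENNReal.ofReal (g x) ∂ν
        = ∫⁻ x, liminf (fun n => ENNReal.ofReal (f n x)) atTop ∂ν := by
          apply lintegral_congr_ae
          filter_upwards [hlim] with x hx
          exact ((ENNReal.continuous_ofReal.tendsto _).comp hx).liminf_eq.symm
      _ ≤ liminf (fun n => ∫⁻ x, ENNReal.ofReal (f n x) ∂ν) atTop :=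
          lintegral_liminf_le' fun n => (hf n).aestronglyMeasurable.aemeasurable.ennreal_ofReal
      _ ≤ liminf (fun n => ENNReal.ofReal (c n)) atTop := by
          refine liminf_le_liminf (Eventually.of_forall fun n => ?_)
          rw [← ofReal_integral_eq_lintegral_ofReal (hf n) (h0 n)]
          exact ENNReal.ofReal_le_ofReal (hc n)
      _ = ENNReal.ofReal C := ((ENNReal.continuous_ofReal.tendsto _).comp hC).liminf_eq
  refine ⟨⟨hgm, ?_⟩, ?_⟩
  · rw [hasFiniteIntegral_iff_ofReal hg0]
    exact hle.trans_lt ENNReal.ofReal_lt_top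
  · rw [integral_eq_lintegral_of_nonneg_ae hg0 hgm]
    exact ENNReal.toReal_le_of_le_ofReal hC0 hle

theorem exists_deriv_smoothTransition_bound :
    ∃ C : ℝ, 1 ≤ C ∧ ∀ x, |deriv Real.smoothTransition x| ≤ C := by
  have hcd : ContDiff ℝ 1 Real.smoothTransition := Real.smoothTransition.contDiff (n := 1)
  obtain ⟨C, hC⟩ := (isCompact_Icc (a := (0:ℝ)) (b := 1)).exists_bound_of_continuousOn
    (hcd.continuous_deriv le_rfl).continuousOn
  refine ⟨max C 1, le_max_right _ _, fun x => ?_⟩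
  by_cases hx : x ∈ Icc (0:ℝ) 1
  · exact (hC x hx).trans (le_max_left _ _)
  · have : deriv Real.smoothTransition x = 0 := by
      rcases lt_or_ge x 0 with h | h
      · have : Real.smoothTransition =ᶠ[𝓝 x] fun _ => 0 := by
          filter_upwards [gt_mem_nhds h] with y hy
          exact Real.smoothTransition.zero_of_nonpos hy.le
        rw [this.deriv_eq, deriv_const]
      · have h1 : 1 < x := by
          by_contra h'
          exact hx ⟨h, not_lt.1 h'⟩
        have : Real.smoothTransition =ᶠ[𝓝 x] fun _ => 1 := by
          filter_upwards [lt_mem_nhds h1] with y hy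
          exact Real.smoothTransition.one_of_one_le hy.le
        rw [this.deriv_eq, deriv_const]
    rw [this, abs_zero]
    positivity

theorem deriv_smoothTransition_of_lt {x : ℝ} (h1 : 1 < x) :
    deriv Real.smoothTransition x = 0 := by
  have : Real.smoothTransition =ᶠ[𝓝 x] fun _ => 1 := by
    filter_upwards [lt_mem_nhds h1] with y hy
    exact Real.smoothTransition.one_of_one_le hy.le
  rw [this.deriv_eq, deriv_const]

namespace IsWeightedWeakSolution

variable {t0 t1 r0 q cW CW κ K L M : ℝ} {W A D : ℝ → ℝ} {B Z gr gt : ℝ × ℝ → ℝ}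

theorem energy_axis (h : IsWeightedWeakSolution t0 t1 r0 q cW CW κ K L M W A D B Z gr gt)
    {ζ : ℝ × ℝ → ℝ} {G : ℝ → ℝ} {m R c : ℝ} (hζ : ContDiff ℝ (⊤ : ℕ∞) ζ)
    (hζc : HasCompactSupport ζ) (hζΩ : tsupport ζ ⊆ Iio r0 ×ˢ Ioo t0 t1)
    (hG : ContDiff ℝ (⊤ : ℕ∞) G) (hG0 : ∀ s, 0 ≤ G s) (hG1 : ∀ s, G s ≤ 1)
    (hG' : ∀ s, 0 ≤ deriv G s) (hR : 0 < R) (hR1 : R ≤ 1)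
    (hm : ∀ᵐ p, p ∈ axisDomain r0 t0 t1 → p ∈ tsupport ζ → m ≤ Z p) :
    IntegrableOn (fun p => p.1 ^ q * ((gr p ^ 2 + gt p ^ 2) / (Z p - m + R) ^ 2 *
      G (c - Real.log (Z p - m + R)) * ζ p ^ 2)) (axisDomain r0 t0 t1) ∧
    ∫ p in axisDomain r0 t0 t1, p.1 ^ q * ((gr p ^ 2 + gt p ^ 2) / (Z p - m + R) ^ 2 *
      G (c - Real.log (Z p - m + R)) * ζ p ^ 2) ≤
    2 * energyConst cW CW κ K L M * ∫ p in axisDomain r0 t0 t1, p.1 ^ q *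
      (G (c - Real.log (Z p - m + R)) *
        (fderiv ℝ ζ p (1, 0) ^ 2 + fderiv ℝ ζ p (0, 1) ^ 2 + ζ p ^ 2 / R ^ 2)) := by
  set Ω := axisDomain r0 t0 t1 with hΩ
  have hΩm : MeasurableSet Ω := (isOpen_axisDomain r0 t0 t1).measurableSet
  have mZ := h.measurable_Z
  have mG : Measurable G := hG.continuous.measurable
  have hζ1 : ContDiff ℝ 1 ζ := hζ.of_le (by exact_mod_cast le_top)
  have cr := continuous_fderiv_apply_const hζ1 (1, 0)
  have ct := continuous_fderiv_apply_const hζ1 (0, 1)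
  obtain ⟨CT, hCT1, hCT⟩ := exists_deriv_smoothTransition_bound
  have hgc : HasCompactSupport fun p =>
      fderiv ℝ ζ p (1, 0) ^ 2 + fderiv ℝ ζ p (0, 1) ^ 2 + ζ p ^ 2 / R ^ 2 := by
    refine HasCompactSupport.intro hζc fun p hp => ?_
    have h1 : fderiv ℝ ζ p = 0 := by
      by_contra hne
      exact hp (support_fderiv_subset ℝ hne)
    simp [image_eq_zero_of_notMem_tsupport hp, h1]
  have mg : Measurable fun p => G (c - Real.log (Z p - m + R)) := by fun_prop
  have iR : IntegrableOn (fun p => p.1 ^ q * (G (c - Real.log (Z p - m + R)) *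
      (fderiv ℝ ζ p (1, 0) ^ 2 + fderiv ℝ ζ p (0, 1) ^ 2 + ζ p ^ 2 / R ^ 2))) Ω := h.integrableOn_weight_mul (f := fun p => G (c - Real.log (Z p - m + R))) mg
      (fun p => hG0 _) (fun p => hG1 _)
      (((cr.pow 2).add (ct.pow 2)).add ((hζ.continuous.pow 2).div_const _)) hgc
  obtain ⟨E, hE⟩ := hζ.continuous.bounded_above_of_compact_support hζc
  set ε : ℕ → ℝ := fun n => 1 / ((n : ℝ) + 1) with hε
  have hε0 : ∀ n, 0 < ε n := fun n => by positivity
  set χ : ℕ → ℝ × ℝ → ℝ := fun n p => Real.smoothTransition (p.1 / ε n - 1) with hχ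
  have hχs : ∀ n, ContDiff ℝ (⊤ : ℕ∞) (χ n) := fun n =>
    Real.smoothTransition.contDiff.comp ((contDiff_fst.div_const _).sub contDiff_const)
  have hT1 : ContDiff ℝ 1 Real.smoothTransition := Real.smoothTransition.contDiff (n := 1)
  have hχd : ∀ n p, HasFDerivAt (χ n)
      ((deriv Real.smoothTransition (p.1 / ε n - 1) * (ε n)⁻¹) •
        ContinuousLinearMap.fst ℝ ℝ ℝ) p := by
    intro n p
    have h1 : HasFDerivAt (fun p : ℝ × ℝ => p.1 / ε n - 1)
        ((ε n)⁻¹ • ContinuousLinearMap.fst ℝ ℝ ℝ) p := by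
      simpa [div_eq_mul_inv] using ((hasFDerivAt_fst (𝕜 := ℝ) (p := p)).mul_const (ε n)⁻¹).sub_const 1
    have h2 := (hT1.differentiable one_ne_zero (p.1 / ε n - 1)).hasDerivAt.comp_hasFDerivAt p h1
    rw [smul_smul] at h2
    exact h2
  set ζn : ℕ → ℝ × ℝ → ℝ := fun n p => χ n p * ζ p with hζn
  have hζns : ∀ n, ContDiff ℝ (⊤ : ℕ∞) (ζn n) := fun n => (hχs n).mul hζ
  have hζnd : ∀ n p e, fderiv ℝ (ζn n) p e = χ n p * fderiv ℝ ζ p e +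
      ζ p * (deriv Real.smoothTransition (p.1 / ε n - 1) * (ε n)⁻¹ * e.1) := by
    intro n p e
    have h1 : fderiv ℝ (ζn n) p = _ :=
      ((hχd n p).mul (hζ1.differentiable one_ne_zero p).hasFDerivAt).fderiv
    rw [h1]
    simp
  have hζnt : ∀ n, tsupport (ζn n) ⊆ tsupport ζ := fun n => tsupport_mul_subset_right
  have hζnΩ : ∀ n, tsupport (ζn n) ⊆ Ω := by
    intro n p hp
    have h1 := hζΩ (hζnt n hp)
    have h2 : tsupport (ζn n) ⊆ {p : ℝ × ℝ | ε n ≤ p.1} := by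
      apply closure_minimal _ (isClosed_le continuous_const continuous_fst)
      intro p hp
      by_contra hlt
      simp only [mem_ofPred_eq, not_le] at hlt
      apply hp
      have : χ n p = 0 := Real.smoothTransition.zero_of_nonpos (by
        rw [sub_nonpos, div_le_one (hε0 n)]; exact hlt.le)
      simp [hζn, this]
    exact ⟨⟨(hε0 n).trans_le (h2 hp), h1.1⟩, h1.2⟩
  have hen := fun n => h.energy_interior (c := c) (hζns n) hζc.mul_left (hζnΩ n) hG hG0 hG1 hG' hR
    hR1 (by filter_upwards [hm] with p hp hpΩ hpt using hp hpΩ (hζnt n hpt))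
  have hε_lim : Tendsto ε atTop (𝓝 0) := tendsto_one_div_add_atTop_nhds_zero_nat
  set I := ∫ p in Ω, p.1 ^ q * (G (c - Real.log (Z p - m + R)) *
        (fderiv ℝ ζ p (1, 0) ^ 2 + fderiv ℝ ζ p (0, 1) ^ 2 + ζ p ^ 2 / R ^ 2)) with hI
  set S : ℕ → Set (ℝ × ℝ) := fun n => Ioc 0 (2 * ε n) ×ˢ Ioo t0 t1 with hS
  have hSm : ∀ n, MeasurableSet (S n) := fun n => measurableSet_Ioc.prod measurableSet_Ioo
  have hSv : ∀ n, volume.real (S n) = 2 * ε n * max (t1 - t0) 0 := by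
    intro n
    rw [hS, measureReal_def, Measure.volume_eq_prod, Measure.prod_prod, Real.volume_Ioc,
      Real.volume_Ioo, ENNReal.toReal_mul, ENNReal.toReal_ofReal', ENNReal.toReal_ofReal', sub_zero,
      max_eq_left (by have := hε0 n; positivity)]
  have hSfin : ∀ n, volume (S n) ≠ ⊤ := by
    intro n
    rw [hS, Measure.volume_eq_prod, Measure.prod_prod, Real.volume_Ioc, Real.volume_Ioo]
    exact ENNReal.mul_ne_top ENNReal.ofReal_ne_top ENNReal.ofReal_ne_top
  set ex : ℕ → ℝ := fun n => (2 * ε n) ^ q * (2 * E ^ 2 * CT ^ 2 / ε n ^ 2) with hex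
  have hex0 : ∀ n, 0 ≤ ex n := fun n => by
    have := hε0 n
    positivity
  have hbound : ∀ n, ∫ p in Ω, p.1 ^ q * (G (c - Real.log (Z p - m + R)) *
        (fderiv ℝ (ζn n) p (1, 0) ^ 2 + fderiv ℝ (ζn n) p (0, 1) ^ 2 + ζn n p ^ 2 / R ^ 2)) ≤
        2 * I + ex n * (2 * ε n * max (t1 - t0) 0) := by
    intro n
    have hcd1 : ContDiff ℝ 1 (ζn n) := (hζns n).of_le (by exact_mod_cast le_top)
    have hgc' : HasCompactSupport fun p => fderiv ℝ (ζn n) p (1, 0) ^ 2 +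
        fderiv ℝ (ζn n) p (0, 1) ^ 2 + ζn n p ^ 2 / R ^ 2 := by
      refine HasCompactSupport.intro hζc fun p hp => ?_
      have hp' : p ∉ tsupport (ζn n) := fun h' => hp (hζnt n h')
      have h1 : fderiv ℝ (ζn n) p = 0 := by
        by_contra hne
        exact hp' (support_fderiv_subset ℝ hne)
      simp [image_eq_zero_of_notMem_tsupport hp', h1]
    have i1 : IntegrableOn (fun p => p.1 ^ q * (G (c - Real.log (Z p - m + R)) *
        (fderiv ℝ (ζn n) p (1, 0) ^ 2 + fderiv ℝ (ζn n) p (0, 1) ^ 2 + ζn n p ^ 2 / R ^ 2))) Ω :=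
      h.integrableOn_weight_mul (f := fun p => G (c - Real.log (Z p - m + R))) mg
      (fun p => hG0 _) (fun p => hG1 _)
      ((((continuous_fderiv_apply_const hcd1 (1, 0)).pow 2).add
        ((continuous_fderiv_apply_const hcd1 (0, 1)).pow 2)).add
        (((hζns n).continuous.pow 2).div_const _)) hgc'
    have i2 : IntegrableOn ((S n).indicator fun _ => ex n) Ω :=
      ((integrable_indicator_iff (hSm n)).2 (integrableOn_const (hSfin n))).integrableOn
    have hle : ∫ p in Ω, (S n).indicator (fun _ => ex n) p ≤ ex n * (2 * ε n * max (t1 - t0) 0) := by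
      have h1 : ∫ p in Ω, (S n).indicator (fun _ => ex n) p ≤
          ∫ p, (S n).indicator (fun _ => ex n) p :=
        setIntegral_le_integral ((integrable_indicator_iff (hSm n)).2
          (integrableOn_const (hSfin n)))
          (Eventually.of_forall fun p => indicator_nonneg (fun _ _ => hex0 n) p)
      refine h1.trans (le_of_eq ?_)
      rw [integral_indicator (hSm n), setIntegral_const, hSv, smul_eq_mul, mul_comm]
    calc _ ≤ ∫ p in Ω, (2 * (p.1 ^ q * (G (c - Real.log (Z p - m + R)) *
        (fderiv ℝ ζ p (1, 0) ^ 2 + fderiv ℝ ζ p (0, 1) ^ 2 + ζ p ^ 2 / R ^ 2))) +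
          (S n).indicator (fun _ => ex n) p) := by
          apply setIntegral_mono_on i1 ((iR.const_mul 2).add i2) hΩm
          intro p hp
          have hρ : 0 ≤ p.1 ^ q := Real.rpow_nonneg hp.1.1.le _
          have hg0 := hG0 (c - Real.log (Z p - m + R))
          have hg1 := hG1 (c - Real.log (Z p - m + R))
          set g := G (c - Real.log (Z p - m + R)) with hg
          have hχ0 : 0 ≤ χ n p := Real.smoothTransition.nonneg _
          have hχ1 : χ n p ≤ 1 := Real.smoothTransition.le_one _
          rw [hζnd, hζnd]
          simp only [mul_one, mul_zero, add_zero]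
          set T' := deriv Real.smoothTransition (p.1 / ε n - 1) with hT'
          set a := fderiv ℝ ζ p (1, 0)
          set b := fderiv ℝ ζ p (0, 1)
          have hχ2 : χ n p ^ 2 ≤ 1 := pow_le_one₀ hχ0 hχ1
          have e1 : (χ n p * a + ζ p * (T' * (ε n)⁻¹)) ^ 2 ≤
              2 * a ^ 2 + 2 * (ζ p * (T' * (ε n)⁻¹)) ^ 2 := by
            have : (χ n p * a) ^ 2 ≤ a ^ 2 := by
              rw [mul_pow]; exact mul_le_of_le_one_left (sq_nonneg _) hχ2
            nlinarith [sq_nonneg (χ n p * a - ζ p * (T' * (ε n)⁻¹))]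
          have e2 : (χ n p * b) ^ 2 ≤ b ^ 2 := by
            rw [mul_pow]; exact mul_le_of_le_one_left (sq_nonneg _) hχ2
          have e3 : ζn n p ^ 2 / R ^ 2 ≤ ζ p ^ 2 / R ^ 2 := by
            have : ζn n p ^ 2 ≤ ζ p ^ 2 := by
              simp only [hζn]
              rw [mul_pow]; exact mul_le_of_le_one_left (sq_nonneg _) hχ2
            gcongr
          have e4 : p.1 ^ q * (g * (2 * (ζ p * (T' * (ε n)⁻¹)) ^ 2)) ≤
              (S n).indicator (fun _ => ex n) p := by
            by_cases hpS : p.1 ≤ 2 * ε n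
            · rw [indicator_of_mem (show p ∈ S n from ⟨⟨hp.1.1, hpS⟩, hp.2⟩), hex]
              apply mul_le_mul (Real.rpow_le_rpow hp.1.1.le hpS h.q_pos.le) _ (by positivity)
                (Real.rpow_nonneg (by have := hε0 n; positivity) _)
              refine (mul_le_of_le_one_left (by positivity) hg1).trans ?_
              have z1 : ζ p ^ 2 ≤ E ^ 2 := by
                rw [← sq_abs]; exact pow_le_pow_left₀ (abs_nonneg _) (hE p) 2
              have z2 : T' ^ 2 ≤ CT ^ 2 := by
                rw [← sq_abs]; exact pow_le_pow_left₀ (abs_nonneg _) (hCT _) 2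
              have e : 2 * (ζ p * (T' * (ε n)⁻¹)) ^ 2 = 2 * ζ p ^ 2 * T' ^ 2 / ε n ^ 2 := by
                field_simp
              rw [e]
              gcongr
            · have : T' = 0 := deriv_smoothTransition_of_lt (by
                rw [lt_sub_iff_add_lt, lt_div_iff₀ (hε0 n)]
                push Not at hpS
                linarith)
              rw [this]
              simpa using indicator_nonneg (fun _ _ => hex0 n) p
          have e5 : 0 ≤ b ^ 2 + ζ p ^ 2 / R ^ 2 := by positivity
          have e6 : p.1 ^ q * (g * ((χ n p * a + ζ p * (T' * (ε n)⁻¹)) ^ 2 + (χ n p * b) ^ 2 +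
              ζn n p ^ 2 / R ^ 2)) ≤ p.1 ^ q * (g * (2 * (a ^ 2 + b ^ 2 + ζ p ^ 2 / R ^ 2) +
                2 * (ζ p * (T' * (ε n)⁻¹)) ^ 2)) := by
            apply mul_le_mul_of_nonneg_left _ hρ
            apply mul_le_mul_of_nonneg_left _ hg0
            linarith
          refine e6.trans ?_
          rw [mul_add g, mul_add (p.1 ^ q)]
          exact add_le_add (le_of_eq (by ring)) e4
      _ = 2 * I + ∫ p in Ω, (S n).indicator (fun _ => ex n) p := by
          rw [integral_add (iR.const_mul 2) i2, integral_const_mul]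
      _ ≤ _ := by linarith
  have hlim0 : Tendsto (fun n => ex n * (2 * ε n * max (t1 - t0) 0)) atTop (𝓝 0) := by
    have e : ∀ n, ex n * (2 * ε n * max (t1 - t0) 0) =
        2 ^ q * (4 * E ^ 2 * CT ^ 2 * max (t1 - t0) 0) * ε n ^ (q - 1) := by
      intro n
      have := hε0 n
      rw [hex]
      simp only
      rw [Real.mul_rpow two_pos.le this.le, Real.rpow_sub_one this.ne']
      field_simp
      ring
    simp only [e]
    have h1 : Tendsto (fun n => ε n ^ (q - 1)) atTop (𝓝 (0 ^ (q - 1))) :=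
      hε_lim.rpow_const (Or.inr (by linarith [h.one_lt_q]))
    rw [Real.zero_rpow (by linarith [h.one_lt_q])] at h1
    simpa using h1.const_mul (2 ^ q * (4 * E ^ 2 * CT ^ 2 * max (t1 - t0) 0))
  have hcl : Tendsto (fun n => energyConst cW CW κ K L M *
      (2 * I + ex n * (2 * ε n * max (t1 - t0) 0))) atTop
      (𝓝 (2 * energyConst cW CW κ K L M * I)) := by
    have := (hlim0.const_add (2 * I)).const_mul (energyConst cW CW κ K L M)
    rw [add_zero] at this
    convert this using 2
    ring
  refine integrable_and_integral_le_of_tendsto (fun n => (hen n).1) ?_ ?_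
    (fun n => (hen n).2.trans (mul_le_mul_of_nonneg_left (hbound n) h.energyConst_nonneg)) hcl
  · intro n
    rw [EventuallyLE, ae_restrict_iff' hΩm]
    refine Eventually.of_forall fun p hp => ?_
    have hρ : 0 ≤ p.1 ^ q := Real.rpow_nonneg hp.1.1.le _
    have hg0 := hG0 (c - Real.log (Z p - m + R))
    simp only [Pi.zero_apply]
    positivity
  · rw [ae_restrict_iff' hΩm]
    refine Eventually.of_forall fun p hp => ?_
    apply Tendsto.congr' _ tendsto_const_nhds
    filter_upwards [hε_lim.eventually_lt_const (show 0 < p.1 / 2 by linarith [hp.1.1])] with n hn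
    have : χ n p = 1 := Real.smoothTransition.one_of_one_le (by
      rw [le_sub_iff_add_le, le_div_iff₀ (hε0 n)]
      linarith)
    simp [hζn, this]

end IsWeightedWeakSolution

theorem tendsto_setIntegral_rect {f : ℝ × ℝ → ℝ} {a b c d : ℝ} (hab : a < b)
    (hf : IntegrableOn f (Ioc a b ×ˢ Icc c d)) :
    Tendsto (fun n : ℕ => ∫ p in Icc (a + (b - a) / (n + 1)) b ×ˢ Icc c d, f p) atTop
      (𝓝 (∫ p in Ioc a b ×ˢ Icc c d, f p)) := by
  have hba : 0 < b - a := sub_pos.2 hab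
  have hU : ⋃ n : ℕ, Icc (a + (b - a) / (n + 1)) b ×ˢ Icc c d = Ioc a b ×ˢ Icc c d := by
    ext ⟨r, t⟩
    simp only [mem_iUnion, mem_prod, mem_Icc, mem_Ioc]
    constructor
    · rintro ⟨n, ⟨h1, h2⟩, h3⟩
      have : 0 < (b - a) / ((n : ℝ) + 1) := by positivity
      exact ⟨⟨by linarith, h2⟩, h3⟩
    · rintro ⟨⟨h1, h2⟩, h3⟩
      have hl : Tendsto (fun n : ℕ => (b - a) / ((n : ℝ) + 1)) atTop (𝓝 0) := by
        have := tendsto_one_div_add_atTop_nhds_zero_nat (𝕜 := ℝ) |>.const_mul (b - a)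
        simpa [div_eq_mul_inv] using this
      obtain ⟨n, hn⟩ := (hl.eventually_le_const (show 0 < r - a by linarith)).exists
      exact ⟨n, ⟨by linarith, h2⟩, h3⟩
  rw [← hU]
  apply tendsto_setIntegral_of_monotone
  · exact fun n => measurableSet_Icc.prod measurableSet_Icc
  · intro m n hmn
    refine Set.prod_mono (Icc_subset_Icc ?_ le_rfl) le_rfl
    have : (m : ℝ) ≤ n := by exact_mod_cast hmn
    gcongr
  · rw [hU]; exact hf

theorem integral_abs_rpow_congr {a b c d q : ℝ} (ha : 0 < a) (f : ℝ × ℝ → ℝ) :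
    ∫ p in Icc a b ×ˢ Icc c d, |p.1| ^ q * f p = ∫ p in Icc a b ×ˢ Icc c d, p.1 ^ q * f p := by
  apply setIntegral_congr_fun (measurableSet_Icc.prod measurableSet_Icc)
  intro p hp
  simp only [abs_of_pos (ha.trans_le hp.1.1)]

theorem monotoneOn_abs_rpow {a b q : ℝ} (ha : 0 < a) (hq : 0 ≤ q) :
    MonotoneOn (fun r : ℝ => |r| ^ q) (Icc a b) := by
  intro x hx y _ hxy
  simp only
  have hx0 : 0 < x := ha.trans_le hx.1
  rw [abs_of_pos hx0, abs_of_pos (hx0.trans_le hxy)]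
  exact Real.rpow_le_rpow hx0.le hxy hq

namespace IsWeightedWeakSolution

variable {t0 t1 r0 q cW CW κ K L M : ℝ} {W A D : ℝ → ℝ} {B Z gr gt : ℝ × ℝ → ℝ}

theorem rect_subset {a b c d : ℝ} (ha : 0 ≤ a) (hbr : b < r0) (hc : t0 < c) (hd : d < t1) :
    Ioc a b ×ˢ Icc c d ⊆ axisDomain r0 t0 t1 := fun _ hp =>
  ⟨⟨ha.trans_lt hp.1.1, hp.1.2.trans_lt hbr⟩, ⟨hc.trans_le hp.2.1, hp.2.2.trans_lt hd⟩⟩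

theorem Icc_rect_subset {a b c d : ℝ} (ha : 0 < a) (hbr : b < r0) (hc : t0 < c) (hd : d < t1) :
    Icc a b ×ˢ Icc c d ⊆ axisDomain r0 t0 t1 := fun _ hp =>
  ⟨⟨ha.trans_le hp.1.1, hp.1.2.trans_lt hbr⟩, ⟨hc.trans_le hp.2.1, hp.2.2.trans_lt hd⟩⟩

theorem poincare_Icc (h : IsWeightedWeakSolution t0 t1 r0 q cW CW κ K L M W A D B Z gr gt)
    {a b c d l : ℝ} (ha : 0 < a) (hab : a ≤ b) (hbr : b < r0) (hcd : c ≤ d) (hc : t0 < c)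
    (hd : d < t1) (hbl : b - a ≤ l) (hdl : d - c ≤ l) {H : ℝ → ℝ}
    (hH : ContDiff ℝ (⊤ : ℕ∞) H) {S : Set (ℝ × ℝ)} (hS : ∀ᵐ p, p ∈ S → H (Z p) = 0) :
    (∫ p in Icc a b ×ˢ Icc c d, S.indicator (fun p => p.1 ^ q) p) *
      (∫ p in Icc a b ×ˢ Icc c d, p.1 ^ q * H (Z p) ^ 2) ≤
    2 * b ^ q * l ^ 2 * ((b - a) * (d - c)) *
      ∫ p in Icc a b ×ˢ Icc c d, p.1 ^ q * (deriv H (Z p) ^ 2 * (gr p ^ 2 + gt p ^ 2)) := by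
  set Q := Icc a b ×ˢ Icc c d with hQ
  have hQm : MeasurableSet Q := measurableSet_Icc.prod measurableSet_Icc
  have hQc : IsCompact Q := isCompact_Icc.prod isCompact_Icc
  have hQf : volume Q ≠ ⊤ := hQc.measure_lt_top.ne
  obtain ⟨z, T, C, hz, hT, hlim⟩ := h.exists_smooth_approx_comp hQc
    (Icc_rect_subset ha hbr hc hd) (η := fun _ => 1) contDiff_const hH
  simp only [one_mul, fderiv_fun_const, Pi.zero_apply, zero_apply,
    zero_mul, zero_add] at hlim
  have hvs : ∀ n, ContDiff ℝ 1 fun p => H (z n p) := fun n =>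
    (hH.comp (hz n)).of_le (by exact_mod_cast le_top)
  have hρc : Continuous fun r : ℝ => |r| ^ q :=
    continuous_abs.rpow_const fun _ => Or.inr h.q_pos.le
  have hmain := fun n => weighted_double_increment_le hρc (monotoneOn_abs_rpow ha h.q_pos.le)
    (fun s _ => by positivity) (hvs n) hab hcd hbl hdl
  have mZ := h.measurable_Z
  have mH : Measurable H := hH.continuous.measurable
  have hρb : ∀ p ∈ Q, |p.1| ^ q ≤ b ^ q := fun p hp => by
    rw [abs_of_pos (ha.trans_le hp.1.1)]
    exact Real.rpow_le_rpow (ha.trans_le hp.1.1).le hp.1.2 h.q_pos.le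
  have hlimR : Tendsto (fun n => ∫ p in Q, |p.1| ^ q * (fderiv ℝ (fun p => H (z n p)) p (1, 0) ^ 2 +
      fderiv ℝ (fun p => H (z n p)) p (0, 1) ^ 2)) atTop
      (𝓝 (∫ p in Q, |p.1| ^ q * ((deriv H (Z p) * gr p) ^ 2 + (deriv H (Z p) * gt p) ^ 2))) := by
    apply tendsto_integral_of_dominated_convergence (fun p => b ^ q * T p)
    · intro n
      apply Continuous.aestronglyMeasurable
      exact (hρc.comp continuous_fst).mul (((continuous_fderiv_apply_const (hvs n) _).pow 2).add
        ((continuous_fderiv_apply_const (hvs n) _).pow 2))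
    · exact hT.const_mul _
    · intro n
      rw [ae_restrict_iff' hQm]
      filter_upwards [hlim] with p hp hpQ
      obtain ⟨-, -, -, h4⟩ := hp hpQ
      rw [Real.norm_of_nonneg (by positivity)]
      exact mul_le_mul (hρb p hpQ) (h4 n).2 (by positivity)
        (Real.rpow_nonneg (ha.le.trans hab) _)
    · rw [ae_restrict_iff' hQm]
      filter_upwards [hlim] with p hp hpQ
      obtain ⟨-, h2, h3, -⟩ := hp hpQ
      exact ((h2.pow 2).add (h3.pow 2)).const_mul _
  have hlim2 : ∀ᵐ w ∂volume.restrict (Q ×ˢ Q),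
      (Tendsto (fun n => H (z n w.1)) atTop (𝓝 (H (Z w.1))) ∧ ∀ n, |H (z n w.1)| ≤ C) ∧
      (Tendsto (fun n => H (z n w.2)) atTop (𝓝 (H (Z w.2))) ∧ ∀ n, |H (z n w.2)| ≤ C) := by
    rw [ae_restrict_iff' (hQm.prod hQm), Measure.volume_eq_prod]
    filter_upwards [Measure.quasiMeasurePreserving_fst.ae hlim,
      Measure.quasiMeasurePreserving_snd.ae hlim] with w h1 h2 hw
    obtain ⟨a1, -, -, a2⟩ := h1 hw.1
    obtain ⟨b1, -, -, b2⟩ := h2 hw.2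
    exact ⟨⟨a1, fun n => (a2 n).1⟩, ⟨b1, fun n => (b2 n).1⟩⟩
  have hQQf : volume (Q ×ˢ Q) ≠ ⊤ := (hQc.prod hQc).measure_lt_top.ne
  have hdom : ∀ x y : ℝ, |x| ≤ C → |y| ≤ C → (x - y) ^ 2 ≤ (2 * C) ^ 2 := by
    intro x y hx hy
    rw [abs_le] at hx hy
    apply sq_le_sq' <;> linarith
  have hww : ∀ w ∈ Q ×ˢ Q, |w.1.1| ^ q * |w.2.1| ^ q ≤ b ^ q * b ^ q := fun w hw =>
    mul_le_mul (hρb _ hw.1) (hρb _ hw.2) (by positivity) (Real.rpow_nonneg (ha.le.trans hab) _)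
  have hlimL : Tendsto (fun n => ∫ w in Q ×ˢ Q, |w.1.1| ^ q * |w.2.1| ^ q *
      (H (z n w.1) - H (z n w.2)) ^ 2) atTop
      (𝓝 (∫ w in Q ×ˢ Q, |w.1.1| ^ q * |w.2.1| ^ q * (H (Z w.1) - H (Z w.2)) ^ 2)) := by
    apply tendsto_integral_of_dominated_convergence (fun _ => b ^ q * b ^ q * (2 * C) ^ 2)
    · intro n
      have hz' : Measurable (z n) := (hz n).continuous.measurable
      exact Measurable.aestronglyMeasurable (by fun_prop)
    · exact integrableOn_const hQQf
    · intro n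
      filter_upwards [hlim2, ae_restrict_mem (hQm.prod hQm)] with w hw hwm
      rw [Real.norm_of_nonneg (by positivity)]
      exact mul_le_mul (hww w hwm) (hdom _ _ (hw.1.2 n) (hw.2.2 n)) (by positivity)
        ((by positivity : 0 ≤ |w.1.1| ^ q * |w.2.1| ^ q).trans (hww w hwm))
    · filter_upwards [hlim2] with w hw
      exact ((hw.1.1.sub hw.2.1).pow 2).const_mul _
  have hlim3 := le_of_tendsto_of_tendsto' hlimL (hlimR.const_mul _) hmain
  rw [abs_of_pos (ha.trans_le hab), integral_abs_rpow_congr ha] at hlim3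
  have e : ∀ p, (deriv H (Z p) * gr p) ^ 2 + (deriv H (Z p) * gt p) ^ 2 =
      deriv H (Z p) ^ 2 * (gr p ^ 2 + gt p ^ 2) := fun p => by ring
  simp only [e] at hlim3
  refine le_trans ?_ hlim3
  rw [← setIntegral_prod_mul]
  have hfull : IntegrableOn (fun w : (ℝ × ℝ) × (ℝ × ℝ) => |w.1.1| ^ q * |w.2.1| ^ q *
      (H (Z w.1) - H (Z w.2)) ^ 2) (Q ×ˢ Q) := by
    refine Integrable.mono' (integrableOn_const hQQf (C := b ^ q * b ^ q * (2 * C) ^ 2)) ?_ ?_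
    · exact Measurable.aestronglyMeasurable (by fun_prop)
    · filter_upwards [hlim2, ae_restrict_mem (hQm.prod hQm)] with w hw hwm
      rw [Real.norm_of_nonneg (by positivity)]
      have h1 : |H (Z w.1)| ≤ C := le_of_tendsto' hw.1.1.abs hw.1.2
      have h2 : |H (Z w.2)| ≤ C := le_of_tendsto' hw.2.1.abs hw.2.2
      exact mul_le_mul (hww w hwm) (hdom _ _ h1 h2) (by positivity)
        ((by positivity : 0 ≤ |w.1.1| ^ q * |w.2.1| ^ q).trans (hww w hwm))
  apply integral_mono_of_nonneg
  · rw [EventuallyLE, ← Measure.volume_eq_prod, ae_restrict_iff' (hQm.prod hQm)]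
    refine Eventually.of_forall fun w hw => ?_
    have h1 : 0 ≤ w.1.1 ^ q := Real.rpow_nonneg (ha.le.trans hw.1.1.1) _
    have h2 : 0 ≤ w.2.1 ^ q := Real.rpow_nonneg (ha.le.trans hw.2.1.1) _
    exact mul_nonneg (indicator_apply_nonneg fun _ => h1) (mul_nonneg h2 (sq_nonneg _))
  · exact hfull
  · rw [EventuallyLE, ← Measure.volume_eq_prod, ae_restrict_iff' (hQm.prod hQm),
      Measure.volume_eq_prod]
    filter_upwards [Measure.quasiMeasurePreserving_fst.ae hS] with w h1 hw
    have p1 : 0 < w.1.1 := ha.trans_le hw.1.1.1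
    have p2 : 0 < w.2.1 := ha.trans_le hw.2.1.1
    by_cases hwS : w.1 ∈ S
    · rw [indicator_of_mem hwS, abs_of_pos p1, abs_of_pos p2, h1 hwS]
      apply le_of_eq; ring
    · rw [indicator_of_notMem hwS, zero_mul]
      positivity

theorem poincare (h : IsWeightedWeakSolution t0 t1 r0 q cW CW κ K L M W A D B Z gr gt)
    {a b c d l : ℝ} (ha : 0 ≤ a) (hab : a < b) (hbr : b < r0) (hcd : c ≤ d) (hc : t0 < c)
    (hd : d < t1) (hbl : b - a ≤ l) (hdl : d - c ≤ l) {H : ℝ → ℝ}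
    (hH : ContDiff ℝ (⊤ : ℕ∞) H) {S : Set (ℝ × ℝ)} (hSm : MeasurableSet S)
    (hS : ∀ᵐ p, p ∈ S → H (Z p) = 0)
    (hint : IntegrableOn (fun p => p.1 ^ q * (deriv H (Z p) ^ 2 * (gr p ^ 2 + gt p ^ 2)))
      (Ioc a b ×ˢ Icc c d)) :
    (∫ p in Ioc a b ×ˢ Icc c d, S.indicator (fun p => p.1 ^ q) p) *
      (∫ p in Ioc a b ×ˢ Icc c d, p.1 ^ q * H (Z p) ^ 2) ≤
    2 * b ^ q * l ^ 2 * ((b - a) * (d - c)) *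
      ∫ p in Ioc a b ×ˢ Icc c d, p.1 ^ q * (deriv H (Z p) ^ 2 * (gr p ^ 2 + gt p ^ 2)) := by
  have hQm : MeasurableSet (Ioc a b ×ˢ Icc c d) := measurableSet_Ioc.prod measurableSet_Icc
  have hQf : volume (Ioc a b ×ˢ Icc c d) ≠ ⊤ := ne_top_of_le_ne_top
    (isCompact_Icc.prod isCompact_Icc : IsCompact (Icc a b ×ˢ Icc c d)).measure_lt_top.ne
    (measure_mono (Set.prod_mono Ioc_subset_Icc_self le_rfl))
  have mZ := h.measurable_Z
  have mH : Measurable H := hH.continuous.measurable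
  obtain ⟨C, hC⟩ := (isCompact_Icc (a := -M) (b := M)).exists_bound_of_continuousOn
    hH.continuous.continuousOn
  have hρ : ∀ p ∈ Ioc a b ×ˢ Icc c d, 0 ≤ p.1 ^ q ∧ p.1 ^ q ≤ b ^ q := fun p hp =>
    ⟨Real.rpow_nonneg (ha.trans hp.1.1.le) _,
      Real.rpow_le_rpow (ha.trans hp.1.1.le) hp.1.2 h.q_pos.le⟩
  have i1 : IntegrableOn (S.indicator fun p => p.1 ^ q) (Ioc a b ×ˢ Icc c d) := by
    refine Integrable.mono' (integrableOn_const hQf (C := b ^ q)) ?_ ?_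
    · have : Measurable fun p : ℝ × ℝ => p.1 ^ q := by fun_prop
      exact (this.indicator hSm).aestronglyMeasurable
    · filter_upwards [ae_restrict_mem hQm] with p hp
      have := hρ p hp
      by_cases hpS : p ∈ S
      · rw [indicator_of_mem hpS, Real.norm_of_nonneg this.1]
        exact this.2
      · rw [indicator_of_notMem hpS, norm_zero]
        exact this.1.trans this.2
  have i2 : IntegrableOn (fun p => p.1 ^ q * H (Z p) ^ 2) (Ioc a b ×ˢ Icc c d) := by
    refine Integrable.mono' (integrableOn_const hQf (C := b ^ q * C ^ 2)) ?_ ?_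
    · exact Measurable.aestronglyMeasurable (by fun_prop)
    · filter_upwards [ae_restrict_mem hQm] with p hp
      have h1 := hρ p hp
      have h2 : H (Z p) ^ 2 ≤ C ^ 2 := by
        rw [← sq_abs]
        exact pow_le_pow_left₀ (abs_nonneg _)
          (hC _ (abs_le.1 (h.Z_bound p (rect_subset ha hbr hc hd hp)))) 2
      rw [Real.norm_of_nonneg (mul_nonneg h1.1 (sq_nonneg _))]
      exact mul_le_mul h1.2 h2 (sq_nonneg _) (h1.1.trans h1.2)
  have hab' : 0 < b - a := sub_pos.2 hab
  refine le_of_tendsto' ((tendsto_setIntegral_rect hab i1).mul (tendsto_setIntegral_rect hab i2))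
    fun n => ?_
  have hn : 0 < (b - a) / ((n : ℝ) + 1) := by positivity
  have hn2 : (b - a) / ((n : ℝ) + 1) ≤ b - a := div_le_self hab'.le (by
    linarith [(Nat.cast_nonneg n : (0:ℝ) ≤ n)])
  refine (h.poincare_Icc (a := a + (b - a) / (n + 1)) (by linarith) (by linarith) hbr hcd hc hd
    (by linarith) hdl hH hS).trans ?_
  have hbq : 0 ≤ b ^ q := Real.rpow_nonneg (ha.trans hab.le) _
  have hdc : 0 ≤ d - c := sub_nonneg.2 hcd
  have hnn : ∀ p ∈ Ioc a b ×ˢ Icc c d,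
      0 ≤ p.1 ^ q * (deriv H (Z p) ^ 2 * (gr p ^ 2 + gt p ^ 2)) := fun p hp =>
    mul_nonneg (hρ p hp).1 (by positivity)
  have hsub : Icc (a + (b - a) / (n + 1)) b ×ˢ Icc c d ⊆ Ioc a b ×ˢ Icc c d :=
    Set.prod_mono (fun x hx => ⟨by linarith [hx.1], hx.2⟩) le_rfl
  apply mul_le_mul
  · gcongr
    linarith
  · exact setIntegral_mono_set hint ((ae_restrict_mem hQm).mono hnn) hsub.eventuallyLE
  · exact setIntegral_nonneg (measurableSet_Icc.prod measurableSet_Icc)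
      fun p hp => hnn p (hsub hp)
  · positivity

theorem ladyzhenskaya_Icc (h : IsWeightedWeakSolution t0 t1 r0 q cW CW κ K L M W A D B Z gr gt)
    {a b c d l : ℝ} (ha : 0 < a) (hab : a ≤ b) (hbr : b < r0) (hcd : c ≤ d) (hc : t0 < c)
    (hd : d < t1) (hl : 0 < l) (hbl : b - a ≤ l) {H : ℝ → ℝ} {ζ : ℝ × ℝ → ℝ}
    (hH : ContDiff ℝ (⊤ : ℕ∞) H) (hζ : ContDiff ℝ (⊤ : ℕ∞) ζ) (hζb : ∀ t, ζ (b, t) = 0)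
    (hζc : ∀ r, ζ (r, c) = 0) :
    ∫ p in Icc a b ×ˢ Icc c d, (p.1 ^ q * (ζ p * H (Z p)) ^ 2) ^ 2 ≤
    (l⁻¹ * (∫ p in Icc a b ×ˢ Icc c d, p.1 ^ q * (ζ p * H (Z p)) ^ 2) +
      l * ∫ p in Icc a b ×ˢ Icc c d, p.1 ^ q *
        ((fderiv ℝ ζ p (1, 0) * H (Z p) + ζ p * (deriv H (Z p) * gr p)) ^ 2 +
          (fderiv ℝ ζ p (0, 1) * H (Z p) + ζ p * (deriv H (Z p) * gt p)) ^ 2)) ^ 2 := by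
  set Q := Icc a b ×ˢ Icc c d with hQ
  have hQm : MeasurableSet Q := measurableSet_Icc.prod measurableSet_Icc
  have hQc : IsCompact Q := isCompact_Icc.prod isCompact_Icc
  have hQf : volume Q ≠ ⊤ := hQc.measure_lt_top.ne
  obtain ⟨z, T, C, hz, hT, hlim⟩ := h.exists_smooth_approx_comp hQc
    (Icc_rect_subset ha hbr hc hd) hζ hH
  have hvs : ∀ n, ContDiff ℝ 1 fun p => ζ p * H (z n p) := fun n =>
    (hζ.mul (hH.comp (hz n))).of_le (by exact_mod_cast le_top)
  have hρc : Continuous fun r : ℝ => |r| ^ q :=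
    continuous_abs.rpow_const fun _ => Or.inr h.q_pos.le
  have hmain := fun n => weighted_ladyzhenskaya hρc (monotoneOn_abs_rpow ha h.q_pos.le)
    (fun s _ => by positivity) (hvs n) hab hcd hl hbl (fun t => by rw [hζb, zero_mul])
    (fun r => by rw [hζc, zero_mul])
  have hb0 : 0 ≤ b ^ q := Real.rpow_nonneg (ha.le.trans hab) _
  have hρb : ∀ p ∈ Q, |p.1| ^ q ≤ b ^ q := fun p hp => by
    rw [abs_of_pos (ha.trans_le hp.1.1)]
    exact Real.rpow_le_rpow (ha.trans_le hp.1.1).le hp.1.2 h.q_pos.le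
  have hsq : ∀ x : ℝ, |x| ≤ C → x ^ 2 ≤ C ^ 2 := fun x hx => by
    rw [← sq_abs]; exact pow_le_pow_left₀ (abs_nonneg _) hx 2
  have hlimR : Tendsto (fun n => ∫ p in Q, |p.1| ^ q *
      (fderiv ℝ (fun p => ζ p * H (z n p)) p (1, 0) ^ 2 +
      fderiv ℝ (fun p => ζ p * H (z n p)) p (0, 1) ^ 2)) atTop
      (𝓝 (∫ p in Q, |p.1| ^ q *
        ((fderiv ℝ ζ p (1, 0) * H (Z p) + ζ p * (deriv H (Z p) * gr p)) ^ 2 +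
          (fderiv ℝ ζ p (0, 1) * H (Z p) + ζ p * (deriv H (Z p) * gt p)) ^ 2))) := by
    apply tendsto_integral_of_dominated_convergence (fun p => b ^ q * T p)
    · intro n
      apply Continuous.aestronglyMeasurable
      exact (hρc.comp continuous_fst).mul (((continuous_fderiv_apply_const (hvs n) _).pow 2).add
        ((continuous_fderiv_apply_const (hvs n) _).pow 2))
    · exact hT.const_mul _
    · intro n
      rw [ae_restrict_iff' hQm]
      filter_upwards [hlim] with p hp hpQ
      obtain ⟨-, -, -, h4⟩ := hp hpQ
      rw [Real.norm_of_nonneg (by positivity)]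
      exact mul_le_mul (hρb p hpQ) (h4 n).2 (by positivity) hb0
    · rw [ae_restrict_iff' hQm]
      filter_upwards [hlim] with p hp hpQ
      obtain ⟨-, h2, h3, -⟩ := hp hpQ
      exact ((h2.pow 2).add (h3.pow 2)).const_mul _
  have hlim1 : Tendsto (fun n => ∫ p in Q, |p.1| ^ q * (ζ p * H (z n p)) ^ 2) atTop
      (𝓝 (∫ p in Q, |p.1| ^ q * (ζ p * H (Z p)) ^ 2)) := by
    apply tendsto_integral_of_dominated_convergence (fun p => b ^ q * C ^ 2)
    · intro n
      exact ((hρc.comp continuous_fst).mul ((hvs n).continuous.pow 2)).aestronglyMeasurable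
    · exact integrableOn_const hQf
    · intro n
      rw [ae_restrict_iff' hQm]
      filter_upwards [hlim] with p hp hpQ
      obtain ⟨-, -, -, h4⟩ := hp hpQ
      rw [Real.norm_of_nonneg (by positivity)]
      exact mul_le_mul (hρb p hpQ) (hsq _ (h4 n).1) (by positivity) hb0
    · rw [ae_restrict_iff' hQm]
      filter_upwards [hlim] with p hp hpQ
      exact ((hp hpQ).1.pow 2).const_mul _
  have hlim2 : Tendsto (fun n => ∫ p in Q, (|p.1| ^ q * (ζ p * H (z n p)) ^ 2) ^ 2) atTop
      (𝓝 (∫ p in Q, (|p.1| ^ q * (ζ p * H (Z p)) ^ 2) ^ 2)) := by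
    apply tendsto_integral_of_dominated_convergence (fun p => (b ^ q * C ^ 2) ^ 2)
    · intro n
      exact (((hρc.comp continuous_fst).mul ((hvs n).continuous.pow 2)).pow 2).aestronglyMeasurable
    · exact integrableOn_const hQf
    · intro n
      rw [ae_restrict_iff' hQm]
      filter_upwards [hlim] with p hp hpQ
      obtain ⟨-, -, -, h4⟩ := hp hpQ
      rw [Real.norm_of_nonneg (by positivity)]
      refine pow_le_pow_left₀ (by positivity) ?_ 2
      exact mul_le_mul (hρb p hpQ) (hsq _ (h4 n).1) (by positivity) hb0
    · rw [ae_restrict_iff' hQm]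
      filter_upwards [hlim] with p hp hpQ
      exact (((hp hpQ).1.pow 2).const_mul _).pow 2
  have hfin := le_of_tendsto_of_tendsto' hlim2
    (((hlim1.const_mul l⁻¹).add (hlimR.const_mul l)).pow 2) hmain
  rw [integral_abs_rpow_congr ha, integral_abs_rpow_congr ha] at hfin
  refine le_trans (le_of_eq ?_) hfin
  apply setIntegral_congr_fun hQm
  intro p hp
  simp only [abs_of_pos (ha.trans_le hp.1.1)]

theorem ladyzhenskaya (h : IsWeightedWeakSolution t0 t1 r0 q cW CW κ K L M W A D B Z gr gt)
    {a b c d l : ℝ} (ha : 0 ≤ a) (hab : a < b) (hbr : b < r0) (hcd : c ≤ d) (hc : t0 < c)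
    (hd : d < t1) (hl : 0 < l) (hbl : b - a ≤ l) {H : ℝ → ℝ} {ζ : ℝ × ℝ → ℝ}
    (hH : ContDiff ℝ (⊤ : ℕ∞) H) (hζ : ContDiff ℝ (⊤ : ℕ∞) ζ) (hζb : ∀ t, ζ (b, t) = 0)
    (hζc : ∀ r, ζ (r, c) = 0)
    (hint : IntegrableOn (fun p => p.1 ^ q * (ζ p ^ 2 * (deriv H (Z p) ^ 2 *
      (gr p ^ 2 + gt p ^ 2)))) (Ioc a b ×ˢ Icc c d)) :
    ∫ p in Ioc a b ×ˢ Icc c d, (p.1 ^ q * (ζ p * H (Z p)) ^ 2) ^ 2 ≤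
    (l⁻¹ * (∫ p in Ioc a b ×ˢ Icc c d, p.1 ^ q * (ζ p * H (Z p)) ^ 2) +
      2 * l * ((∫ p in Ioc a b ×ˢ Icc c d, p.1 ^ q *
        ((fderiv ℝ ζ p (1, 0) ^ 2 + fderiv ℝ ζ p (0, 1) ^ 2) * H (Z p) ^ 2)) +
      ∫ p in Ioc a b ×ˢ Icc c d, p.1 ^ q * (ζ p ^ 2 * (deriv H (Z p) ^ 2 *
        (gr p ^ 2 + gt p ^ 2))))) ^ 2 := by
  set Q := Ioc a b ×ˢ Icc c d with hQ
  have hQm : MeasurableSet Q := measurableSet_Ioc.prod measurableSet_Icc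
  have hQc : IsCompact (Icc a b ×ˢ Icc c d) := isCompact_Icc.prod isCompact_Icc
  have hQQ : Q ⊆ Icc a b ×ˢ Icc c d := Set.prod_mono Ioc_subset_Icc_self le_rfl
  have hQf : volume Q ≠ ⊤ := ne_top_of_le_ne_top hQc.measure_lt_top.ne (measure_mono hQQ)
  have mZ := h.measurable_Z
  have mr := h.measurable_gr
  have mt := h.measurable_gt
  have mH : Measurable H := hH.continuous.measurable
  have mζ : Measurable ζ := hζ.continuous.measurable
  have hζ1 : ContDiff ℝ 1 ζ := hζ.of_le (by exact_mod_cast le_top)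
  have cd1 := continuous_fderiv_apply_const hζ1 (1, 0)
  have cd2 := continuous_fderiv_apply_const hζ1 (0, 1)
  have md1 := cd1.measurable
  have md2 := cd2.measurable
  obtain ⟨C, hC⟩ := (isCompact_Icc (a := -M) (b := M)).exists_bound_of_continuousOn
    hH.continuous.continuousOn
  obtain ⟨Cz, hCz⟩ := hQc.exists_bound_of_continuousOn hζ.continuous.continuousOn
  obtain ⟨Cd, hCd⟩ := hQc.exists_bound_of_continuousOn
    ((cd1.pow 2).add (cd2.pow 2)).continuousOn
  have hb0 : 0 ≤ b ^ q := Real.rpow_nonneg (ha.trans hab.le) _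
  have hρ : ∀ p ∈ Q, 0 ≤ p.1 ^ q ∧ p.1 ^ q ≤ b ^ q := fun p hp =>
    ⟨Real.rpow_nonneg (ha.trans hp.1.1.le) _,
      Real.rpow_le_rpow (ha.trans hp.1.1.le) hp.1.2 h.q_pos.le⟩
  have hHb : ∀ p ∈ Q, H (Z p) ^ 2 ≤ C ^ 2 := fun p hp => by
    rw [← sq_abs]
    exact pow_le_pow_left₀ (abs_nonneg _)
      (hC _ (abs_le.1 (h.Z_bound p (rect_subset ha hbr hc hd hp)))) 2
  have hvb : ∀ p ∈ Q, (ζ p * H (Z p)) ^ 2 ≤ Cz ^ 2 * C ^ 2 := fun p hp => by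
    rw [mul_pow]
    refine mul_le_mul ?_ (hHb p hp) (sq_nonneg _) (sq_nonneg _)
    rw [← sq_abs]
    exact pow_le_pow_left₀ (abs_nonneg _) (hCz p (hQQ hp)) 2
  have i1 : IntegrableOn (fun p => p.1 ^ q * (ζ p * H (Z p)) ^ 2) Q := by
    refine Integrable.mono' (integrableOn_const hQf (C := b ^ q * (Cz ^ 2 * C ^ 2))) ?_ ?_
    · exact Measurable.aestronglyMeasurable (by fun_prop)
    · filter_upwards [ae_restrict_mem hQm] with p hp
      have h1 := hρ p hp
      rw [Real.norm_of_nonneg (mul_nonneg h1.1 (sq_nonneg _))]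
      exact mul_le_mul h1.2 (hvb p hp) (sq_nonneg _) hb0
  have i2 : IntegrableOn (fun p => (p.1 ^ q * (ζ p * H (Z p)) ^ 2) ^ 2) Q := by
    refine Integrable.mono' (integrableOn_const hQf (C := (b ^ q * (Cz ^ 2 * C ^ 2)) ^ 2)) ?_ ?_
    · exact Measurable.aestronglyMeasurable (by fun_prop)
    · filter_upwards [ae_restrict_mem hQm] with p hp
      have h1 := hρ p hp
      have h2 : 0 ≤ p.1 ^ q * (ζ p * H (Z p)) ^ 2 := mul_nonneg h1.1 (sq_nonneg _)
      rw [Real.norm_of_nonneg (sq_nonneg _)]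
      exact pow_le_pow_left₀ h2 (mul_le_mul h1.2 (hvb p hp) (sq_nonneg _) hb0) 2
  have i3 : IntegrableOn (fun p => p.1 ^ q *
      ((fderiv ℝ ζ p (1, 0) ^ 2 + fderiv ℝ ζ p (0, 1) ^ 2) * H (Z p) ^ 2)) Q := by
    refine Integrable.mono' (integrableOn_const hQf (C := b ^ q * (Cd * C ^ 2))) ?_ ?_
    · exact Measurable.aestronglyMeasurable (by fun_prop)
    · filter_upwards [ae_restrict_mem hQm] with p hp
      have h1 := hρ p hp
      have h2 : fderiv ℝ ζ p (1, 0) ^ 2 + fderiv ℝ ζ p (0, 1) ^ 2 ≤ Cd :=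
        (le_abs_self _).trans (hCd p (hQQ hp))
      rw [Real.norm_of_nonneg (mul_nonneg h1.1 (by positivity))]
      refine mul_le_mul h1.2 ?_ (by positivity) hb0
      exact mul_le_mul h2 (hHb p hp) (sq_nonneg _)
        ((by positivity : 0 ≤ fderiv ℝ ζ p (1, 0) ^ 2 + fderiv ℝ ζ p (0, 1) ^ 2).trans h2)
  have hab' : 0 < b - a := sub_pos.2 hab
  refine le_of_tendsto_of_tendsto' (tendsto_setIntegral_rect hab i2)
    ((((tendsto_setIntegral_rect hab i1).const_mul l⁻¹).add (tendsto_const_nhds (x :=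
      2 * l * ((∫ p in Q, p.1 ^ q *
        ((fderiv ℝ ζ p (1, 0) ^ 2 + fderiv ℝ ζ p (0, 1) ^ 2) * H (Z p) ^ 2)) +
      ∫ p in Q, p.1 ^ q * (ζ p ^ 2 * (deriv H (Z p) ^ 2 *
        (gr p ^ 2 + gt p ^ 2))))))).pow 2) fun n => ?_
  have hn : 0 < (b - a) / ((n : ℝ) + 1) := by positivity
  have hn2 : (b - a) / ((n : ℝ) + 1) ≤ b - a := div_le_self hab'.le (by
    linarith [(Nat.cast_nonneg n : (0:ℝ) ≤ n)])
  refine (h.ladyzhenskaya_Icc (a := a + (b - a) / (n + 1)) (by linarith) (by linarith) hbr hcd hc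
    hd hl (by linarith) hH hζ hζb hζc).trans ?_
  have hsub : Icc (a + (b - a) / (n + 1)) b ×ˢ Icc c d ⊆ Q :=
    Set.prod_mono (fun x hx => ⟨by linarith [hx.1], hx.2⟩) le_rfl
  have hQnm : MeasurableSet (Icc (a + (b - a) / (n + 1)) b ×ˢ Icc c d) :=
    measurableSet_Icc.prod measurableSet_Icc
  have n1 : ∀ p ∈ Q, 0 ≤ p.1 ^ q * (ζ p * H (Z p)) ^ 2 := fun p hp =>
    mul_nonneg (hρ p hp).1 (by positivity)
  have hgrad : ∫ p in Icc (a + (b - a) / (n + 1)) b ×ˢ Icc c d, p.1 ^ q *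
        ((fderiv ℝ ζ p (1, 0) * H (Z p) + ζ p * (deriv H (Z p) * gr p)) ^ 2 +
          (fderiv ℝ ζ p (0, 1) * H (Z p) + ζ p * (deriv H (Z p) * gt p)) ^ 2) ≤
      2 * ((∫ p in Q, p.1 ^ q *
        ((fderiv ℝ ζ p (1, 0) ^ 2 + fderiv ℝ ζ p (0, 1) ^ 2) * H (Z p) ^ 2)) +
      ∫ p in Q, p.1 ^ q * (ζ p ^ 2 * (deriv H (Z p) ^ 2 * (gr p ^ 2 + gt p ^ 2)))) := by
    rw [← integral_add i3 hint, ← integral_const_mul]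
    have i4 := (i3.add hint).const_mul 2
    refine le_trans (integral_mono_of_nonneg ?_ (i4.mono_measure
      (Measure.restrict_mono hsub le_rfl)) ?_) (setIntegral_mono_set i4 ?_ hsub.eventuallyLE)
    · filter_upwards [ae_restrict_mem hQnm] with p hp
      exact mul_nonneg (hρ p (hsub hp)).1 (by positivity)
    · filter_upwards [ae_restrict_mem hQnm] with p hp
      have e : 2 * (p.1 ^ q * ((fderiv ℝ ζ p (1, 0) ^ 2 + fderiv ℝ ζ p (0, 1) ^ 2) * H (Z p) ^ 2) +
          p.1 ^ q * (ζ p ^ 2 * (deriv H (Z p) ^ 2 * (gr p ^ 2 + gt p ^ 2)))) =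
        p.1 ^ q * ((2 * (fderiv ℝ ζ p (1, 0) * H (Z p)) ^ 2 +
          2 * (ζ p * (deriv H (Z p) * gr p)) ^ 2) + (2 * (fderiv ℝ ζ p (0, 1) * H (Z p)) ^ 2 +
          2 * (ζ p * (deriv H (Z p) * gt p)) ^ 2)) := by ring
      simp only [Pi.add_apply]
      rw [e]
      refine mul_le_mul_of_nonneg_left (add_le_add ?_ ?_) (hρ p (hsub hp)).1
      · nlinarith [sq_nonneg (fderiv ℝ ζ p (1, 0) * H (Z p) - ζ p * (deriv H (Z p) * gr p))]
      · nlinarith [sq_nonneg (fderiv ℝ ζ p (0, 1) * H (Z p) - ζ p * (deriv H (Z p) * gt p))]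
    · filter_upwards [ae_restrict_mem hQm] with p hp
      have := (hρ p hp).1
      simp only [Pi.add_apply, Pi.zero_apply]
      positivity
  have g0 : 0 ≤ ∫ p in Icc (a + (b - a) / (n + 1)) b ×ˢ Icc c d, p.1 ^ q *
        ((fderiv ℝ ζ p (1, 0) * H (Z p) + ζ p * (deriv H (Z p) * gr p)) ^ 2 +
          (fderiv ℝ ζ p (0, 1) * H (Z p) + ζ p * (deriv H (Z p) * gt p)) ^ 2) :=
    setIntegral_nonneg hQnm fun p hp => mul_nonneg (hρ p (hsub hp)).1 (by positivity)
  have g1 : 0 ≤ ∫ p in Icc (a + (b - a) / (n + 1)) b ×ˢ Icc c d, p.1 ^ q * (ζ p * H (Z p)) ^ 2 :=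
    setIntegral_nonneg hQnm fun p hp => n1 p (hsub hp)
  have hl1 : 0 < l⁻¹ := inv_pos.2 hl
  refine pow_le_pow_left₀ (by positivity) ?_ 2
  refine add_le_add le_rfl ?_
  calc _ ≤ l * (2 * _) := mul_le_mul_of_nonneg_left hgrad hl.le
    _ = _ := by ring

end IsWeightedWeakSolution

/-- A smooth plateau: equal to `1` for `|x - x₀| ≤ ρ` and to `0` for `|x - x₀| ≥ ρ + e`. -/
noncomputable def plateau (x₀ ρ e x : ℝ) : ℝ :=
  Real.smoothTransition ((ρ + e - (x - x₀)) / e) * Real.smoothTransition ((ρ + e + (x - x₀)) / e)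

theorem contDiff_plateau (x₀ ρ e : ℝ) : ContDiff ℝ (⊤ : ℕ∞) (plateau x₀ ρ e) := by
  unfold plateau
  exact (Real.smoothTransition.contDiff.comp (by fun_prop)).mul
    (Real.smoothTransition.contDiff.comp (by fun_prop))

theorem plateau_nonneg (x₀ ρ e x : ℝ) : 0 ≤ plateau x₀ ρ e x :=
  mul_nonneg (Real.smoothTransition.nonneg _) (Real.smoothTransition.nonneg _)

theorem plateau_le_one (x₀ ρ e x : ℝ) : plateau x₀ ρ e x ≤ 1 :=
  mul_le_one₀ (Real.smoothTransition.le_one _) (Real.smoothTransition.nonneg _)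
    (Real.smoothTransition.le_one _)

theorem plateau_eq_one {x₀ ρ e x : ℝ} (he : 0 < e) (h : x ∈ Icc (x₀ - ρ) (x₀ + ρ)) :
    plateau x₀ ρ e x = 1 := by
  unfold plateau
  rw [Real.smoothTransition.one_of_one_le, Real.smoothTransition.one_of_one_le, one_mul]
  · rw [le_div_iff₀ he]; linarith [h.1]
  · rw [le_div_iff₀ he]; linarith [h.2]

theorem plateau_eq_zero {x₀ ρ e x : ℝ} (he : 0 < e) (h : x ∉ Icc (x₀ - (ρ + e)) (x₀ + (ρ + e))) :
    plateau x₀ ρ e x = 0 := by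
  unfold plateau
  rw [mem_Icc, not_and_or, not_le, not_le] at h
  rcases h with h | h
  · rw [Real.smoothTransition.zero_of_nonpos (x := (ρ + e + (x - x₀)) / e), mul_zero]
    exact div_nonpos_of_nonpos_of_nonneg (by linarith) he.le
  · rw [Real.smoothTransition.zero_of_nonpos, zero_mul]
    exact div_nonpos_of_nonpos_of_nonneg (by linarith) he.le

theorem abs_deriv_plateau_le {C x₀ ρ e : ℝ} (hC : ∀ x, |deriv Real.smoothTransition x| ≤ C)
    (he : 0 < e) (x : ℝ) : |deriv (plateau x₀ ρ e) x| ≤ 2 * C / e := by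
  have hT : Differentiable ℝ Real.smoothTransition :=
    (Real.smoothTransition.contDiff (n := 1)).differentiable one_ne_zero
  have h1 : HasDerivAt (fun x => (ρ + e - (x - x₀)) / e) (-1 / e) x :=
    (((hasDerivAt_id x).sub_const x₀).const_sub (ρ + e)).div_const e
  have h2 : HasDerivAt (fun x => (ρ + e + (x - x₀)) / e) (1 / e) x :=
    (((hasDerivAt_id x).sub_const x₀).const_add (ρ + e)).div_const e
  have h3 := ((hT _).hasDerivAt.comp x h1).mul ((hT _).hasDerivAt.comp x h2)
  have h4 : deriv (plateau x₀ ρ e) x = _ := h3.deriv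
  rw [h4]
  simp only [Function.comp]
  have b : ∀ y z s : ℝ, |s| = 1 → |deriv Real.smoothTransition y * (s / e) *
      Real.smoothTransition z| ≤ C / e := by
    intro y z s hs
    rw [abs_mul, abs_mul, abs_div, hs, abs_of_pos he, abs_of_nonneg (Real.smoothTransition.nonneg z)]
    have : |deriv Real.smoothTransition y| * (1 / e) ≤ C / e := by
      rw [mul_one_div]; gcongr; exact hC y
    exact (mul_le_of_le_one_right (by positivity) (Real.smoothTransition.le_one z)).trans this
  refine (abs_add_le _ _).trans ?_
  have b1 := b ((ρ + e - (x - x₀)) / e) ((ρ + e + (x - x₀)) / e) (-1) (by simp)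
  have b2 := b ((ρ + e + (x - x₀)) / e) ((ρ + e - (x - x₀)) / e) 1 (by simp)
  rw [mul_comm (Real.smoothTransition _) (deriv _ _ * _)]
  calc _ ≤ C / e + C / e := add_le_add b1 b2
    _ = 2 * C / e := by ring

theorem exists_cutoff : ∃ C : ℝ, 1 ≤ C ∧ ∀ a τ ρ' ρ : ℝ, ρ' < ρ → ∃ ζ : ℝ × ℝ → ℝ,
    ContDiff ℝ (⊤ : ℕ∞) ζ ∧ HasCompactSupport ζ ∧ (∀ p, 0 ≤ ζ p) ∧ (∀ p, ζ p ≤ 1) ∧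
    (∀ p ∈ Icc (a - ρ') (a + ρ') ×ˢ Icc (τ - ρ') (τ + ρ'), ζ p = 1) ∧
    tsupport ζ ⊆ Ioo (a - ρ) (a + ρ) ×ˢ Ioo (τ - ρ) (τ + ρ) ∧
    ∀ p, fderiv ℝ ζ p (1, 0) ^ 2 + fderiv ℝ ζ p (0, 1) ^ 2 ≤ C / (ρ - ρ') ^ 2 := by
  obtain ⟨C, hC1, hC⟩ := exists_deriv_smoothTransition_bound
  refine ⟨32 * C ^ 2, by nlinarith, fun a τ ρ' ρ hρ => ?_⟩
  set e := (ρ - ρ') / 2 with he_def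
  have he : 0 < e := by rw [he_def]; linarith
  have hs : tsupport (fun p : ℝ × ℝ => plateau a ρ' e p.1 * plateau τ ρ' e p.2) ⊆
      Icc (a - (ρ' + e)) (a + (ρ' + e)) ×ˢ Icc (τ - (ρ' + e)) (τ + (ρ' + e)) := by
    refine closure_minimal ?_ (isClosed_Icc.prod isClosed_Icc)
    intro p hp
    rw [Function.mem_support] at hp
    by_contra hcon
    rw [mem_prod, not_and_or] at hcon
    rcases hcon with h | h
    · exact hp (by rw [plateau_eq_zero he h, zero_mul])
    · exact hp (by rw [plateau_eq_zero he h, mul_zero])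
  refine ⟨fun p => plateau a ρ' e p.1 * plateau τ ρ' e p.2, ?_, ?_, ?_, ?_, ?_, ?_, ?_⟩
  · exact ((contDiff_plateau _ _ _).comp contDiff_fst).mul
      ((contDiff_plateau _ _ _).comp contDiff_snd)
  · exact (isCompact_Icc.prod isCompact_Icc).of_isClosed_subset (isClosed_tsupport _) hs
  · exact fun p => mul_nonneg (plateau_nonneg _ _ _ _) (plateau_nonneg _ _ _ _)
  · exact fun p => mul_le_one₀ (plateau_le_one _ _ _ _) (plateau_nonneg _ _ _ _)
      (plateau_le_one _ _ _ _)
  · intro p hp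
    simp only [plateau_eq_one he hp.1, plateau_eq_one he hp.2, one_mul]
  · refine hs.trans (Set.prod_mono ?_ ?_) <;>
      exact Icc_subset_Ioo (by rw [he_def]; linarith) (by rw [he_def]; linarith)
  · intro p
    have d1 : HasDerivAt (plateau a ρ' e) (deriv (plateau a ρ' e) p.1) p.1 :=
      ((contDiff_plateau a ρ' e).differentiable (by simp) _).hasDerivAt
    have d2 : HasDerivAt (plateau τ ρ' e) (deriv (plateau τ ρ' e) p.2) p.2 :=
      ((contDiff_plateau τ ρ' e).differentiable (by simp) _).hasDerivAt
    have h4 := (d1.comp_hasFDerivAt p (hasFDerivAt_fst (𝕜 := ℝ))).mul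
      (HasDerivAt.comp_hasFDerivAt (f := Prod.snd) p d2 (hasFDerivAt_snd (𝕜 := ℝ)))
    have h5 : fderiv ℝ (fun p : ℝ × ℝ => plateau a ρ' e p.1 * plateau τ ρ' e p.2) p = _ := h4.fderiv
    rw [h5]
    simp only [Function.comp, add_apply, smul_apply,
      ContinuousLinearMap.coe_fst', ContinuousLinearMap.coe_snd', smul_eq_mul, mul_zero, mul_one,
      zero_add, add_zero]
    have key : ∀ x y : ℝ, |x| ≤ 2 * C / e → 0 ≤ y → y ≤ 1 → (y * x) ^ 2 ≤ (2 * C / e) ^ 2 := by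
      intro x y hx hy hy1
      rw [← sq_abs, abs_mul, abs_of_nonneg hy]
      exact pow_le_pow_left₀ (by positivity)
        ((mul_le_of_le_one_left (abs_nonneg _) hy1).trans hx) 2
    have k1 := key _ _ (abs_deriv_plateau_le (x₀ := a) (ρ := ρ') hC he p.1)
      (plateau_nonneg τ ρ' e p.2) (plateau_le_one τ ρ' e p.2)
    have k2 := key _ _ (abs_deriv_plateau_le (x₀ := τ) (ρ := ρ') hC he p.2)
      (plateau_nonneg a ρ' e p.1) (plateau_le_one a ρ' e p.1)
    have e1 : 32 * C ^ 2 / (ρ - ρ') ^ 2 = (2 * C / e) ^ 2 + (2 * C / e) ^ 2 := by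
      have : ρ - ρ' = 2 * e := by rw [he_def]; ring
      rw [this]
      field_simp
      ring
    rw [e1]
    exact add_le_add k1 k2

/-- The part of a square centred at `(a, τ)` that lies in the half-plane. -/
def axisSquare (a τ ρ : ℝ) : Set (ℝ × ℝ) :=
  Ioc (max (a - ρ) 0) (a + ρ) ×ˢ Icc (τ - ρ) (τ + ρ)

theorem measurableSet_axisSquare (a τ ρ : ℝ) : MeasurableSet (axisSquare a τ ρ) :=
  measurableSet_Ioc.prod measurableSet_Icc

theorem axisSquare_mono {a τ ρ' ρ : ℝ} (h : ρ' ≤ ρ) : axisSquare a τ ρ' ⊆ axisSquare a τ ρ := by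
  intro p hp
  refine ⟨⟨(max_le_max (by linarith) le_rfl).trans_lt hp.1.1, hp.1.2.trans (by linarith)⟩,
    ⟨(by linarith : τ - ρ ≤ τ - ρ').trans hp.2.1, hp.2.2.trans (by linarith)⟩⟩

theorem axisSquare_pos {a τ ρ : ℝ} {p : ℝ × ℝ} (hp : p ∈ axisSquare a τ ρ) : 0 < p.1 :=
  (le_max_right _ _).trans_lt hp.1.1

theorem volume_axisSquare_ne_top (a τ ρ : ℝ) : volume (axisSquare a τ ρ) ≠ ⊤ :=
  ne_top_of_le_ne_top
    (isCompact_Icc.prod isCompact_Icc :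
      IsCompact (Icc (max (a - ρ) 0) (a + ρ) ×ˢ Icc (τ - ρ) (τ + ρ))).measure_lt_top.ne
    (measure_mono (Set.prod_mono Ioc_subset_Icc_self le_rfl))

theorem volume_real_axisSquare {a τ ρ : ℝ} (hρ : 0 ≤ ρ) :
    volume.real (axisSquare a τ ρ) ≤ 4 * ρ ^ 2 := by
  unfold axisSquare
  rw [Measure.volume_eq_prod, measureReal_prod_prod, Real.volume_real_Ioc, Real.volume_real_Icc_of_le
    (by linarith)]
  have : max (a + ρ - max (a - ρ) 0) 0 ≤ 2 * ρ :=
    max_le (by linarith [le_max_left (a - ρ) 0]) (by linarith)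
  nlinarith

theorem axisSquare_subset {a τ ρ r0 t0 t1 : ℝ} (hr : a + ρ < r0) (h0 : t0 < τ - ρ)
    (h1 : τ + ρ < t1) : axisSquare a τ ρ ⊆ axisDomain r0 t0 t1 := fun _ hp =>
  ⟨⟨axisSquare_pos hp, hp.1.2.trans_lt hr⟩, ⟨h0.trans_le hp.2.1, hp.2.2.trans_lt h1⟩⟩

theorem rpow_bounds_axisSquare {a τ ρ b q : ℝ} (hq : 0 ≤ q) (hb : a + ρ ≤ b) {p : ℝ × ℝ}
    (hp : p ∈ axisSquare a τ ρ) : 0 < p.1 ^ q ∧ p.1 ^ q ≤ b ^ q :=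
  ⟨Real.rpow_pos_of_pos (axisSquare_pos hp) _,
    Real.rpow_le_rpow (axisSquare_pos hp).le (hp.1.2.trans hb) hq⟩

theorem integrableOn_rpow_mul_axisSquare {a τ ρ q C : ℝ} (hq : 0 ≤ q) {f : ℝ × ℝ → ℝ}
    (hf : Measurable f) (hb : ∀ p ∈ axisSquare a τ ρ, |f p| ≤ C) :
    IntegrableOn (fun p => p.1 ^ q * f p) (axisSquare a τ ρ) := by
  refine Integrable.mono' (integrableOn_const (volume_axisSquare_ne_top a τ ρ)
    (C := (a + ρ) ^ q * C)) ?_ ?_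
  · exact Measurable.aestronglyMeasurable (by fun_prop)
  · filter_upwards [ae_restrict_mem (measurableSet_axisSquare a τ ρ)] with p hp
    have h1 := rpow_bounds_axisSquare hq le_rfl hp
    rw [norm_mul, Real.norm_of_nonneg h1.1.le]
    exact mul_le_mul h1.2 (hb p hp) (abs_nonneg _) (h1.1.le.trans h1.2)

namespace IsWeightedWeakSolution

variable {t0 t1 r0 q cW CW κ K L M : ℝ} {W A D : ℝ → ℝ} {B Z gr gt : ℝ × ℝ → ℝ}

theorem caccioppoli (h : IsWeightedWeakSolution t0 t1 r0 q cW CW κ K L M W A D B Z gr gt) :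
    ∃ C : ℝ, 1 ≤ C ∧ ∀ (a τ R m c ρ' ρ : ℝ) (G : ℝ → ℝ), 0 ≤ a → 0 < R → R ≤ 1 → a + R < r0 →
      t0 < τ - R → τ + R < t1 → (∀ᵐ p, p ∈ axisSquare a τ R → m ≤ Z p) →
      0 < ρ' → ρ' < ρ → ρ ≤ R → ContDiff ℝ (⊤ : ℕ∞) G → (∀ s, 0 ≤ G s) → (∀ s, G s ≤ 1) →
      (∀ s, 0 ≤ deriv G s) →
      IntegrableOn (fun p => p.1 ^ q * ((gr p ^ 2 + gt p ^ 2) / (Z p - m + R) ^ 2 *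
        G (c - Real.log (Z p - m + R)))) (axisSquare a τ ρ') ∧
      ∫ p in axisSquare a τ ρ', p.1 ^ q * ((gr p ^ 2 + gt p ^ 2) / (Z p - m + R) ^ 2 *
        G (c - Real.log (Z p - m + R))) ≤
        C / (ρ - ρ') ^ 2 * ∫ p in axisSquare a τ ρ, p.1 ^ q * G (c - Real.log (Z p - m + R)) := by
  obtain ⟨C0, hC0, hcut⟩ := exists_cutoff
  have hE := h.energyConst_nonneg
  refine ⟨2 * energyConst cW CW κ K L M * (C0 + 1) + 1, ?_, ?_⟩
  · have : 0 ≤ 2 * energyConst cW CW κ K L M * (C0 + 1) := by positivity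
    linarith
  intro a τ R m c ρ' ρ G ha hR hR1 hr h0 h1 hm hρ0 hρ hρR hG hG0 hG1 hG'
  obtain ⟨ζ, hζ, hζc, hζ0, hζ1, hζe, hζs, hζd⟩ := hcut a τ ρ' ρ hρ
  have hsΩ : ∀ p, p ∈ axisDomain r0 t0 t1 → p ∈ tsupport ζ → p ∈ axisSquare a τ ρ := by
    intro p hp hps
    have := hζs hps
    exact ⟨⟨max_lt this.1.1 hp.1.1, this.1.2.le⟩, ⟨this.2.1.le, this.2.2.le⟩⟩
  have hζΩ : tsupport ζ ⊆ Iio r0 ×ˢ Ioo t0 t1 := fun p hp => by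
    have := hζs hp
    exact ⟨this.1.2.trans (by linarith), by linarith [this.2.1], by linarith [this.2.2]⟩
  obtain ⟨hi, hle⟩ := h.energy_axis (c := c) hζ hζc hζΩ hG hG0 hG1 hG' hR hR1
    (hm.mono fun p hp h2 h3 => hp (axisSquare_mono hρR (hsΩ p h2 h3)))
  have mZ := h.measurable_Z
  have mG : Measurable G := hG.continuous.measurable
  have hQΩ : axisSquare a τ ρ' ⊆ axisDomain r0 t0 t1 :=
    axisSquare_subset (by linarith) (by linarith) (by linarith)
  have hQρ : axisSquare a τ ρ ⊆ axisDomain r0 t0 t1 :=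
    axisSquare_subset (by linarith) (by linarith) (by linarith)
  have hΩm : MeasurableSet (axisDomain r0 t0 t1) := (isOpen_axisDomain _ _ _).measurableSet
  have heq : EqOn (fun p => p.1 ^ q * ((gr p ^ 2 + gt p ^ 2) / (Z p - m + R) ^ 2 *
        G (c - Real.log (Z p - m + R)) * ζ p ^ 2))
      (fun p => p.1 ^ q * ((gr p ^ 2 + gt p ^ 2) / (Z p - m + R) ^ 2 *
        G (c - Real.log (Z p - m + R)))) (axisSquare a τ ρ') := by
    intro p hp
    have : ζ p = 1 := hζe p ⟨⟨(le_max_left _ _).trans hp.1.1.le, hp.1.2⟩, hp.2⟩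
    simp only [this, one_pow, mul_one]
  have hi' := (hi.mono_set hQΩ).congr_fun heq (measurableSet_axisSquare a τ ρ')
  refine ⟨hi', ?_⟩
  rw [← setIntegral_congr_fun (measurableSet_axisSquare a τ ρ') heq]
  refine (setIntegral_mono_set hi ?_ hQΩ.eventuallyLE).trans (hle.trans ?_)
  · filter_upwards [ae_restrict_mem hΩm] with p hp
    have h1 : 0 ≤ p.1 ^ q := Real.rpow_nonneg hp.1.1.le _
    have h2 := hG0 (c - Real.log (Z p - m + R))
    simp only [Pi.zero_apply]
    positivity
  have hiG : IntegrableOn (fun p => p.1 ^ q * G (c - Real.log (Z p - m + R)))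
      (axisSquare a τ ρ) := integrableOn_rpow_mul_axisSquare h.q_pos.le (by fun_prop) (C := 1)
    fun p _ => by rw [abs_of_nonneg (hG0 _)]; exact hG1 _
  have hI0 : 0 ≤ ∫ p in axisSquare a τ ρ, p.1 ^ q * G (c - Real.log (Z p - m + R)) :=
    setIntegral_nonneg (measurableSet_axisSquare a τ ρ) fun p hp =>
      mul_nonneg (rpow_bounds_axisSquare h.q_pos.le le_rfl hp).1.le (hG0 _)
  have hd : 0 < ρ - ρ' := sub_pos.2 hρ
  have hdR : ρ - ρ' ≤ R := by linarith
  have hmain : ∫ p in axisDomain r0 t0 t1, p.1 ^ q *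
      (G (c - Real.log (Z p - m + R)) *
        (fderiv ℝ ζ p (1, 0) ^ 2 + fderiv ℝ ζ p (0, 1) ^ 2 + ζ p ^ 2 / R ^ 2)) ≤
      (C0 + 1) / (ρ - ρ') ^ 2 *
        ∫ p in axisSquare a τ ρ, p.1 ^ q * G (c - Real.log (Z p - m + R)) := by
    rw [setIntegral_eq_of_subset_of_forall_sdiff_eq_zero hΩm hQρ, ← integral_const_mul]
    · apply integral_mono_of_nonneg
      · filter_upwards [ae_restrict_mem (measurableSet_axisSquare a τ ρ)] with p hp
        have h1 := (rpow_bounds_axisSquare h.q_pos.le le_rfl hp).1.le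
        have h2 := hG0 (c - Real.log (Z p - m + R))
        simp only [Pi.zero_apply]
        positivity
      · exact hiG.const_mul _
      · filter_upwards [ae_restrict_mem (measurableSet_axisSquare a τ ρ)] with p hp
        have h1 := (rpow_bounds_axisSquare h.q_pos.le le_rfl hp).1.le
        have h2 := hG0 (c - Real.log (Z p - m + R))
        have h3 : ζ p ^ 2 / R ^ 2 ≤ 1 / (ρ - ρ') ^ 2 := by
          have := hζ0 p
          gcongr
          exact pow_le_one₀ this (hζ1 p)
        have h4 : fderiv ℝ ζ p (1, 0) ^ 2 + fderiv ℝ ζ p (0, 1) ^ 2 + ζ p ^ 2 / R ^ 2 ≤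
            (C0 + 1) / (ρ - ρ') ^ 2 := by
          rw [add_div]; exact add_le_add (hζd p) h3
        calc _ ≤ p.1 ^ q * (G (c - Real.log (Z p - m + R)) * ((C0 + 1) / (ρ - ρ') ^ 2)) := by
              gcongr
          _ = _ := by ring
    · intro p hp
      have hp' : p ∉ tsupport ζ := fun h2 => hp.2 (hsΩ p hp.1 h2)
      have e1 : fderiv ℝ ζ p = 0 := by
        by_contra h2
        exact hp' (support_fderiv_subset ℝ h2)
      have e2 : ζ p = 0 := image_eq_zero_of_notMem_tsupport hp'
      simp [e1, e2]
  calc _ ≤ 2 * energyConst cW CW κ K L M * ((C0 + 1) / (ρ - ρ') ^ 2 *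
        ∫ p in axisSquare a τ ρ, p.1 ^ q * G (c - Real.log (Z p - m + R))) := by gcongr
    _ = (2 * energyConst cW CW κ K L M * (C0 + 1)) / (ρ - ρ') ^ 2 *
        ∫ p in axisSquare a τ ρ, p.1 ^ q * G (c - Real.log (Z p - m + R)) := by ring
    _ ≤ _ := by gcongr; linarith

end IsWeightedWeakSolution

theorem exists_small_of_recursion (C : ℝ) (m : ℕ) : ∃ η > 0, ∀ x : ℕ → ℝ, (∀ n, 0 ≤ x n) →
    x 0 ≤ η → (∀ n, ∀ ε : ℝ, 0 < ε → ε ≤ 1 / 4 →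
      x (n + 1) ^ 2 ≤ C * 256 ^ n * (2 * ε + ε⁻¹ ^ m * x n) * x n ^ 2) →
    Tendsto x atTop (𝓝 0) := by
  wlog hC : 1 ≤ C generalizing C
  · obtain ⟨η, hη, hx⟩ := this 1 le_rfl
    refine ⟨η, hη, fun x h0 h1 h2 => hx x h0 h1 fun n ε e0 e1 => (h2 n ε e0 e1).trans ?_⟩
    have := h0 n
    push Not at hC
    gcongr
  set θ : ℝ := (256 ^ (m + 1))⁻¹ with hθ
  have hθ0 : 0 < θ := by positivity
  have hθ1 : θ < 1 := inv_lt_one_of_one_lt₀ (one_lt_pow₀ (by norm_num) (by omega))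
  set ε₀ : ℝ := θ ^ 2 / (4 * C) with hε₀
  have hε₀p : 0 < ε₀ := by positivity
  have hε₀1 : ε₀ ≤ 1 / 4 := by
    rw [hε₀, div_le_div_iff₀ (by positivity) (by norm_num)]
    nlinarith
  refine ⟨θ ^ 2 / (2 * C) * ε₀ ^ m, by positivity, fun x h0 h1 h2 => ?_⟩
  set η := θ ^ 2 / (2 * C) * ε₀ ^ m with hη
  have key : ∀ n, x n ≤ η * θ ^ n := by
    intro n
    induction n with
    | zero => simpa using h1
    | succ n ih =>
      have hp : (0 : ℝ) < 256 ^ n := by positivity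
      have h3 := h2 n (ε₀ / 256 ^ n) (by positivity)
        ((div_le_self hε₀p.le (one_le_pow₀ (by norm_num))).trans hε₀1)
      have h4 : C * 256 ^ n * (2 * (ε₀ / 256 ^ n) + (ε₀ / 256 ^ n)⁻¹ ^ m * x n) ≤ θ ^ 2 := by
        calc _ ≤ C * 256 ^ n * (2 * (ε₀ / 256 ^ n) + (ε₀ / 256 ^ n)⁻¹ ^ m * (η * θ ^ n)) := by
              gcongr
          _ = 2 * C * ε₀ + θ ^ 2 / 2 * (256 ^ (m + 1) * θ) ^ n := by
              have e1 : (ε₀ / 256 ^ n)⁻¹ ^ m = (256 ^ n) ^ m / ε₀ ^ m := by rw [inv_div, div_pow]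
              have e2 : (256 ^ (m + 1) * θ) ^ n = 256 ^ n * (256 ^ n) ^ m * θ ^ n := by
                rw [mul_pow]
                ring
              rw [e1, e2, hη]
              generalize (256 : ℝ) ^ n = y at hp ⊢
              clear_value ε₀ θ
              field_simp
          _ = θ ^ 2 := by
              rw [hθ, mul_inv_cancel₀ (by positivity), one_pow, ← hθ, hε₀]
              field_simp
              ring
      have h5 : x (n + 1) ^ 2 ≤ (η * θ ^ (n + 1)) ^ 2 := by
        calc _ ≤ θ ^ 2 * x n ^ 2 := h3.trans (mul_le_mul_of_nonneg_right h4 (sq_nonneg _))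
          _ ≤ θ ^ 2 * (η * θ ^ n) ^ 2 := by
              have := h0 n
              gcongr
          _ = _ := by ring
      exact le_of_sq_le_sq h5 (by positivity)
  refine squeeze_zero h0 key ?_
  simpa using (tendsto_pow_atTop_nhds_zero_of_lt_one hθ0.le hθ1).const_mul η

theorem volume_real_le_of_subset_axisSquare {a τ ρ R ε q : ℝ} {P : Set (ℝ × ℝ)} (ha : 0 ≤ a)
    (hq : 0 ≤ q) (hρ0 : 0 ≤ ρ) (hR : 0 < R) (hρ : ρ ≤ R / 2) (hε : 0 < ε) (hε1 : ε ≤ 1 / 4)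
    (hP : MeasurableSet P) (hPQ : P ⊆ axisSquare a τ ρ) :
    volume.real P ≤ 2 * ε * R ^ 2 + ((ε * (a + R)) ^ q)⁻¹ * ∫ p in P, p.1 ^ q := by
  set b := a + R with hb
  have hb0 : 0 < b := by linarith
  set P1 := P ∩ {p | p.1 ≤ ε * b} with hP1
  set P2 := P ∩ {p | ε * b < p.1} with hP2
  have hP2m : MeasurableSet P2 := hP.inter (measurableSet_lt measurable_const measurable_fst)
  have hsub : P ⊆ P1 ∪ P2 := fun p hp => by
    rcases le_or_gt p.1 (ε * b) with h | h
    · exact Or.inl ⟨hp, h⟩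
    · exact Or.inr ⟨hp, h⟩
  have hPf : volume P ≠ ⊤ := ne_top_of_le_ne_top (volume_axisSquare_ne_top a τ ρ)
    (measure_mono hPQ)
  have hP1f : volume P1 ≠ ⊤ := ne_top_of_le_ne_top hPf (measure_mono inter_subset_left)
  have hP2f : volume P2 ≠ ⊤ := ne_top_of_le_ne_top hPf (measure_mono inter_subset_left)
  have hiQ : IntegrableOn (fun p : ℝ × ℝ => p.1 ^ q) P := by
    have := integrableOn_rpow_mul_axisSquare (a := a) (τ := τ) (ρ := ρ) hq
      (f := fun _ => 1) measurable_const (C := 1) (fun _ _ => by simp)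
    simpa using this.mono_set hPQ
  have e1 : volume.real P1 ≤ 2 * ε * R ^ 2 := by
    have hs : P1 ⊆ Icc (max (a - ρ) 0) (max (a - ρ) 0 + 2 * ε * R) ×ˢ Icc (τ - ρ) (τ + ρ) := by
      intro p hp
      have hp1 := hPQ hp.1
      have hp2 : p.1 ≤ ε * b := hp.2
      refine ⟨⟨hp1.1.1.le, ?_⟩, hp1.2⟩
      rcases le_total a R with h | h
      · have := le_max_right (a - ρ) 0
        nlinarith
      · have h3 := (le_max_left (a - ρ) 0).trans_lt hp1.1.1
        nlinarith
    refine (measureReal_mono hs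
      (isCompact_Icc.prod isCompact_Icc).measure_lt_top.ne).trans ?_
    rw [Measure.volume_eq_prod, measureReal_prod_prod, Real.volume_real_Icc_of_le (by
      nlinarith [mul_pos hε hR]), Real.volume_real_Icc_of_le (by linarith)]
    nlinarith [mul_pos hε hR]
  have e2 : volume.real P2 ≤ ((ε * b) ^ q)⁻¹ * ∫ p in P, p.1 ^ q := by
    have hpos : 0 < (ε * b) ^ q := Real.rpow_pos_of_pos (by positivity) _
    rw [← div_eq_inv_mul, le_div_iff₀ hpos]
    calc volume.real P2 * (ε * b) ^ q = ∫ _ in P2, (ε * b) ^ q := by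
          rw [setIntegral_const, smul_eq_mul]
      _ ≤ ∫ p in P2, p.1 ^ q := by
          refine setIntegral_mono_on (integrableOn_const hP2f) (hiQ.mono_set inter_subset_left)
            hP2m fun p hp => ?_
          exact Real.rpow_le_rpow (by positivity) (le_of_lt hp.2) hq
      _ ≤ ∫ p in P, p.1 ^ q := by
          refine setIntegral_mono_set hiQ ?_ (inter_subset_left).eventuallyLE
          filter_upwards [ae_restrict_mem hP] with p hp
          exact Real.rpow_nonneg (axisSquare_pos (hPQ hp)).le _
  exact (measureReal_mono hsub (measure_union_lt_top hP1f.lt_top hP2f.lt_top).ne).trans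
    ((measureReal_union_le _ _).trans (add_le_add e1 e2))

/-- A smooth ramp in the variable `c - log (x - m + R)`, rising from `0` at level `k` to `1` at
level `k + s`. -/
noncomputable def logRamp (m R c k s x : ℝ) : ℝ :=
  Real.smoothTransition ((c - Real.log (smoothFloor R (x - m + R)) - k) / s)

theorem contDiff_logRamp {R : ℝ} (hR : 0 < R) (m c k s : ℝ) :
    ContDiff ℝ (⊤ : ℕ∞) (logRamp m R c k s) := by
  unfold logRamp
  have h1 : ContDiff ℝ (⊤ : ℕ∞) fun x : ℝ => smoothFloor R (x - m + R) :=
    (contDiff_smoothFloor R).comp ((contDiff_id.sub contDiff_const).add contDiff_const)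
  exact Real.smoothTransition.contDiff.comp (((contDiff_const.sub
    (h1.log fun s => (smoothFloor_pos hR _).ne')).sub contDiff_const).div_const s)

theorem logRamp_nonneg (m R c k s x : ℝ) : 0 ≤ logRamp m R c k s x :=
  Real.smoothTransition.nonneg _

theorem logRamp_le_one (m R c k s x : ℝ) : logRamp m R c k s x ≤ 1 :=
  Real.smoothTransition.le_one _

theorem logRamp_eq_zero {m R c k s x : ℝ} (hR : 0 < R) (hs : 0 < s) (hx : m ≤ x)
    (hk : c - Real.log (x - m + R) ≤ k) : logRamp m R c k s x = 0 := by
  unfold logRamp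
  rw [smoothFloor_of_le hR (by linarith)]
  exact Real.smoothTransition.zero_of_nonpos (div_nonpos_of_nonpos_of_nonneg (by linarith) hs.le)

theorem logRamp_eq_one {m R c k s x : ℝ} (hR : 0 < R) (hs : 0 < s) (hx : m ≤ x)
    (hk : k + s ≤ c - Real.log (x - m + R)) : logRamp m R c k s x = 1 := by
  unfold logRamp
  rw [smoothFloor_of_le hR (by linarith)]
  exact Real.smoothTransition.one_of_one_le ((one_le_div hs).2 (by linarith))

theorem sq_deriv_logRamp_le {C m R c k s x : ℝ} (hC : ∀ x, |deriv Real.smoothTransition x| ≤ C)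
    (hR : 0 < R) (hs : 0 < s) (hx : m ≤ x) :
    deriv (logRamp m R c k s) x ^ 2 ≤ (C / s) ^ 2 * (1 / (x - m + R) ^ 2 *
      Real.smoothTransition ((c - Real.log (x - m + R) - (k - s)) / s)) := by
  have hu : 0 < x - m + R := by linarith
  have hev : logRamp m R c k s =ᶠ[𝓝 x]
      fun y => Real.smoothTransition ((c - Real.log (y - m + R) - k) / s) := by
    filter_upwards [lt_mem_nhds (show m - R / 2 < x by linarith)] with y hy
    unfold logRamp
    rw [smoothFloor_of_le hR (by linarith)]
  have hl : HasDerivAt (fun y => (c - Real.log (y - m + R) - k) / s)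
      (-(1 / (x - m + R)) / s) x := by
    have h1 : HasDerivAt (fun y => y - m + R) 1 x := ((hasDerivAt_id x).sub_const m).add_const R
    exact (((h1.log hu.ne').const_sub c).sub_const k).div_const s
  by_cases hk : k ≤ c - Real.log (x - m + R)
  · have hT : Differentiable ℝ Real.smoothTransition :=
      (Real.smoothTransition.contDiff (n := 1)).differentiable one_ne_zero
    have h3 : deriv (fun y => Real.smoothTransition ((c - Real.log (y - m + R) - k) / s)) x = _ :=
      ((hT _).hasDerivAt.comp x hl).deriv
    rw [hev.deriv_eq, h3, Real.smoothTransition.one_of_one_le, mul_one]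
    · have h4 := hC ((c - Real.log (x - m + R) - k) / s)
      have h5 := pow_le_pow_left₀ (abs_nonneg _) h4 2
      rw [sq_abs] at h5
      calc _ = deriv Real.smoothTransition ((c - Real.log (x - m + R) - k) / s) ^ 2 *
            (1 / s ^ 2 * (1 / (x - m + R) ^ 2)) := by field_simp
        _ ≤ C ^ 2 * (1 / s ^ 2 * (1 / (x - m + R) ^ 2)) := by gcongr
        _ = _ := by field_simp
    · exact (one_le_div hs).2 (by linarith)
  · push Not at hk
    have hz : (fun y => Real.smoothTransition ((c - Real.log (y - m + R) - k) / s)) =ᶠ[𝓝 x]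
        fun _ => 0 := by
      have : ∀ᶠ y in 𝓝 x, (c - Real.log (y - m + R) - k) / s < 0 :=
        hl.continuousAt.eventually_lt continuousAt_const (div_neg_of_neg_of_pos (by linarith) hs)
      exact this.mono fun y hy => Real.smoothTransition.zero_of_nonpos hy.le
    rw [hev.deriv_eq, hz.deriv_eq, deriv_const]
    have := Real.smoothTransition.nonneg ((c - Real.log (x - m + R) - (k - s)) / s)
    rw [zero_pow two_ne_zero]
    positivity

/-- The weighted mass of the part of a square where `c - log (Z - m + R)` exceeds `k`. -/
noncomputable def logMass (Z : ℝ × ℝ → ℝ) (q a τ m R c k ρ : ℝ) : ℝ :=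
  ∫ p in axisSquare a τ ρ, p.1 ^ q * (Ioi k).indicator 1 (c - Real.log (Z p - m + R))

theorem indicator_Ioi_nonneg (k x : ℝ) : 0 ≤ (Ioi k).indicator (1 : ℝ → ℝ) x :=
  indicator_nonneg (fun _ _ => zero_le_one) x

theorem indicator_Ioi_le_one (k x : ℝ) : (Ioi k).indicator (1 : ℝ → ℝ) x ≤ 1 :=
  indicator_le_self' (fun _ _ => zero_le_one) x

theorem integrableOn_logMass {Z : ℝ × ℝ → ℝ} {q : ℝ} (hZ : Measurable Z) (hq : 0 ≤ q)
    (a τ m R c k ρ : ℝ) : IntegrableOn (fun p => p.1 ^ q *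
      (Ioi k).indicator (1 : ℝ → ℝ) (c - Real.log (Z p - m + R))) (axisSquare a τ ρ) := by
  have hi : Measurable ((Ioi k).indicator (1 : ℝ → ℝ)) :=
    measurable_one.indicator measurableSet_Ioi
  refine integrableOn_rpow_mul_axisSquare hq (C := 1) (by fun_prop) fun p _ => ?_
  rw [abs_of_nonneg (indicator_Ioi_nonneg _ _)]
  exact indicator_Ioi_le_one _ _

theorem integral_le_mul_logMass {Z F : ℝ × ℝ → ℝ} {q a τ m R c k ρ ρ' C : ℝ} (hZ : Measurable Z)
    (hq : 0 ≤ q) (hρ : ρ' ≤ ρ) (hC : 0 ≤ C)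
    (h0 : ∀ᵐ p, p ∈ axisSquare a τ ρ' → 0 ≤ F p)
    (hF : ∀ᵐ p, p ∈ axisSquare a τ ρ' →
      F p ≤ C * (Ioi k).indicator (1 : ℝ → ℝ) (c - Real.log (Z p - m + R))) :
    ∫ p in axisSquare a τ ρ', p.1 ^ q * F p ≤ C * logMass Z q a τ m R c k ρ := by
  have hi := (integrableOn_logMass hZ hq a τ m R c k ρ).const_mul C
  unfold logMass
  rw [← integral_const_mul]
  have hsub := axisSquare_mono (a := a) (τ := τ) hρ
  refine (integral_mono_of_nonneg ?_ (hi.mono_measure (Measure.restrict_mono hsub le_rfl)) ?_).trans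
    (setIntegral_mono_set hi ?_ hsub.eventuallyLE)
  · rw [EventuallyLE, ae_restrict_iff' (measurableSet_axisSquare _ _ _)]
    filter_upwards [h0] with p hp hpQ
    exact mul_nonneg (rpow_bounds_axisSquare hq le_rfl hpQ).1.le (hp hpQ)
  · rw [EventuallyLE, ae_restrict_iff' (measurableSet_axisSquare _ _ _)]
    filter_upwards [hF] with p hp hpQ
    rw [mul_left_comm]
    exact mul_le_mul_of_nonneg_left (hp hpQ) (rpow_bounds_axisSquare hq le_rfl hpQ).1.le
  · filter_upwards [ae_restrict_mem (measurableSet_axisSquare _ _ _)] with p hp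
    exact mul_nonneg hC (mul_nonneg (rpow_bounds_axisSquare hq le_rfl hp).1.le
      (indicator_Ioi_nonneg _ _))

theorem logMass_nonneg {q : ℝ} (hq : 0 ≤ q) (Z : ℝ × ℝ → ℝ) (a τ m R c k ρ : ℝ) :
    0 ≤ logMass Z q a τ m R c k ρ :=
  setIntegral_nonneg (measurableSet_axisSquare _ _ _) fun _ hp =>
    mul_nonneg (rpow_bounds_axisSquare hq le_rfl hp).1.le (indicator_Ioi_nonneg _ _)

theorem indicator_Ioi_anti {k k' : ℝ} (hk : k ≤ k') (x : ℝ) :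
    (Ioi k').indicator (1 : ℝ → ℝ) x ≤ (Ioi k).indicator (1 : ℝ → ℝ) x :=
  indicator_le_indicator_of_subset (Ioi_subset_Ioi hk) (fun _ => zero_le_one) x

theorem logMass_mono {Z : ℝ × ℝ → ℝ} {q a τ m R c k k' ρ ρ' : ℝ} (hZ : Measurable Z) (hq : 0 ≤ q)
    (hρ : ρ' ≤ ρ) (hk : k ≤ k') :
    logMass Z q a τ m R c k' ρ' ≤ logMass Z q a τ m R c k ρ := by
  have := integral_le_mul_logMass (a := a) (τ := τ) (m := m) (R := R) (c := c) (k := k)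
    (F := fun p => (Ioi k').indicator (1 : ℝ → ℝ) (c - Real.log (Z p - m + R))) hZ hq hρ
    zero_le_one (Eventually.of_forall fun p _ => indicator_Ioi_nonneg _ _)
    (Eventually.of_forall fun p _ => by rw [one_mul]; exact indicator_Ioi_anti hk _)
  rwa [one_mul] at this

namespace IsWeightedWeakSolution

variable {t0 t1 r0 q cW CW κ K L M : ℝ} {W A D : ℝ → ℝ} {B Z gr gt : ℝ × ℝ → ℝ}

/-- Gradient bound for the logarithmic ramp on a smaller square. -/
theorem logRamp_energy (h : IsWeightedWeakSolution t0 t1 r0 q cW CW κ K L M W A D B Z gr gt) :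
    ∃ C : ℝ, 1 ≤ C ∧ ∀ (a τ R m c k s ρ' ρ : ℝ), 0 ≤ a → 0 < R → R ≤ 1 → a + R < r0 →
      t0 < τ - R → τ + R < t1 → (∀ᵐ p, p ∈ axisSquare a τ R → m ≤ Z p) →
      0 < ρ' → ρ' < ρ → ρ ≤ R → 0 < s →
      IntegrableOn (fun p => p.1 ^ q * (deriv (logRamp m R c (k + s) s) (Z p) ^ 2 *
        (gr p ^ 2 + gt p ^ 2))) (axisSquare a τ ρ') ∧
      ∫ p in axisSquare a τ ρ', p.1 ^ q * (deriv (logRamp m R c (k + s) s) (Z p) ^ 2 *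
        (gr p ^ 2 + gt p ^ 2)) ≤
        C / (s ^ 2 * (ρ - ρ') ^ 2) * logMass Z q a τ m R c k ρ := by
  obtain ⟨C1, hC1, hcac⟩ := h.caccioppoli
  obtain ⟨CT, hCT1, hCT⟩ := exists_deriv_smoothTransition_bound
  refine ⟨CT ^ 2 * C1, one_le_mul_of_one_le_of_one_le (one_le_pow₀ hCT1) hC1, ?_⟩
  intro a τ R m c k s ρ' ρ ha hR hR1 hr h0 h1 hm hρ0 hρ hρR hs
  set G : ℝ → ℝ := fun x => Real.smoothTransition ((x - k) / s) with hG
  have hGc : ContDiff ℝ (⊤ : ℕ∞) G :=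
    Real.smoothTransition.contDiff.comp ((contDiff_id.sub contDiff_const).div_const s)
  have hGm : Monotone G := fun x y hxy => Real.smoothTransition.monotone (by gcongr)
  obtain ⟨hi, hle⟩ := hcac a τ R m c ρ' ρ G ha hR hR1 hr h0 h1 hm hρ0 hρ hρR hGc
    (fun _ => Real.smoothTransition.nonneg _) (fun _ => Real.smoothTransition.le_one _)
    (fun _ => hGm.deriv_nonneg)
  have hm' : ∀ᵐ p, p ∈ axisSquare a τ ρ' → m ≤ Z p := hm.mono fun p hp hpQ =>
    hp (axisSquare_mono (hρ.le.trans hρR) hpQ)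
  have hpt : ∀ᵐ p ∂volume.restrict (axisSquare a τ ρ'),
      0 ≤ p.1 ^ q * (deriv (logRamp m R c (k + s) s) (Z p) ^ 2 * (gr p ^ 2 + gt p ^ 2)) ∧
      p.1 ^ q * (deriv (logRamp m R c (k + s) s) (Z p) ^ 2 * (gr p ^ 2 + gt p ^ 2)) ≤
      (CT / s) ^ 2 * (p.1 ^ q * ((gr p ^ 2 + gt p ^ 2) / (Z p - m + R) ^ 2 *
        G (c - Real.log (Z p - m + R)))) := by
    rw [ae_restrict_iff' (measurableSet_axisSquare _ _ _)]
    filter_upwards [hm'] with p hp hpQ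
    have e1 := (rpow_bounds_axisSquare h.q_pos.le le_rfl hpQ).1.le
    have e2 := sq_deriv_logRamp_le (c := c) (k := k + s) hCT hR hs (hp hpQ)
    rw [add_sub_cancel_right] at e2
    refine ⟨by positivity, ?_⟩
    calc _ ≤ p.1 ^ q * (((CT / s) ^ 2 * (1 / (Z p - m + R) ^ 2 *
          Real.smoothTransition ((c - Real.log (Z p - m + R) - k) / s))) *
            (gr p ^ 2 + gt p ^ 2)) := by gcongr
      _ = _ := by simp only [hG]; ring
  have mZ := h.measurable_Z
  have mr := h.measurable_gr
  have mt := h.measurable_gt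
  have mD : Measurable (deriv (logRamp m R c (k + s) s)) := measurable_deriv _
  refine ⟨Integrable.mono' (hi.const_mul ((CT / s) ^ 2))
    (Measurable.aestronglyMeasurable (by fun_prop)) (hpt.mono fun p hp => ?_), ?_⟩
  · rw [Real.norm_of_nonneg hp.1]; exact hp.2
  · refine (integral_mono_of_nonneg (hpt.mono fun p hp => hp.1) (hi.const_mul ((CT / s) ^ 2))
      (hpt.mono fun p hp => hp.2)).trans ?_
    rw [integral_const_mul]
    have hmass : ∫ p in axisSquare a τ ρ, p.1 ^ q * G (c - Real.log (Z p - m + R)) ≤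
        1 * logMass Z q a τ m R c k ρ := by
      refine integral_le_mul_logMass mZ h.q_pos.le le_rfl zero_le_one
        (Eventually.of_forall fun p _ => Real.smoothTransition.nonneg _)
        (Eventually.of_forall fun p _ => ?_)
      rw [one_mul]
      by_cases hk : k < c - Real.log (Z p - m + R)
      · rw [indicator_of_mem (mem_Ioi.2 hk)]; exact Real.smoothTransition.le_one _
      · refine le_trans (le_of_eq ?_) (indicator_Ioi_nonneg _ _)
        exact Real.smoothTransition.zero_of_nonpos
          (div_nonpos_of_nonpos_of_nonneg (by linarith) hs.le)
    rw [one_mul] at hmass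
    have hd : 0 < ρ - ρ' := sub_pos.2 hρ
    calc _ ≤ (CT / s) ^ 2 * (C1 / (ρ - ρ') ^ 2 * logMass Z q a τ m R c k ρ) := by
          gcongr
          exact hle.trans (mul_le_mul_of_nonneg_left hmass (by positivity))
      _ = _ := by field_simp

/-- One step of the level iteration: the mass above a higher level on a smaller square is
controlled quadratically. -/
theorem sq_logMass_le (h : IsWeightedWeakSolution t0 t1 r0 q cW CW κ K L M W A D B Z gr gt) :
    ∃ C : ℝ, 1 ≤ C ∧ ∀ (a τ R m c k s σ ρ d ε : ℝ), 0 ≤ a → 0 < R → R ≤ 1 → a + R < r0 →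
      t0 < τ - R → τ + R < t1 → (∀ᵐ p, p ∈ axisSquare a τ R → m ≤ Z p) →
      0 < ρ → 0 < d → ρ + 2 * d ≤ R / 2 → 0 < σ → σ ≤ 1 → σ ≤ s → 0 < ε → ε ≤ 1 / 4 →
      logMass Z q a τ m R c (k + 2 * s) ρ ^ 2 ≤
        (2 * ε * R ^ 2 + ((ε * (a + R)) ^ q)⁻¹ * logMass Z q a τ m R c k (ρ + 2 * d)) *
          (C * R / (d ^ 2 * σ ^ 2) * logMass Z q a τ m R c k (ρ + 2 * d)) ^ 2 := by
  obtain ⟨C1, hC1, hen⟩ := h.logRamp_energy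
  obtain ⟨C0, hC0, hcut⟩ := exists_cutoff
  refine ⟨1 + 2 * C0 + 2 * C1, by linarith, ?_⟩
  intro a τ R m c k s σ ρ d ε ha hR hR1 hr h0 h1 hm hρ0 hd hρd hσ hσ1 hσs hε hε1
  have hs : 0 < s := hσ.trans_le hσs
  have hq := h.q_pos.le
  obtain ⟨ζ, hζ, hζc, hζ0, hζ1, hζe, hζs, hζd⟩ := hcut a τ ρ (ρ + d) (by linarith)
  obtain ⟨hi, hle⟩ := hen a τ R m c k s (ρ + d) (ρ + 2 * d) ha hR hR1 hr h0 h1 hm (by linarith)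
    (by linarith) (by linarith) hs
  have ed : ρ + 2 * d - (ρ + d) = d := by ring
  have ed' : ρ + d - ρ = d := by ring
  rw [ed] at hle
  simp only [ed'] at hζd
  set φ := logMass Z q a τ m R c k (ρ + 2 * d) with hφ
  have hφ0 : 0 ≤ φ := logMass_nonneg hq _ _ _ _ _ _ _ _
  set H := logRamp m R c (k + s) s with hH
  have hHc : ContDiff ℝ (⊤ : ℕ∞) H := contDiff_logRamp hR _ _ _ _
  set Q := axisSquare a τ (ρ + d) with hQ
  have hQm : MeasurableSet Q := measurableSet_axisSquare _ _ _
  have mZ := h.measurable_Z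
  have mr := h.measurable_gr
  have mt := h.measurable_gt
  have mH : Measurable H := hHc.continuous.measurable
  have mH' : Measurable (deriv H) := measurable_deriv _
  have mζ : Measurable ζ := hζ.continuous.measurable
  have hm' : ∀ᵐ p, p ∈ Q → m ≤ Z p := hm.mono fun p hp hpQ =>
    hp (axisSquare_mono (by linarith) hpQ)
  have hζsq : ∀ p, ζ p ^ 2 ≤ 1 := fun p => pow_le_one₀ (hζ0 p) (hζ1 p)
  have hHsq : ∀ x, H x ^ 2 ≤ 1 := fun x =>
    pow_le_one₀ (logRamp_nonneg _ _ _ _ _ _) (logRamp_le_one _ _ _ _ _ _)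
  have hHind : ∀ p, m ≤ Z p → H (Z p) ^ 2 ≤
      (Ioi k).indicator (1 : ℝ → ℝ) (c - Real.log (Z p - m + R)) := by
    intro p hp
    by_cases hk : k < c - Real.log (Z p - m + R)
    · rw [indicator_of_mem (mem_Ioi.2 hk)]; exact hHsq _
    · rw [hH, logRamp_eq_zero hR hs hp (by linarith), zero_pow two_ne_zero]
      exact indicator_Ioi_nonneg _ _
  have hpos : ∀ p ∈ Q, 0 ≤ p.1 ^ q := fun p hp => (rpow_bounds_axisSquare hq le_rfl hp).1.le
  have hX : ∫ p in Q, p.1 ^ q * (ζ p * H (Z p)) ^ 2 ≤ 1 * φ := by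
    refine integral_le_mul_logMass mZ hq (by linarith) zero_le_one
      (Eventually.of_forall fun p _ => sq_nonneg _) (hm'.mono fun p hp hpQ => ?_)
    rw [one_mul, mul_pow]
    exact (mul_le_of_le_one_left (sq_nonneg _) (hζsq p)).trans (hHind p (hp hpQ))
  have hY : ∫ p in Q, p.1 ^ q *
      ((fderiv ℝ ζ p (1, 0) ^ 2 + fderiv ℝ ζ p (0, 1) ^ 2) * H (Z p) ^ 2) ≤ C0 / d ^ 2 * φ := by
    refine integral_le_mul_logMass mZ hq (by linarith) (by positivity)
      (Eventually.of_forall fun p _ => by positivity) (hm'.mono fun p hp hpQ => ?_)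
    exact mul_le_mul (hζd p) (hHind p (hp hpQ)) (sq_nonneg _) (by positivity)
  have hVpt : ∀ p ∈ Q, 0 ≤ p.1 ^ q * (ζ p ^ 2 * (deriv H (Z p) ^ 2 * (gr p ^ 2 + gt p ^ 2))) ∧
      p.1 ^ q * (ζ p ^ 2 * (deriv H (Z p) ^ 2 * (gr p ^ 2 + gt p ^ 2))) ≤
      p.1 ^ q * (deriv H (Z p) ^ 2 * (gr p ^ 2 + gt p ^ 2)) := fun p hp => by
    have := hpos p hp
    refine ⟨by positivity, ?_⟩
    exact mul_le_mul_of_nonneg_left (mul_le_of_le_one_left (by positivity) (hζsq p)) this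
  have hVi : IntegrableOn (fun p => p.1 ^ q * (ζ p ^ 2 * (deriv H (Z p) ^ 2 *
      (gr p ^ 2 + gt p ^ 2)))) Q := by
    refine Integrable.mono' hi (Measurable.aestronglyMeasurable (by fun_prop)) ?_
    filter_upwards [ae_restrict_mem hQm] with p hp
    rw [Real.norm_of_nonneg (hVpt p hp).1]
    exact (hVpt p hp).2
  have hV : ∫ p in Q, p.1 ^ q * (ζ p ^ 2 * (deriv H (Z p) ^ 2 * (gr p ^ 2 + gt p ^ 2))) ≤
      C1 / (s ^ 2 * d ^ 2) * φ :=
    (setIntegral_mono_on hVi hi hQm fun p hp => (hVpt p hp).2).trans hle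
  have hlady := h.ladyzhenskaya (a := max (a - (ρ + d)) 0) (b := a + (ρ + d)) (c := τ - (ρ + d))
    (d := τ + (ρ + d)) (l := R) (le_max_right _ _) (max_lt (by linarith) (by linarith))
    (by linarith) (by linarith) (by linarith) (by linarith) hR
    (by linarith [le_max_left (a - (ρ + d)) 0]) hHc hζ
    (fun t => image_eq_zero_of_notMem_tsupport fun hp => lt_irrefl _ (hζs hp).1.2)
    (fun r => image_eq_zero_of_notMem_tsupport fun hp => lt_irrefl _ (hζs hp).2.1) hVi
  change ∫ p in Q, _ ≤ (R⁻¹ * (∫ p in Q, _) + 2 * R * ((∫ p in Q, _) + ∫ p in Q, _)) ^ 2 at hlady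
  have hX0 : 0 ≤ ∫ p in Q, p.1 ^ q * (ζ p * H (Z p)) ^ 2 :=
    setIntegral_nonneg hQm fun p hp => mul_nonneg (hpos p hp) (sq_nonneg _)
  have hY0 : 0 ≤ ∫ p in Q, p.1 ^ q *
      ((fderiv ℝ ζ p (1, 0) ^ 2 + fderiv ℝ ζ p (0, 1) ^ 2) * H (Z p) ^ 2) :=
    setIntegral_nonneg hQm fun p hp => mul_nonneg (hpos p hp) (by positivity)
  have hV0 : 0 ≤ ∫ p in Q, p.1 ^ q *
      (ζ p ^ 2 * (deriv H (Z p) ^ 2 * (gr p ^ 2 + gt p ^ 2))) :=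
    setIntegral_nonneg hQm fun p hp => (hVpt p hp).1
  have hL4 : ∫ p in Q, (p.1 ^ q * (ζ p * H (Z p)) ^ 2) ^ 2 ≤
      ((1 + 2 * C0 + 2 * C1) * R / (d ^ 2 * σ ^ 2) * φ) ^ 2 := by
    have hRi : 0 < R⁻¹ := inv_pos.2 hR
    refine hlady.trans (pow_le_pow_left₀ (by positivity) ?_ 2)
    have hds : 0 < d ^ 2 * σ ^ 2 := by positivity
    have b1 : R⁻¹ ≤ R / (d ^ 2 * σ ^ 2) := by
      rw [inv_eq_one_div, div_le_div_iff₀ hR hds]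
      have hdR : d * σ ≤ R := by nlinarith
      nlinarith [mul_pos hd hσ]
    have b2 : C0 / d ^ 2 ≤ C0 / (d ^ 2 * σ ^ 2) :=
      div_le_div_of_nonneg_left (by linarith) hds
        (mul_le_of_le_one_right (by positivity) (pow_le_one₀ hσ.le hσ1))
    have b3 : C1 / (s ^ 2 * d ^ 2) ≤ C1 / (d ^ 2 * σ ^ 2) := by
      rw [mul_comm (s ^ 2)]; gcongr
    calc _ ≤ R / (d ^ 2 * σ ^ 2) * φ + 2 * R * (C0 / (d ^ 2 * σ ^ 2) * φ +
          C1 / (d ^ 2 * σ ^ 2) * φ) := by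
          refine add_le_add (mul_le_mul b1 (by linarith) hX0 (by positivity)) ?_
          refine mul_le_mul_of_nonneg_left (add_le_add ?_ ?_) (by positivity)
          · exact hY.trans (mul_le_mul_of_nonneg_right b2 hφ0)
          · exact hV.trans (mul_le_mul_of_nonneg_right b3 hφ0)
      _ = _ := by ring
  -- the superlevel set and the Cauchy–Schwarz step
  set P := Q ∩ {p | k + s < c - Real.log (Z p - m + R)} with hP
  have hPm : MeasurableSet P := hQm.inter (measurableSet_lt (by fun_prop) (by fun_prop))
  have hPf : volume P ≠ ⊤ := ne_top_of_le_ne_top (volume_axisSquare_ne_top a τ (ρ + d))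
    (measure_mono inter_subset_left)
  have hvP := volume_real_le_of_subset_axisSquare (a := a) (τ := τ) (ρ := ρ + d) ha hq
    (by linarith) hR (by linarith) hε hε1 hPm inter_subset_left
  have hPφ : ∫ p in P, p.1 ^ q ≤ φ := by
    have e1 : ∫ p in P, p.1 ^ q = ∫ p in P, p.1 ^ q *
        (Ioi k).indicator (1 : ℝ → ℝ) (c - Real.log (Z p - m + R)) := by
      refine setIntegral_congr_fun hPm fun p hp => ?_
      have : c - Real.log (Z p - m + R) ∈ Ioi k := by
        have : k + s < c - Real.log (Z p - m + R) := hp.2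
        exact mem_Ioi.2 (by linarith)
      simp only [indicator_of_mem this, Pi.one_apply, mul_one]
    rw [e1]
    refine setIntegral_mono_set (integrableOn_logMass mZ hq _ _ _ _ _ _ _) ?_
      (inter_subset_left.trans (axisSquare_mono (by linarith))).eventuallyLE
    filter_upwards [ae_restrict_mem (measurableSet_axisSquare _ _ _)] with p hp
    exact mul_nonneg (rpow_bounds_axisSquare hq le_rfl hp).1.le (indicator_Ioi_nonneg _ _)
  have hfm : Measurable fun p => (ζ p * H (Z p)) ^ 2 := by fun_prop
  have hf1 : ∀ p, (ζ p * H (Z p)) ^ 2 ≤ 1 := fun p => by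
    rw [mul_pow]; exact mul_le_one₀ (hζsq p) (sq_nonneg _) (hHsq _)
  have hfi : IntegrableOn (fun p => p.1 ^ q * (ζ p * H (Z p)) ^ 2) Q :=
    integrableOn_rpow_mul_axisSquare hq hfm (C := 1) fun p _ => by
      rw [abs_of_nonneg (sq_nonneg _)]; exact hf1 p
  have hfi2 : IntegrableOn (fun p => (p.1 ^ q * (ζ p * H (Z p)) ^ 2) ^ 2) Q := by
    refine Integrable.mono' (integrableOn_const (volume_axisSquare_ne_top a τ (ρ + d))
      (C := ((a + (ρ + d)) ^ q) ^ 2)) (Measurable.aestronglyMeasurable (by fun_prop)) ?_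
    filter_upwards [ae_restrict_mem hQm] with p hp
    have h2 := rpow_bounds_axisSquare hq le_rfl hp
    rw [Real.norm_of_nonneg (sq_nonneg _)]
    exact pow_le_pow_left₀ (mul_nonneg h2.1.le (sq_nonneg _))
      ((mul_le_of_le_one_right h2.1.le (hf1 p)).trans h2.2) 2
  have hcs : (∫ p in P, p.1 ^ q * (ζ p * H (Z p)) ^ 2) ^ 2 ≤
      volume.real P * ∫ p in P, (p.1 ^ q * (ζ p * H (Z p)) ^ 2) ^ 2 := by
    have : IsFiniteMeasure (volume.restrict P) := ⟨by
      rw [Measure.restrict_apply_univ]; exact hPf.lt_top⟩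
    have := sq_integral_le_measure_mul (hfi.mono_set (inter_subset_left (t :=
      {p | k + s < c - Real.log (Z p - m + R)}))) (hfi2.mono_set inter_subset_left)
    rwa [measureReal_restrict_apply_univ] at this
  have hmass : logMass Z q a τ m R c (k + 2 * s) ρ ≤
      ∫ p in P, p.1 ^ q * (ζ p * H (Z p)) ^ 2 := by
    have e1 : ∫ p in P, p.1 ^ q * (ζ p * H (Z p)) ^ 2 = ∫ p in Q, p.1 ^ q * (ζ p * H (Z p)) ^ 2 := by
      symm
      refine setIntegral_eq_of_subset_of_ae_sdiff_eq_zero hQm.nullMeasurableSet inter_subset_left ?_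
      filter_upwards [hm'] with p hp hpQ
      have hk : c - Real.log (Z p - m + R) ≤ k + s := by
        by_contra hk
        exact hpQ.2 ⟨hpQ.1, not_le.1 hk⟩
      rw [hH, logRamp_eq_zero hR hs (hp hpQ.1) hk]
      ring
    rw [e1]
    have hsub : axisSquare a τ ρ ⊆ Q := axisSquare_mono (by linarith)
    refine le_trans (integral_mono_of_nonneg ?_ (hfi.mono_set hsub) ?_)
      (setIntegral_mono_set hfi ?_ hsub.eventuallyLE)
    · filter_upwards [ae_restrict_mem (measurableSet_axisSquare _ _ _)] with p hp
      exact mul_nonneg (rpow_bounds_axisSquare hq le_rfl hp).1.le (indicator_Ioi_nonneg _ _)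
    · rw [EventuallyLE, ae_restrict_iff' (measurableSet_axisSquare _ _ _)]
      filter_upwards [hm'] with p hp hpρ
      refine mul_le_mul_of_nonneg_left ?_ (hpos p (hsub hpρ))
      by_cases hk : k + 2 * s < c - Real.log (Z p - m + R)
      · have e2 : ζ p = 1 := hζe p ⟨⟨(le_max_left _ _).trans hpρ.1.1.le, hpρ.1.2⟩, hpρ.2⟩
        rw [e2, hH, logRamp_eq_one hR hs (hp (hsub hpρ)) (by linarith)]
        simpa using indicator_Ioi_le_one _ _
      · rw [indicator_of_notMem (by simpa using hk)]
        exact sq_nonneg _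
    · filter_upwards [ae_restrict_mem hQm] with p hp
      exact mul_nonneg (hpos p hp) (sq_nonneg _)
  have hL0 : 0 ≤ ∫ p in P, (p.1 ^ q * (ζ p * H (Z p)) ^ 2) ^ 2 :=
    setIntegral_nonneg hPm fun p _ => sq_nonneg _
  have hbpos : 0 < (ε * (a + R)) ^ q := Real.rpow_pos_of_pos (by positivity) _
  calc _ ≤ (∫ p in P, p.1 ^ q * (ζ p * H (Z p)) ^ 2) ^ 2 :=
        pow_le_pow_left₀ (logMass_nonneg hq _ _ _ _ _ _ _ _) hmass 2
    _ ≤ volume.real P * ∫ p in P, (p.1 ^ q * (ζ p * H (Z p)) ^ 2) ^ 2 := hcs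
    _ ≤ _ := by
      refine mul_le_mul (hvP.trans ?_) ((setIntegral_mono_set hfi2 ?_
        inter_subset_left.eventuallyLE).trans hL4) hL0 (by positivity)
      · gcongr
      · exact Eventually.of_forall fun p => sq_nonneg _

end IsWeightedWeakSolution

theorem le_integral_rpow_axisSquare {a τ R q : ℝ} (ha : 0 ≤ a) (hR : 0 < R) (hq : 0 ≤ q) :
    (1 / 4) ^ q * (a + R) ^ q * (R ^ 2 / 4) ≤ ∫ p in axisSquare a τ (R / 2), p.1 ^ q := by
  set E : Set (ℝ × ℝ) := Ioc (a + R / 4) (a + R / 2) ×ˢ Icc (τ - R / 2) (τ + R / 2) with hE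
  have hEm : MeasurableSet E := measurableSet_Ioc.prod measurableSet_Icc
  have hsub : E ⊆ axisSquare a τ (R / 2) :=
    Set.prod_mono (Ioc_subset_Ioc_left (max_le (by linarith) (by linarith))) le_rfl
  have hi : IntegrableOn (fun p : ℝ × ℝ => p.1 ^ q) (axisSquare a τ (R / 2)) := by
    simpa using integrableOn_rpow_mul_axisSquare (a := a) (τ := τ) (ρ := R / 2) hq
      (f := fun _ => 1) measurable_const (C := 1) fun p _ => by simp
  have hv : volume.real E = R ^ 2 / 4 := by
    rw [hE, Measure.volume_eq_prod, measureReal_prod_prod, Real.volume_real_Ioc_of_le (by linarith),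
      Real.volume_real_Icc_of_le (by linarith)]
    ring
  have hEf : volume E ≠ ⊤ := ne_top_of_le_ne_top (volume_axisSquare_ne_top a τ (R / 2))
    (measure_mono hsub)
  calc (1 / 4) ^ q * (a + R) ^ q * (R ^ 2 / 4) = ∫ p in E, (1 / 4) ^ q * (a + R) ^ q := by
        rw [setIntegral_const, hv, smul_eq_mul, mul_comm]
    _ ≤ ∫ p in E, p.1 ^ q := by
        refine setIntegral_mono_on (integrableOn_const hEf) (hi.mono_set hsub) hEm fun p hp => ?_
        rw [← Real.mul_rpow (by norm_num) (by linarith)]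
        exact Real.rpow_le_rpow (by positivity) (by linarith [hp.1.1]) hq
    _ ≤ _ := by
        refine setIntegral_mono_set hi ?_ hsub.eventuallyLE
        filter_upwards [ae_restrict_mem (measurableSet_axisSquare _ _ _)] with p hp
        exact (rpow_bounds_axisSquare hq le_rfl hp).1.le

theorem logMass_le {q : ℝ} (hq : 0 ≤ q) {Z : ℝ × ℝ → ℝ} {a τ m R c k ρ : ℝ} (ha : 0 ≤ a)
    (hρ : 0 ≤ ρ) : logMass Z q a τ m R c k ρ ≤ (a + ρ) ^ q * (4 * ρ ^ 2) := by
  unfold logMass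
  calc _ ≤ ∫ p in axisSquare a τ ρ, (a + ρ) ^ q := by
        refine integral_mono_of_nonneg ?_ (integrableOn_const (volume_axisSquare_ne_top a τ ρ)) ?_
        · filter_upwards [ae_restrict_mem (measurableSet_axisSquare _ _ _)] with p hp
          exact mul_nonneg (rpow_bounds_axisSquare hq le_rfl hp).1.le (indicator_Ioi_nonneg _ _)
        · filter_upwards [ae_restrict_mem (measurableSet_axisSquare _ _ _)] with p hp
          have := rpow_bounds_axisSquare hq le_rfl hp
          exact (mul_le_of_le_one_right this.1.le (indicator_Ioi_le_one _ _)).trans this.2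
    _ ≤ _ := by
        rw [setIntegral_const, smul_eq_mul, mul_comm]
        exact mul_le_mul_of_nonneg_left (volume_real_axisSquare hρ)
          (Real.rpow_nonneg (by linarith) _)

namespace IsWeightedWeakSolution

variable {t0 t1 r0 q cW CW κ K L M : ℝ} {W A D : ℝ → ℝ} {B Z gr gt : ℝ × ℝ → ℝ}

/-- If `Z` is at least `m + k` on half of a square, then the logarithm of `Z - m + R` is very
negative only on a small set. -/
theorem logMass_decay (h : IsWeightedWeakSolution t0 t1 r0 q cW CW κ K L M W A D B Z gr gt) :
    ∃ C : ℝ, 1 ≤ C ∧ ∀ (a τ R m k s : ℝ), 0 ≤ a → 0 < R → R ≤ 1 → a + R < r0 →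
      t0 < τ - R → τ + R < t1 → 0 ≤ k → 0 < s → (∀ᵐ p, p ∈ axisSquare a τ R → m ≤ Z p) →
      (∫ p in axisSquare a τ (R / 2), p.1 ^ q) / 2 ≤
        ∫ p in axisSquare a τ (R / 2), {p | m + k ≤ Z p}.indicator (fun p => p.1 ^ q) p →
      logMass Z q a τ m R (Real.log (k + R)) s (R / 2) ≤ C / s ^ 2 * ((a + R) ^ q * R ^ 2) := by
  obtain ⟨C, hC, hen⟩ := h.logRamp_energy
  have hq := h.q_pos.le
  have h4 : (0 : ℝ) < (1 / 4) ^ q := Real.rpow_pos_of_pos (by norm_num) _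
  have h41 : (1 / 4 : ℝ) ^ q ≤ 1 := Real.rpow_le_one (by norm_num) (by norm_num) hq
  refine ⟨256 * C / (1 / 4) ^ q, by rw [le_div_iff₀ h4]; linarith, ?_⟩
  intro a τ R m k s ha hR hR1 hr h0 h1 hk hs hm hhalf
  set c := Real.log (k + R) with hc
  set bq := (a + R) ^ q with hbq
  have hbq0 : 0 < bq := Real.rpow_pos_of_pos (by positivity) _
  obtain ⟨hi, hle⟩ := hen a τ R m c (-s) s (R / 2) R ha hR hR1 hr h0 h1 hm (by linarith)
    (by linarith) le_rfl hs
  rw [neg_add_cancel] at hi hle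
  set H := logRamp m R c 0 s with hH
  have mZ := h.measurable_Z
  have hS : ∀ᵐ p : ℝ × ℝ, p ∈ {p | m + k ≤ Z p} → H (Z p) = 0 := Eventually.of_forall fun p hp => by
    have hp' : m + k ≤ Z p := hp
    refine logRamp_eq_zero hR hs (by linarith) ?_
    rw [sub_nonpos, hc]
    exact Real.log_le_log (by linarith) (by linarith)
  have hp := h.poincare (a := max (a - R / 2) 0) (b := a + R / 2) (c := τ - R / 2) (d := τ + R / 2)
    (l := R) (le_max_right _ _) (max_lt (by linarith) (by linarith)) (by linarith) (by linarith)
    (by linarith) (by linarith) (by linarith [le_max_left (a - R / 2) 0]) (by linarith)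
    (contDiff_logRamp hR m c 0 s) (measurableSet_le measurable_const mZ) hS hi
  change (∫ p in axisSquare a τ (R / 2), _) * (∫ p in axisSquare a τ (R / 2), _) ≤
    _ * ∫ p in axisSquare a τ (R / 2), _ at hp
  have hmassle : logMass Z q a τ m R c s (R / 2) ≤
      ∫ p in axisSquare a τ (R / 2), p.1 ^ q * H (Z p) ^ 2 := by
    have mH : Measurable H := (contDiff_logRamp hR m c 0 s).continuous.measurable
    refine integral_mono_of_nonneg ?_ (integrableOn_rpow_mul_axisSquare hq (C := 1)
      (by fun_prop) fun p _ => ?_) ?_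
    · filter_upwards [ae_restrict_mem (measurableSet_axisSquare _ _ _)] with p hp
      exact mul_nonneg (rpow_bounds_axisSquare hq le_rfl hp).1.le (indicator_Ioi_nonneg _ _)
    · rw [abs_of_nonneg (sq_nonneg _)]
      exact pow_le_one₀ (logRamp_nonneg _ _ _ _ _ _) (logRamp_le_one _ _ _ _ _ _)
    · rw [EventuallyLE, ae_restrict_iff' (measurableSet_axisSquare _ _ _)]
      filter_upwards [hm] with p hp hpρ
      refine mul_le_mul_of_nonneg_left ?_ (rpow_bounds_axisSquare hq le_rfl hpρ).1.le
      by_cases hk : s < c - Real.log (Z p - m + R)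
      · rw [hH, logRamp_eq_one hR hs (hp (axisSquare_mono (by linarith) hpρ)) (by linarith)]
        simpa using indicator_Ioi_le_one _ _
      · rw [indicator_of_notMem (by simpa using hk)]
        exact sq_nonneg _
  have hI := le_integral_rpow_axisSquare (τ := τ) ha hR hq
  have hφ : logMass Z q a τ m R c (-s) R ≤ bq * (4 * R ^ 2) := logMass_le hq ha hR.le
  have hE : ∫ p in axisSquare a τ (R / 2), p.1 ^ q * (deriv H (Z p) ^ 2 * (gr p ^ 2 + gt p ^ 2)) ≤
      16 * C / s ^ 2 * bq := by
    refine hle.trans ((mul_le_mul_of_nonneg_left hφ (by positivity)).trans (le_of_eq ?_))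
    field_simp
    ring
  have hE0 : 0 ≤ ∫ p in axisSquare a τ (R / 2),
      p.1 ^ q * (deriv H (Z p) ^ 2 * (gr p ^ 2 + gt p ^ 2)) :=
    setIntegral_nonneg (measurableSet_axisSquare _ _ _) fun p hp =>
      mul_nonneg (rpow_bounds_axisSquare hq le_rfl hp).1.le (by positivity)
  set X := logMass Z q a τ m R c s (R / 2) with hX
  have hX0 : 0 ≤ X := logMass_nonneg hq _ _ _ _ _ _ _ _
  have hb2 : (a + R / 2) ^ q ≤ bq := Real.rpow_le_rpow (by positivity) (by linarith) hq
  have hb20 : 0 ≤ (a + R / 2) ^ q := Real.rpow_nonneg (by positivity) _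
  have hvol : (a + R / 2 - max (a - R / 2) 0) * (τ + R / 2 - (τ - R / 2)) ≤ R * R :=
    mul_le_mul (by linarith [le_max_left (a - R / 2) 0]) (by linarith) (by linarith) hR.le
  have hvol0 : 0 ≤ (a + R / 2 - max (a - R / 2) 0) * (τ + R / 2 - (τ - R / 2)) :=
    mul_nonneg (sub_nonneg.2 (max_le (by linarith) (by linarith))) (by linarith)
  have key : ((1 / 4) ^ q * bq * (R ^ 2 / 4) / 2) * X ≤
      2 * bq * R ^ 2 * (R * R) * (16 * C / s ^ 2 * bq) := by
    calc _ ≤ (∫ p in axisSquare a τ (R / 2), {p | m + k ≤ Z p}.indicator (fun p => p.1 ^ q) p) *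
          ∫ p in axisSquare a τ (R / 2), p.1 ^ q * H (Z p) ^ 2 := by
          refine mul_le_mul (by linarith) hmassle hX0 (le_trans ?_ hhalf)
          have : 0 ≤ (1 / 4) ^ q * bq * (R ^ 2 / 4) := by positivity
          linarith
      _ ≤ _ := hp
      _ ≤ _ := by gcongr
  have h5 : 0 < (1 / 4) ^ q * bq * (R ^ 2 / 4) / 2 := by positivity
  rw [← mul_le_mul_iff_right₀ h5]
  refine key.trans (le_of_eq ?_)
  field_simp
  ring

/-- De Giorgi iteration: a small logarithmic mass forces a pointwise lower bound. -/
theorem exists_logMass_eq_zero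
    (h : IsWeightedWeakSolution t0 t1 r0 q cW CW κ K L M W A D B Z gr gt) :
    ∃ η > 0, ∀ (a τ R m c k : ℝ), 0 ≤ a → 0 < R → R ≤ 1 → a + R < r0 →
      t0 < τ - R → τ + R < t1 → 1 ≤ k → (∀ᵐ p, p ∈ axisSquare a τ R → m ≤ Z p) →
      logMass Z q a τ m R c k (R / 2) ≤ η * ((a + R) ^ q * R ^ 2) →
      logMass Z q a τ m R c (2 * k) (R / 4) = 0 := by
  obtain ⟨C, hC, hstep⟩ := h.sq_logMass_le
  obtain ⟨η, hη, hrec⟩ := exists_small_of_recursion ((4096 * C) ^ 2) ⌈q⌉₊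
  have hq := h.q_pos.le
  have mZ := h.measurable_Z
  refine ⟨η, hη, ?_⟩
  intro a τ R m c k ha hR hR1 hr h0 h1 hk hm hsmall
  have hbq : 0 < (a + R) ^ q := Real.rpow_pos_of_pos (by positivity) _
  set V := (a + R) ^ q * R ^ 2 with hV
  have hV0 : 0 < V := by positivity
  set u : ℕ → ℝ := fun n => (1 / 2) ^ n with hu
  have hu0 : ∀ n, 0 < u n := fun n => by positivity
  have hu1 : ∀ n, u n ≤ 1 := fun n => pow_le_one₀ (by norm_num) (by norm_num)
  have hus : ∀ n, u (n + 1) = u n / 2 := fun n => by simp only [hu, pow_succ]; ring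
  set x : ℕ → ℝ := fun n => logMass Z q a τ m R c (k * (2 - u n)) (R / 4 * (1 + u n)) / V with hx
  have hx0 : ∀ n, 0 ≤ x n := fun n => div_nonneg (logMass_nonneg hq _ _ _ _ _ _ _ _) hV0.le
  have hxl : Tendsto x atTop (𝓝 0) := by
    refine hrec x hx0 ?_ fun n ε hε hε1 => ?_
    · rw [hx]
      simp only [hu, pow_zero]
      rw [div_le_iff₀ hV0]
      have e1 : k * (2 - 1) = k := by ring
      have e2 : R / 4 * (1 + 1) = R / 2 := by ring
      rw [e1, e2]
      exact hsmall
    · have hun := hu0 n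
      have hun1 := hu1 n
      have := hstep a τ R m c (k * (2 - u n)) (k * (u n / 4)) (u n / 4) (R / 4 * (1 + u n / 2))
        (R * u n / 16) ε ha hR hR1 hr h0 h1 hm (by positivity) (by positivity) (by nlinarith)
        (by positivity) (by linarith) (by nlinarith) hε hε1
      have e1 : k * (2 - u n) + 2 * (k * (u n / 4)) = k * (2 - u (n + 1)) := by rw [hus]; ring
      have e2 : R / 4 * (1 + u n / 2) + 2 * (R * u n / 16) = R / 4 * (1 + u n) := by ring
      have e3 : R / 4 * (1 + u n / 2) = R / 4 * (1 + u (n + 1)) := by rw [hus]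
      rw [e2, e1, e3] at this
      have x1 : logMass Z q a τ m R c (k * (2 - u n)) (R / 4 * (1 + u n)) = x n * V := by
        simp only [hx]; field_simp
      have x2 : logMass Z q a τ m R c (k * (2 - u (n + 1))) (R / 4 * (1 + u (n + 1))) =
          x (n + 1) * V := by
        simp only [hx]; field_simp
      rw [x1, x2] at this
      have hεq : (ε ^ q)⁻¹ ≤ ε⁻¹ ^ ⌈q⌉₊ := by
        rw [← Real.inv_rpow hε.le, ← Real.rpow_natCast]
        exact Real.rpow_le_rpow_of_exponent_le ((one_le_inv₀ hε).2 (by linarith)) (Nat.le_ceil q)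
      have h256 : (256 : ℝ) ^ n * u n ^ 8 = 1 := by
        simp only [hu]
        rw [← pow_mul, mul_comm n 8, pow_mul, ← mul_pow]
        norm_num
      have hεp : 0 < ε ^ q := Real.rpow_pos_of_pos hε _
      have hfac : (2 * ε * R ^ 2 + ((ε * (a + R)) ^ q)⁻¹ * (x n * V)) ≤
          R ^ 2 * (2 * ε + ε⁻¹ ^ ⌈q⌉₊ * x n) := by
        rw [Real.mul_rpow hε.le (by positivity), hV]
        have e4 : (ε ^ q * (a + R) ^ q)⁻¹ * (x n * ((a + R) ^ q * R ^ 2)) =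
            R ^ 2 * ((ε ^ q)⁻¹ * x n) := by field_simp
        rw [e4, mul_add]
        have := mul_le_mul_of_nonneg_right hεq (hx0 n)
        have h6 : 2 * ε * R ^ 2 = R ^ 2 * (2 * ε) := by ring
        rw [h6]
        gcongr
      have hsq : (C * R / ((R * u n / 16) ^ 2 * (u n / 4) ^ 2) * (x n * V)) ^ 2 * R ^ 2 =
          (4096 * C) ^ 2 * 256 ^ n * x n ^ 2 * V ^ 2 := by
        have : C * R / ((R * u n / 16) ^ 2 * (u n / 4) ^ 2) = 4096 * C / (R * u n ^ 4) := by
          field_simp; norm_num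
        rw [this]
        have h7 : (256 : ℝ) ^ n = 1 / u n ^ 8 := by rw [eq_div_iff (by positivity)]; exact h256
        rw [h7]
        field_simp
      have hfin : (x (n + 1) * V) ^ 2 ≤
          ((4096 * C) ^ 2 * 256 ^ n * (2 * ε + ε⁻¹ ^ ⌈q⌉₊ * x n) * x n ^ 2) * V ^ 2 := by
        refine this.trans ((mul_le_mul_of_nonneg_right hfac (sq_nonneg _)).trans (le_of_eq ?_))
        linear_combination (2 * ε + ε⁻¹ ^ ⌈q⌉₊ * x n) * hsq
      rw [mul_pow] at hfin
      exact le_of_mul_le_mul_right hfin (by positivity)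
  have hle : ∀ n, logMass Z q a τ m R c (2 * k) (R / 4) / V ≤ x n := fun n => by
    refine div_le_div_of_nonneg_right ?_ hV0.le
    have := hu0 n
    exact logMass_mono mZ hq (by nlinarith) (by nlinarith)
  have h8 : logMass Z q a τ m R c (2 * k) (R / 4) / V ≤ 0 :=
    ge_of_tendsto hxl (Eventually.of_forall hle)
  rw [div_le_iff₀ hV0, zero_mul] at h8
  exact le_antisymm h8 (logMass_nonneg hq _ _ _ _ _ _ _ _)

/-- Growth lemma. -/
theorem growth (h : IsWeightedWeakSolution t0 t1 r0 q cW CW κ K L M W A D B Z gr gt) :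
    ∃ δ ∈ Ioo (0 : ℝ) 1, ∀ (a τ R m k : ℝ), 0 ≤ a → 0 < R → R ≤ 1 → a + R < r0 →
      t0 < τ - R → τ + R < t1 → 0 ≤ k → (∀ᵐ p, p ∈ axisSquare a τ R → m ≤ Z p) →
      (∫ p in axisSquare a τ (R / 2), p.1 ^ q) / 2 ≤
        ∫ p in axisSquare a τ (R / 2), {p | m + k ≤ Z p}.indicator (fun p => p.1 ^ q) p →
      ∀ᵐ p, p ∈ axisSquare a τ (R / 4) → m + δ * k - R ≤ Z p := by
  obtain ⟨C, hC, hdec⟩ := h.logMass_decay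
  obtain ⟨η, hη, hzero⟩ := h.exists_logMass_eq_zero
  have hq := h.q_pos.le
  have mZ := h.measurable_Z
  obtain ⟨s, hs1, hs⟩ : ∃ s : ℝ, 1 ≤ s ∧ C / s ^ 2 ≤ η := by
    refine ⟨1 + C / η, by have := div_nonneg (by linarith : 0 ≤ C) hη.le; linarith, ?_⟩
    have h0 : 0 ≤ C / η := div_nonneg (by linarith) hη.le
    rw [div_le_iff₀ (by positivity)]
    have : C = η * (C / η) := by field_simp
    nlinarith [mul_nonneg hη.le h0, mul_nonneg hη.le (sq_nonneg (C / η))]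
  refine ⟨Real.exp (-(2 * s)), ⟨Real.exp_pos _, by rw [Real.exp_lt_one_iff]; linarith⟩, ?_⟩
  intro a τ R m k ha hR hR1 hr h0 h1 hk hm hhalf
  have hV0 : 0 ≤ (a + R) ^ q * R ^ 2 :=
    mul_nonneg (Real.rpow_nonneg (by linarith) _) (sq_nonneg _)
  have hz := hzero a τ R m (Real.log (k + R)) s ha hR hR1 hr h0 h1 hs1 hm
    ((hdec a τ R m k s ha hR hR1 hr h0 h1 hk (by linarith) hm hhalf).trans
      (mul_le_mul_of_nonneg_right hs hV0))
  unfold logMass at hz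
  rw [setIntegral_eq_zero_iff_of_nonneg_ae ?_ (integrableOn_logMass mZ hq _ _ _ _ _ _ _)] at hz
  · rw [EventuallyEq, ae_restrict_iff' (measurableSet_axisSquare _ _ _)] at hz
    filter_upwards [hz, hm] with p hp hpm hpQ
    have h3 := (rpow_bounds_axisSquare hq le_rfl hpQ).1
    have hmp := hpm (axisSquare_mono (by linarith) hpQ)
    by_contra hlt
    have hlt := not_le.1 hlt
    have hzp := hp hpQ
    have hw : 2 * s < Real.log (k + R) - Real.log (Z p - m + R) := by
      have h4 : Real.log (Z p - m + R) < Real.log (Real.exp (-(2 * s)) * (k + R)) := by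
        refine Real.log_lt_log (by linarith) ?_
        have := Real.exp_pos (-(2 * s))
        nlinarith
      rw [Real.log_mul (Real.exp_pos _).ne' (by linarith), Real.log_exp] at h4
      linarith
    rw [indicator_of_mem (mem_Ioi.2 hw), Pi.one_apply, mul_one] at hzp
    exact h3.ne' hzp
  · filter_upwards [ae_restrict_mem (measurableSet_axisSquare _ _ _)] with p hp
    exact mul_nonneg (rpow_bounds_axisSquare hq le_rfl hp).1.le (indicator_Ioi_nonneg _ _)

/-- One step of the reduction of oscillation. -/
theorem oscillation_step (h : IsWeightedWeakSolution t0 t1 r0 q cW CW κ K L M W A D B Z gr gt) :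
    ∃ θ ∈ Ioo (1 / 2 : ℝ) 1, ∀ (a τ R m l : ℝ), 0 ≤ a → 0 < R → R ≤ 1 → a + R < r0 →
      t0 < τ - R → τ + R < t1 → 0 ≤ l →
      (∀ᵐ p, p ∈ axisSquare a τ R → m ≤ Z p ∧ Z p ≤ m + l) →
      ∃ m', ∀ᵐ p, p ∈ axisSquare a τ (R / 4) → m' ≤ Z p ∧ Z p ≤ m' + (θ * l + R) := by
  obtain ⟨δ₁, ⟨hδ₁, hδ₁'⟩, hg₁⟩ := h.growth
  obtain ⟨δ₂, ⟨hδ₂, hδ₂'⟩, hg₂⟩ := h.neg.growth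
  have hδ : 0 < min δ₁ δ₂ := lt_min hδ₁ hδ₂
  have hq := h.q_pos.le
  have mZ := h.measurable_Z
  refine ⟨1 - min δ₁ δ₂ / 2, ⟨by linarith [min_le_left δ₁ δ₂], by linarith⟩, ?_⟩
  intro a τ R m l ha hR hR1 hr h0 h1 hl hm
  set I := ∫ p in axisSquare a τ (R / 2), p.1 ^ q with hI
  have hi : IntegrableOn (fun p : ℝ × ℝ => p.1 ^ q) (axisSquare a τ (R / 2)) := by
    simpa using integrableOn_rpow_mul_axisSquare (a := a) (τ := τ) (ρ := R / 2) hq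
      (f := fun _ => 1) measurable_const (C := 1) fun p _ => by simp
  have hS₁ : MeasurableSet {p : ℝ × ℝ | m + l / 2 ≤ Z p} := measurableSet_le measurable_const mZ
  have hS₂ : MeasurableSet {p : ℝ × ℝ | -(m + l) + l / 2 ≤ -Z p} :=
    measurableSet_le measurable_const mZ.neg
  have hsum : I ≤ (∫ p in axisSquare a τ (R / 2),
        {p | m + l / 2 ≤ Z p}.indicator (fun p => p.1 ^ q) p) +
      ∫ p in axisSquare a τ (R / 2),
        {p | -(m + l) + l / 2 ≤ -Z p}.indicator (fun p => p.1 ^ q) p := by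
    rw [← integral_add (hi.indicator hS₁) (hi.indicator hS₂)]
    refine setIntegral_mono_on hi ((hi.indicator hS₁).add (hi.indicator hS₂))
      (measurableSet_axisSquare _ _ _) fun p hp => ?_
    have hp0 := (rpow_bounds_axisSquare hq le_rfl hp).1.le
    by_cases hc : m + l / 2 ≤ Z p
    · rw [indicator_of_mem (show p ∈ {p : ℝ × ℝ | m + l / 2 ≤ Z p} from hc)]
      exact le_add_of_nonneg_right (indicator_apply_nonneg fun _ => hp0)
    · rw [indicator_of_mem (show p ∈ {p : ℝ × ℝ | -(m + l) + l / 2 ≤ -Z p} by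
        change -(m + l) + l / 2 ≤ -Z p
        linarith [not_le.1 hc]), indicator_of_notMem (by exact hc)]
      simp
  rcases le_total (I / 2) (∫ p in axisSquare a τ (R / 2),
      {p | m + l / 2 ≤ Z p}.indicator (fun p => p.1 ^ q) p) with hc | hc
  · have := hg₁ a τ R m (l / 2) ha hR hR1 hr h0 h1 (by linarith)
      (hm.mono fun p hp hpQ => (hp hpQ).1) hc
    refine ⟨m + min δ₁ δ₂ * (l / 2) - R, ?_⟩
    filter_upwards [this, hm] with p hp hpm hpQ
    have := mul_le_mul_of_nonneg_right (min_le_left δ₁ δ₂) (by linarith : 0 ≤ l / 2)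
    have h2 := hp hpQ
    have h3 := (hpm (axisSquare_mono (by linarith) hpQ)).2
    exact ⟨by linarith, by linarith⟩
  · have := hg₂ a τ R (-(m + l)) (l / 2) ha hR hR1 hr h0 h1 (by linarith)
      (hm.mono fun p hp hpQ => neg_le_neg (hp hpQ).2) (by
        change I / 2 ≤ ∫ p in axisSquare a τ (R / 2),
          {p | -(m + l) + l / 2 ≤ -Z p}.indicator (fun p => p.1 ^ q) p
        linarith)
    refine ⟨m, ?_⟩
    filter_upwards [this, hm] with p hp hpm hpQ
    have := mul_le_mul_of_nonneg_right (min_le_right δ₁ δ₂) (by linarith : 0 ≤ l / 2)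
    have h2 := hp hpQ
    have h3 := (hpm (axisSquare_mono (by linarith) hpQ)).1
    exact ⟨by linarith, by linarith⟩

/-- Geometric decay of the oscillation on concentric squares, up to the axis. -/
theorem oscillation_decay (h : IsWeightedWeakSolution t0 t1 r0 q cW CW κ K L M W A D B Z gr gt) :
    ∃ θ ∈ Ioo (1 / 2 : ℝ) 1, ∀ (a τ R : ℝ), 0 ≤ a → 0 < R → R ≤ 1 → a + R < r0 →
      t0 < τ - R → τ + R < t1 → ∀ n : ℕ, ∃ m, ∀ᵐ p, p ∈ axisSquare a τ (R * (1 / 4) ^ n) →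
        m ≤ Z p ∧ Z p ≤ m + (2 * M + 4) * θ ^ n := by
  obtain ⟨θ, hθ, hstep⟩ := h.oscillation_step
  have hθ1 := hθ.1
  refine ⟨θ, hθ, fun a τ R ha hR hR1 hr h0 h1 => ?_⟩
  have key : ∀ n : ℕ, ∃ m l, 0 ≤ l ∧ l ≤ (2 * M + 4 * R) * θ ^ n - 4 * (R * (1 / 4) ^ n) ∧
      ∀ᵐ p, p ∈ axisSquare a τ (R * (1 / 4) ^ n) → m ≤ Z p ∧ Z p ≤ m + l := by
    intro n
    induction n with
    | zero =>
      refine ⟨-M, 2 * M, by linarith [h.M_nonneg], by simp, Eventually.of_forall fun p hp => ?_⟩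
      rw [pow_zero, mul_one] at hp
      have := abs_le.1 (h.Z_bound p (axisSquare_subset hr h0 h1 hp))
      exact ⟨this.1, by linarith [this.2]⟩
    | succ n ih =>
      obtain ⟨m, l, hl, hl', hm⟩ := ih
      have hρ : 0 < R * (1 / 4) ^ n := by positivity
      have hρR : R * (1 / 4) ^ n ≤ R :=
        mul_le_of_le_one_right hR.le (pow_le_one₀ (by norm_num) (by norm_num))
      obtain ⟨m', hm'⟩ := hstep a τ (R * (1 / 4) ^ n) m l ha hρ (hρR.trans hR1) (by linarith)
        (by linarith) (by linarith) hl hm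
      have e : R * (1 / 4) ^ (n + 1) = R * (1 / 4) ^ n / 4 := by rw [pow_succ]; ring
      refine ⟨m', θ * l + R * (1 / 4) ^ n, by positivity, ?_, by rwa [e]⟩
      rw [e, pow_succ]
      nlinarith [mul_le_mul_of_nonneg_left hl' (by linarith : 0 ≤ θ)]
  intro n
  obtain ⟨m, l, -, hl, hm⟩ := key n
  refine ⟨m, hm.mono fun p hp hpQ => ⟨(hp hpQ).1, (hp hpQ).2.trans ?_⟩⟩
  have h1 : 0 ≤ R * (1 / 4) ^ n := by positivity
  have h2 : 0 ≤ θ ^ n := by positivity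
  nlinarith

end IsWeightedWeakSolution

/-- The essential upper limit of `Z` at a point, taken within `Ω`. -/
noncomputable def essUpperLimit (Ω : Set (ℝ × ℝ)) (Z : ℝ × ℝ → ℝ) (p : ℝ × ℝ) : ℝ :=
  sInf {c | ∃ U : Set (ℝ × ℝ), IsOpen U ∧ p ∈ U ∧ ∀ᵐ z, z ∈ U ∩ Ω → Z z ≤ c}

theorem essUpperLimit_mem_Icc {Ω U : Set (ℝ × ℝ)} {Z : ℝ × ℝ → ℝ} {p : ℝ × ℝ} {m m' : ℝ}
    (hΩ : IsOpen Ω) (hp : p ∈ closure Ω) (hU : IsOpen U) (hpU : p ∈ U)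
    (hm : ∀ᵐ z, z ∈ U ∩ Ω → m ≤ Z z ∧ Z z ≤ m') : essUpperLimit Ω Z p ∈ Icc m m' := by
  have hmem : m' ∈ {c | ∃ U : Set (ℝ × ℝ), IsOpen U ∧ p ∈ U ∧ ∀ᵐ z, z ∈ U ∩ Ω → Z z ≤ c} :=
    ⟨U, hU, hpU, hm.mono fun z hz hzU => (hz hzU).2⟩
  have hlow : ∀ c ∈ {c | ∃ U : Set (ℝ × ℝ), IsOpen U ∧ p ∈ U ∧ ∀ᵐ z, z ∈ U ∩ Ω → Z z ≤ c},
      m ≤ c := by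
    rintro c ⟨V, hV, hpV, hc⟩
    have hne : ((U ∩ V) ∩ Ω).Nonempty := mem_closure_iff.1 hp _ (hU.inter hV) ⟨hpU, hpV⟩
    have hpos : volume ((U ∩ V) ∩ Ω) ≠ 0 := (((hU.inter hV).inter hΩ).measure_pos volume hne).ne'
    have : ∃ᵐ z, z ∈ (U ∩ V) ∩ Ω := by
      rwa [frequently_ae_mem_iff]
    obtain ⟨z, hz, h1, h2⟩ := (this.and_eventually (hm.and hc)).exists
    exact (h1 ⟨hz.1.1, hz.2⟩).1.trans (h2 ⟨hz.1.2, hz.2⟩)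
  exact ⟨le_csInf ⟨m', hmem⟩ hlow, csInf_le ⟨m, hlow⟩ hmem⟩

theorem essUpperLimit_ae_eq {Ω : Set (ℝ × ℝ)} {Z : ℝ × ℝ → ℝ} (hΩ : IsOpen Ω)
    (hosc : ∀ p ∈ Ω, ∀ ε > 0, ∃ U m, IsOpen U ∧ p ∈ U ∧
      ∀ᵐ z, z ∈ U ∩ Ω → m ≤ Z z ∧ Z z ≤ m + ε) :
    ∀ᵐ p, p ∈ Ω → essUpperLimit Ω Z p = Z p := by
  have key : ∀ n : ℕ, ∀ᵐ p, p ∈ Ω → |essUpperLimit Ω Z p - Z p| ≤ 1 / ((n : ℝ) + 1) := by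
    intro n
    rw [ae_iff]
    refine measure_null_of_locally_null _ fun p hp => ?_
    rw [mem_ofPred_eq] at hp
    push Not at hp
    obtain ⟨U, m, hU, hpU, hm⟩ := hosc p hp.1 (1 / ((n : ℝ) + 1)) (by positivity)
    refine ⟨_, inter_mem_nhdsWithin _ (hU.mem_nhds hpU), ?_⟩
    refine measure_mono_null (fun z hz => ?_) (ae_iff.1 hm)
    obtain ⟨hz1, hzU⟩ := hz
    rw [mem_ofPred_eq] at hz1 ⊢
    intro hcon
    apply hz1
    intro hzΩ
    have h1 := hcon ⟨hzU, hzΩ⟩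
    have h2 := essUpperLimit_mem_Icc hΩ (subset_closure hzΩ) hU hzU hm
    rw [abs_le]
    exact ⟨by linarith [h2.1], by linarith [h2.2]⟩
  filter_upwards [ae_all_iff.2 key] with p hp hpΩ
  have h0 : |essUpperLimit Ω Z p - Z p| ≤ 0 :=
    ge_of_tendsto tendsto_one_div_add_atTop_nhds_zero_nat (Eventually.of_forall fun n => hp n hpΩ)
  exact sub_eq_zero.1 (abs_nonpos_iff.1 h0)

theorem ball_inter_axisDomain_subset {a τ ρ r0 t0 t1 : ℝ} :
    Metric.ball (a, τ) ρ ∩ axisDomain r0 t0 t1 ⊆ axisSquare a τ ρ := by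
  rintro ⟨r, t⟩ ⟨hb, hr, ht⟩
  rw [← ball_prod_same, mem_prod, Real.ball_eq_Ioo, Real.ball_eq_Ioo] at hb
  exact ⟨⟨max_lt hb.1.1 hr.1, hb.1.2.le⟩, ⟨hb.2.1.le, hb.2.2.le⟩⟩

namespace IsWeightedWeakSolution

variable {t0 t1 r0 q cW CW κ K L M : ℝ} {W A D : ℝ → ℝ} {B Z gr gt : ℝ × ℝ → ℝ}

/-- A bounded weak solution has a representative which is locally Hölder continuous up to the
axis. -/
theorem exists_holder_representative
    (h : IsWeightedWeakSolution t0 t1 r0 q cW CW κ K L M W A D B Z gr gt) :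
    ∃ α ∈ Ioo (0 : ℝ) 1, ∃ Zstar : ℝ × ℝ → ℝ,
      (∀ᵐ p, p ∈ axisDomain r0 t0 t1 → Zstar p = Z p) ∧
      ∀ Kc : Set (ℝ × ℝ), IsCompact Kc → Kc ⊆ Ico 0 r0 ×ˢ Ioo t0 t1 →
        ∃ C : ℝ, 0 ≤ C ∧ ∀ p ∈ Kc, ∀ z ∈ Kc, |Zstar p - Zstar z| ≤ C * ‖p - z‖ ^ α := by
  obtain ⟨θ, ⟨hθ, hθ1⟩, hosc⟩ := h.oscillation_decay
  have hM := h.M_nonneg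
  have hΩ := isOpen_axisDomain r0 t0 t1
  set Ω := axisDomain r0 t0 t1 with hΩd
  have hball : ∀ (a τ R : ℝ), 0 ≤ a → 0 < R → R ≤ 1 → a + R < r0 →
      t0 < τ - R → τ + R < t1 → ∀ n : ℕ, ∃ m, ∀ᵐ p,
        p ∈ Metric.ball (a, τ) (R * (1 / 4) ^ n) ∩ Ω → m ≤ Z p ∧ Z p ≤ m + (2 * M + 4) * θ ^ n := by
    intro a τ R ha hR hR1 hr h0 h1 n
    obtain ⟨m, hm⟩ := hosc a τ R ha hR hR1 hr h0 h1 n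
    exact ⟨m, hm.mono fun p hp hpQ => hp (ball_inter_axisDomain_subset hpQ)⟩
  have hcl : Ico 0 r0 ×ˢ Ioo t0 t1 ⊆ closure Ω := by
    rw [hΩd, axisDomain, closure_prod_eq, closure_Ioo h.r0_pos.ne]
    exact Set.prod_mono Ico_subset_Icc_self subset_closure
  have hradius : ∀ Kc : Set (ℝ × ℝ), IsCompact Kc → Kc ⊆ Ico 0 r0 ×ˢ Ioo t0 t1 →
      ∃ R, 0 < R ∧ R ≤ 1 ∧ ∀ p ∈ Kc, p.1 + R < r0 ∧ t0 < p.2 - R ∧ p.2 + R < t1 := by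
    intro Kc hKc hsub
    obtain ⟨δ, hδ, hδK⟩ := hKc.exists_cthickening_subset_open
      (isOpen_Iio.prod isOpen_Ioo : IsOpen (Iio r0 ×ˢ Ioo t0 t1))
      (hsub.trans (Set.prod_mono Ico_subset_Iio_self le_rfl))
    have hR : 0 < min δ 1 := lt_min hδ one_pos
    refine ⟨min δ 1, hR, min_le_right _ _, fun p hp => ?_⟩
    have h1 : ∀ s : ℝ, |s| ≤ min δ 1 → (p.1 + s, p.2 + s) ∈ Iio r0 ×ˢ Ioo t0 t1 := fun s hs => by
      refine hδK (Metric.mem_cthickening_of_dist_le _ p _ _ hp ?_)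
      rw [Prod.dist_eq, Real.dist_eq, Real.dist_eq]
      simp only [add_sub_cancel_left]
      exact max_le (hs.trans (min_le_left _ _)) (hs.trans (min_le_left _ _))
    have h2 := h1 (min δ 1) (by rw [abs_of_pos hR])
    have h3 := h1 (-min δ 1) (by rw [abs_neg, abs_of_pos hR])
    exact ⟨h2.1, h3.2.1, h2.2.2⟩
  have hθ0 : 0 < θ := by linarith
  set α := Real.logb (1 / 4) θ with hα
  have hα0 : 0 < α := Real.logb_pos_of_base_lt_one (by norm_num) (by norm_num) hθ0 hθ1
  have hαθ : (1 / 4 : ℝ) ^ α = θ := Real.rpow_logb (by norm_num) (by norm_num) hθ0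
  refine ⟨α, ⟨hα0, ?_⟩, essUpperLimit Ω Z, essUpperLimit_ae_eq hΩ fun p hp ε hε => ?_,
    fun Kc hKc hsub => ?_⟩
  · rw [hα, Real.logb_lt_iff_lt_rpow_of_base_lt_one (by norm_num) (by norm_num) hθ0, Real.rpow_one]
    linarith
  · obtain ⟨R, hR, hR1, hRp⟩ := hradius {p} isCompact_singleton
      (singleton_subset_iff.2 ⟨⟨hp.1.1.le, hp.1.2⟩, hp.2⟩)
    obtain ⟨h1, h2, h3⟩ := hRp p rfl
    have hlim : Tendsto (fun n : ℕ => (2 * M + 4) * θ ^ n) atTop (𝓝 0) := by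
      simpa using (tendsto_pow_atTop_nhds_zero_of_lt_one hθ0.le hθ1).const_mul (2 * M + 4)
    obtain ⟨n, hn⟩ := (hlim.eventually_le_const hε).exists
    obtain ⟨m, hm⟩ := hball p.1 p.2 R hp.1.1.le hR hR1 h1 h2 h3 n
    exact ⟨_, m, Metric.isOpen_ball, Metric.mem_ball_self (by positivity),
      hm.mono fun z hz hzU => ⟨(hz hzU).1, (hz hzU).2.trans (by linarith)⟩⟩
  · obtain ⟨R, hR, hR1, hRp⟩ := hradius Kc hKc hsub
    refine ⟨(4 * M + 4) * (8 / R) ^ α, by positivity, fun p hp z hz => ?_⟩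
    rw [mul_assoc, ← Real.mul_rpow (by positivity) (norm_nonneg _), ← dist_eq_norm]
    have hbd : ∀ p ∈ Kc, essUpperLimit Ω Z p ∈ Icc (-M) M := fun p hp =>
      essUpperLimit_mem_Icc hΩ (hcl (hsub hp)) isOpen_univ (mem_univ p)
        (Eventually.of_forall fun z hz => abs_le.1 (h.Z_bound z hz.2))
    rcases eq_or_ne p z with rfl | hne
    · rw [sub_self, abs_zero]
      positivity
    have hd : 0 < dist p z := dist_pos.2 hne
    rcases lt_or_ge (R / 2) (dist p z) with hfar | hnear
    · have h8 : 1 ≤ 8 / R * dist p z := by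
        rw [div_mul_eq_mul_div, one_le_div hR]
        linarith
      have h9 := Real.one_le_rpow h8 hα0.le
      have h1 := hbd p hp
      have h2 := hbd z hz
      calc _ ≤ 2 * M := abs_le.2 ⟨by linarith [h1.1, h2.2], by linarith [h1.2, h2.1]⟩
        _ ≤ (4 * M + 4) * 1 := by linarith
        _ ≤ _ := mul_le_mul_of_nonneg_left h9 (by linarith)
    · obtain ⟨n, hn1, hn2⟩ := exists_nat_pow_near_of_lt_one
        (show 0 < 2 * dist p z / R by positivity) (by rw [div_le_one hR]; linarith)
        (show (0 : ℝ) < 1 / 4 by norm_num) (by norm_num)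
      obtain ⟨h1, h2, h3⟩ := hRp p hp
      obtain ⟨m, hm⟩ := hball p.1 p.2 R (hsub hp).1.1 hR hR1 h1 h2 h3 n
      have hρ : 0 < R * (1 / 4) ^ n := by positivity
      have hzb : z ∈ Metric.ball (p.1, p.2) (R * (1 / 4) ^ n) := by
        rw [Metric.mem_ball, dist_comm, Prod.mk.eta]
        rw [div_le_iff₀ hR] at hn2
        linarith
      have hZp := essUpperLimit_mem_Icc hΩ (hcl (hsub hp)) Metric.isOpen_ball
        (Metric.mem_ball_self hρ) hm
      have hZz := essUpperLimit_mem_Icc hΩ (hcl (hsub hz)) Metric.isOpen_ball hzb hm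
      have hpow : θ ^ n ≤ (8 / R * dist p z) ^ α := by
        rw [← hαθ, ← Real.rpow_natCast, ← Real.rpow_mul (by norm_num), mul_comm α,
          Real.rpow_mul (by norm_num), Real.rpow_natCast]
        refine Real.rpow_le_rpow (by positivity) ?_ hα0.le
        rw [lt_div_iff₀ hR, pow_succ] at hn1
        rw [div_mul_eq_mul_div, le_div_iff₀ hR]
        linarith
      have hθn : 0 ≤ θ ^ n := by positivity
      calc _ ≤ (2 * M + 4) * θ ^ n :=
            abs_le.2 ⟨by linarith [hZp.1, hZz.2], by linarith [hZp.2, hZz.1]⟩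
        _ ≤ (4 * M + 4) * θ ^ n := mul_le_mul_of_nonneg_right (by linarith) hθn
        _ ≤ _ := mul_le_mul_of_nonneg_left hpow (by linarith)

end IsWeightedWeakSolution

theorem stmt_19
    (t0 t1 r0 N cW CW κ K L : ℝ)
    (hI : t0 < t1) (hr0 : 0 < r0) (hN : 2 < N)
    (hcW : 0 < cW) (hCW : cW ≤ CW) (hκ : 0 < κ) (hK : κ ≤ K) (hL : 0 ≤ L)
    (W A D : ℝ → ℝ) (B : ℝ × ℝ → ℝ)
    (hWm : Measurable W) (hAm : Measurable A) (hBm : Measurable B)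
    (hDm : Measurable D)
    (hW : ∀ r ∈ Set.Ioo 0 r0, cW * r ^ (N - 1) ≤ W r ∧ W r ≤ CW * r ^ (N - 1))
    (hA : ∀ r ∈ Set.Ioo 0 r0, κ ≤ A r ∧ A r ≤ K)
    (hB : ∀ p ∈ Set.Ioo 0 r0 ×ˢ Set.Ioo t0 t1, κ ≤ B p ∧ B p ≤ K)
    (hD : ∀ r ∈ Set.Ioo 0 r0, |D r| ≤ L)
    (Z gr gt : ℝ × ℝ → ℝ)
    (hZm : Measurable Z)
    (hZbd : ∃ M : ℝ, ∀ p ∈ Set.Ioo 0 r0 ×ˢ Set.Ioo t0 t1, |Z p| ≤ M)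
    (hgrm : Measurable gr) (hgtm : Measurable gt)
    (hgL2 : ∀ Kc : Set (ℝ × ℝ), IsCompact Kc →
      Kc ⊆ Set.Ioo 0 r0 ×ˢ Set.Ioo t0 t1 →
      IntegrableOn (fun p => (gr p) ^ 2) Kc ∧
      IntegrableOn (fun p => (gt p) ^ 2) Kc)
    (hweak_r : ∀ Φ : ℝ × ℝ → ℝ, ContDiff ℝ (⊤ : ℕ∞) Φ → HasCompactSupport Φ →
      tsupport Φ ⊆ Set.Ioo 0 r0 ×ˢ Set.Ioo t0 t1 →
      ∫ p in Set.Ioo 0 r0 ×ˢ Set.Ioo t0 t1, Z p * fderiv ℝ Φ p (1, 0)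
        = -∫ p in Set.Ioo 0 r0 ×ˢ Set.Ioo t0 t1, gr p * Φ p)
    (hweak_t : ∀ Φ : ℝ × ℝ → ℝ, ContDiff ℝ (⊤ : ℕ∞) Φ → HasCompactSupport Φ →
      tsupport Φ ⊆ Set.Ioo 0 r0 ×ˢ Set.Ioo t0 t1 →
      ∫ p in Set.Ioo 0 r0 ×ˢ Set.Ioo t0 t1, Z p * fderiv ℝ Φ p (0, 1)
        = -∫ p in Set.Ioo 0 r0 ×ˢ Set.Ioo t0 t1, gt p * Φ p)
    (hweak_eq : ∀ Φ : ℝ × ℝ → ℝ, ContDiff ℝ (⊤ : ℕ∞) Φ → HasCompactSupport Φ →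
      tsupport Φ ⊆ Set.Ioo 0 r0 ×ˢ Set.Ioo t0 t1 →
      ∫ p in Set.Ioo 0 r0 ×ˢ Set.Ioo t0 t1,
        W p.1 * (B p * gt p * fderiv ℝ Φ p (0, 1)
          + A p.1 * gr p * fderiv ℝ Φ p (1, 0)
          - D p.1 * Z p * Φ p) = 0) :
    ∃ α ∈ Set.Ioo (0:ℝ) 1, ∃ Zstar : ℝ × ℝ → ℝ,
      (∀ᵐ p : ℝ × ℝ ∂volume,
        p ∈ Set.Ioo 0 r0 ×ˢ Set.Ioo t0 t1 → Zstar p = Z p) ∧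
      (∀ Kc : Set (ℝ × ℝ), IsCompact Kc →
        Kc ⊆ Set.Ico 0 r0 ×ˢ Set.Ioo t0 t1 →
        ∃ C : ℝ, 0 ≤ C ∧ ∀ p ∈ Kc, ∀ q ∈ Kc,
          |Zstar p - Zstar q| ≤ C * ‖p - q‖ ^ α) := by
  obtain ⟨M, hM⟩ := hZbd
  have hsol : IsWeightedWeakSolution t0 t1 r0 (N - 1) cW CW κ K L (max M 0) W A D B Z gr gt :=
    { one_lt_q := by linarith
      r0_pos := hr0
      cW_pos := hcW
      cW_le := hCW
      κ_pos := hκ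
      κ_le := hK
      L_nonneg := hL
      M_nonneg := le_max_right _ _
      measurable_W := hWm
      measurable_A := hAm
      measurable_B := hBm
      measurable_D := hDm
      measurable_Z := hZm
      measurable_gr := hgrm
      measurable_gt := hgtm
      W_bounds := hW
      A_bounds := hA
      B_bounds := hB
      D_bound := hD
      Z_bound := fun p hp => (hM p hp).trans (le_max_left _ _)
      sq_integrable := hgL2
      weak_r := hweak_r
      weak_t := hweak_t
      weak_eq := hweak_eq }
  exact hsol.exists_holder_representative
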